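/- Let d ≥ 4 be an integer, let 1 ≤ p ≤ 2 and let ε > 0. There exists C_ε (independent of q and r) such that for every odd integer q ≥ 1 and every admissible radius r, the operator norm of H^q_r on ℓ^p(ℤ^d) satisfies ‖H^q_r‖_{ℓ^p→ℓ^p} ≤ C_ε·φ(q)^{2/p−1}·q^{−(d−1)/p′+ε}·gcd(q, r²)^{1/p′}, where p′ = p/(p−1) (with the convention 1/p′ = 0 when p = 1) and φ is Euler's totient function. -/

import Mathlib

open scoped ENNReal NNReal BigOperators
open MeasureTheory

noncomputable section

/-- `e(t) = exp(2πit)`. -/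
def eC (t : ℝ) : ℂ := Complex.exp (2 * Real.pi * Complex.I * t)

/-- `|x|²` for `x ∈ ℤ^d`. -/
def normSqZ {d : ℕ} (x : Fin d → ℤ) : ℤ := ∑ i, (x i) ^ 2

/-- The natural number `r²` of an admissible radius `r`. -/
def radSq (r : ℝ) : ℕ := ⌊r ^ 2⌋₊

/-- `r` is an admissible radius: `r > 0` and `r² ∈ ℕ`. -/
def IsAdmissible (r : ℝ) : Prop := 0 < r ∧ ∃ n : ℕ, r ^ 2 = (n : ℝ)

/-- A set of positive reals is lacunary. -/
def Lacunary (R : Set ℝ) : Prop := ∃ c : ℝ, 1 < c ∧ ∀ r ∈ R, ∀ s ∈ R, r < s → c * r ≤ s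

/-- `N_d(r)`: the number of lattice points on the sphere of radius `r` in `ℤ^d`. -/
def sphereCount (d : ℕ) (r : ℝ) : ℕ := Nat.card {x : Fin d → ℤ // normSqZ x = (radSq r : ℤ)}

/-- The discrete spherical average `A_r f`. -/
def sphAvg (d : ℕ) (r : ℝ) (f : (Fin d → ℤ) → ℂ) (x : Fin d → ℤ) : ℂ :=
  (sphereCount d r : ℂ)⁻¹ *
    ∑' y : Fin d → ℤ, if normSqZ y = (radSq r : ℤ) then f (x - y) else 0

/-- The `ℓ^p(ℤ^d)` norm, valued in `ℝ≥0∞`. -/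
def lpNorm (d : ℕ) (p : ℝ) (f : (Fin d → ℤ) → ℂ) : ℝ≥0∞ :=
  (∑' x : Fin d → ℤ, (‖f x‖₊ : ℝ≥0∞) ^ p) ^ (1 / p)

/-- `(G, B)` is an admissible good/bad prime dichotomy for the set of radii `R`,
with parameter `s`. -/
def GoodBadDichotomy (R : Set ℝ) (G B : Set ℕ) (s : ℝ) : Prop :=
  (∀ p : ℕ, p.Prime → p ∈ G ∪ B) ∧
  (∀ p ∈ G, Nat.Prime p) ∧
  (∀ p ∈ B, Nat.Prime p) ∧
  (∀ p ∈ G, ∀ r ∈ R, IsUnit ((radSq r : ZMod p))) ∧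
  (∀ ε : ℝ, 0 < ε → ∃ C : ℝ, 0 < C ∧ ∀ p ∈ G,
    (({z : ZMod p | ∃ r ∈ R, z = (radSq r : ZMod p)}.ncard : ℝ)) ≤ C * (p : ℝ) ^ ε) ∧
  Summable (fun q : B => (q : ℝ) ^ (-s))

/-- `∏_{i ≤ T} p_i`, the product of the first `⌊T⌋` primes. -/
def primorialUpTo (T : ℝ) : ℕ := ∏ i ∈ Finset.range ⌊T⌋₊, Nat.nth Nat.Prime i

/-- `∏_{j₀ ≤ i ≤ T} p_i` where `p_i` is the `i`-th prime (`1`-indexed). -/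
def prodPrimesFrom (j₀ : ℕ) (T : ℝ) : ℕ :=
  ∏ i ∈ Finset.Icc j₀ ⌊T⌋₊, Nat.nth Nat.Prime (i - 1)

/-- `n_j = 1 + ∏_{i ≤ 2^{j^η}} p_i`. -/
def nseq (η : ℝ) (j : ℕ) : ℕ := 1 + primorialUpTo ((2 : ℝ) ^ ((j : ℝ) ^ η))

/-- The normalized Kloosterman sum `K(q, N; n)`. -/
def kloosterman (d q : ℕ) (N : ℤ) (n : Fin d → ℤ) : ℂ :=
  ((q : ℂ)⁻¹) ^ d *
    ∑ u : Fin q,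
      if Nat.Coprime (u : ℕ) q then
        eC (-(((u : ℕ) : ℝ) * (N : ℝ)) / q) *
          ∑ b : Fin d → Fin q,
            eC ((((u : ℕ) : ℝ) * ∑ i, (((b i : ℕ) : ℝ)) ^ 2
                + ∑ i, ((b i : ℕ) : ℝ) * ((n i : ℝ))) / q)
      else 0

/-- The Ramanujan sum `c_q(N)`. -/
def ramanujanSum (q : ℕ) (N : ℤ) : ℂ :=
  ∑ u : Fin q, if Nat.Coprime (u : ℕ) q then eC ((((u : ℕ) : ℝ) * (N : ℝ)) / q) else 0

/-- The measure `dσ_r = (2 r^{d-1})⁻¹ ℋ^{d-1} ⌞ {|x| = r}` on `ℝ^d`. -/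
def sphMeasure (d : ℕ) (r : ℝ) : Measure (EuclideanSpace ℝ (Fin d)) :=
  (ENNReal.ofReal (2 * r ^ (d - 1)))⁻¹ •
    (μH[((d : ℝ) - 1)] : Measure (EuclideanSpace ℝ (Fin d))).restrict (Metric.sphere 0 r)

/-- The Fourier transform `𝓕dσ_r(ξ) = ∫ e(x·ξ) dσ_r(x)`. -/
def fourierSphMeasure (d : ℕ) (r : ℝ) (ξ : Fin d → ℝ) : ℂ :=
  ∫ x : EuclideanSpace ℝ (Fin d), eC (∑ i, x i * ξ i) ∂(sphMeasure d r)

/-- `Ψ` is a smooth bump: supported in `[-1/4,1/4]^d` and `1` on `[-1/8,1/8]^d`. -/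
def IsBump (d : ℕ) (Ψ : (Fin d → ℝ) → ℝ) : Prop :=
  ContDiff ℝ (⊤ : ℕ∞) Ψ ∧
  (∀ x, x ∉ Set.Icc (fun _ => -(1/4 : ℝ)) (fun _ => (1/4 : ℝ)) → Ψ x = 0) ∧
  (∀ x ∈ Set.Icc (fun _ => -(1/8 : ℝ)) (fun _ => (1/8 : ℝ)), Ψ x = 1)

/-- `Ψ'` is a smooth cutoff with `1_{[-1/4,1/4]^d} ≤ Ψ' ≤ 1_{[-1/2,1/2]^d}`. -/
def IsCutoff (d : ℕ) (Ψ' : (Fin d → ℝ) → ℝ) : Prop :=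
  ContDiff ℝ (⊤ : ℕ∞) Ψ' ∧
  (∀ x, Set.indicator (Set.Icc (fun _ => -(1/4 : ℝ)) (fun _ => (1/4 : ℝ)))
      (fun _ => (1 : ℝ)) x ≤ Ψ' x) ∧
  (∀ x, Ψ' x ≤ Set.indicator (Set.Icc (fun _ => -(1/2 : ℝ)) (fun _ => (1/2 : ℝ)))
      (fun _ => (1 : ℝ)) x)

/-- The Fourier transform of `f : ℤ^d → ℂ`, `f̂(ξ) = ∑_n f(n) e(n·ξ)`. -/
def ftZ {d : ℕ} (f : (Fin d → ℤ) → ℂ) (ξ : Fin d → ℝ) : ℂ :=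
  ∑' n : Fin d → ℤ, f n * eC (∑ i, (n i : ℝ) * ξ i)

/-- The Fourier multiplier operator on `ℤ^d` with 1-periodic multiplier `m`. -/
def mulOp (d : ℕ) (m : (Fin d → ℝ) → ℂ) (f : (Fin d → ℤ) → ℂ) (x : Fin d → ℤ) : ℂ :=
  ∫ ξ in Set.Icc (0 : Fin d → ℝ) 1, m ξ * ftZ f ξ * eC (-∑ i, (x i : ℝ) * ξ i)

/-- The multiplier of `H^q_r`. -/
def mHqr (d q : ℕ) (r : ℝ) (Ψ : (Fin d → ℝ) → ℝ) (ξ : Fin d → ℝ) : ℂ :=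
  ∑' n : Fin d → ℤ,
    kloosterman d q ((radSq r : ℤ)) n * ((Ψ (fun i => (q : ℝ) * ξ i - (n i : ℝ)) : ℝ) : ℂ) *
      fourierSphMeasure d r (fun i => ξ i - (n i : ℝ) / q)

/-- The multiplier of `U^{1,q}_r` for `q = q₁q₂`. -/
def mU1 (d q₁ q₂ : ℕ) (r : ℝ) (Ψ' : (Fin d → ℝ) → ℝ) (ξ : Fin d → ℝ) : ℂ :=
  ∑' n : Fin d → ℤ,
    kloosterman d q₁ ((radSq r : ℤ)) n *
      ((Ψ' (fun i => ((q₁ * q₂ : ℕ) : ℝ) * ξ i - (n i : ℝ)) : ℝ) : ℂ)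

/-- The `ℓ^p(ℤ^d) → ℓ^p(ℤ^d)` operator norm (as a supremum over finitely supported
functions in the unit ball). -/
def opNormLp (d : ℕ) (p : ℝ) (T : ((Fin d → ℤ) → ℂ) → ((Fin d → ℤ) → ℂ)) : ℝ≥0∞ :=
  ⨆ f : {f : (Fin d → ℤ) → ℂ // (Function.support f).Finite ∧ lpNorm d p f ≤ 1},
    lpNorm d p (T f.1)

/-- `𝓕Ψ_q(ζ) = ∫_{ℝ^d} Ψ(qy) e(y·ζ) dy`. -/
def ftPsiQ (d q : ℕ) (Ψ : (Fin d → ℝ) → ℝ) (ζ : Fin d → ℝ) : ℂ :=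
  ∫ y : Fin d → ℝ, ((Ψ (fun i => (q : ℝ) * y i) : ℝ) : ℂ) * eC (∑ i, y i * ζ i)

/-- The kernel `K^q_r(x) = c_q(r² - |x|²) · ((𝓕Ψ_q) * dσ_r)(x)`. -/
def kernelK (d q : ℕ) (r : ℝ) (Ψ : (Fin d → ℝ) → ℝ) (x : Fin d → ℤ) : ℂ :=
  ramanujanSum q ((radSq r : ℤ) - normSqZ x) *
    ∫ y : EuclideanSpace ℝ (Fin d), ftPsiQ d q Ψ (fun i => ((x i : ℝ)) - y i) ∂(sphMeasure d r)

/-- Discrete convolution on `ℤ^d`. -/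
def dconv {d : ℕ} (f g : (Fin d → ℤ) → ℂ) (x : Fin d → ℤ) : ℂ :=
  ∑' y : Fin d → ℤ, f y * g (x - y)

/-- `Ã_r f = f * σ_r` with `σ_r = r^{2-d} 1_{sphere}`. -/
def tildeAvg (d : ℕ) (r : ℝ) (f : (Fin d → ℤ) → ℂ) (x : Fin d → ℤ) : ℂ :=
  (r : ℂ) ^ ((2 : ℤ) - (d : ℤ)) *
    ∑' y : Fin d → ℤ, if normSqZ y = (radSq r : ℤ) then f (x - y) else 0

/-- The error operator `E_r f = Ã_r f - ∑_{1 ≤ q ≤ r} C^q_r f`. -/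
def errOp (d : ℕ) (r : ℝ) (Ψ : (Fin d → ℝ) → ℝ) (f : (Fin d → ℤ) → ℂ) (x : Fin d → ℤ) : ℂ :=
  tildeAvg d r f x - ∑ q ∈ Finset.Icc 1 ⌊r⌋₊, dconv f (kernelK d q r Ψ) x

/-- The Euclidean norm `|x|` of `x ∈ ℤ^d`. -/
def euclNormZ {d : ℕ} (x : Fin d → ℤ) : ℝ := Real.sqrt (∑ i, ((x i : ℝ)) ^ 2)

open Polynomial in
/-- The polynomial `(X ^ p - X) ^ 2 - e` over `𝔽_p`. -/
def artinSchreierQuad (p : ℕ) (e : ZMod p) : (ZMod p)[X] := (X ^ p - X) ^ 2 - C e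

section Stepanov

open Polynomial

variable {p : ℕ} [hp : Fact p.Prime]

lemma natDegree_X_pow_sub_X : (X ^ p - X : (ZMod p)[X]).natDegree = p :=
  FiniteField.X_pow_card_sub_X_natDegree_eq _ hp.out.one_lt

lemma natDegree_artinSchreierQuad (e : ZMod p) : (artinSchreierQuad p e).natDegree = 2 * p := by
  rw [artinSchreierQuad, natDegree_sub_C, natDegree_pow, natDegree_X_pow_sub_X]

lemma squarefree_artinSchreierQuad (hp2 : p ≠ 2) {e : ZMod p} (he : e ≠ 0) :
    Squarefree (artinSchreierQuad p e) := by
  apply Polynomial.Separable.squarefree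
  have h2 : (2 : ZMod p) ≠ 0 := by
    exact Ring.two_ne_zero (by rwa [ZMod.ringChar_zmod_n])
  have hd : derivative (artinSchreierQuad p e) = - C 2 * (X ^ p - X) := by
    simp [artinSchreierQuad, derivative_pow]
  refine ⟨C (-e⁻¹), C (-e⁻¹ * 2⁻¹) * (X ^ p - X), ?_⟩
  rw [hd, artinSchreierQuad]
  have h1 : (C (2⁻¹ : ZMod p)) * C 2 = 1 := by
    rw [← C_mul, inv_mul_cancel₀ h2, C_1]
  have h3 : (C (e⁻¹ : ZMod p)) * C e = 1 := by
    rw [← C_mul, inv_mul_cancel₀ he, C_1]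
  simp only [C_mul, C_neg]
  linear_combination (C e⁻¹ * (X ^ p - X)^2) * h1 + h3

lemma eq_zero_of_sq_eq_C_mul_mul_sq {F : Type*} [Field F] {f : F[X]} (hf : Squarefree f)
    (hd : 0 < f.natDegree) {c : F} (hc : c ≠ 0) :
    ∀ (n : ℕ) (r s : F[X]), s.natDegree ≤ n → r ^ 2 = C c * f * s ^ 2 → s = 0 := by
  have hf0 : f ≠ 0 := by rintro rfl; simp at hd
  have hu : IsUnit (C c : F[X]) := isUnit_C.2 hc.isUnit
  intro n
  induction n using Nat.strong_induction_on with
  | _ n ih =>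
  intro r s hs h
  have h1 : f ∣ r := by
    rw [← hf.dvd_pow_iff_dvd two_ne_zero, h]
    exact Dvd.intro_left (C c) rfl |>.mul_right _
  obtain ⟨t, rfl⟩ := h1
  have h2 : f * t ^ 2 = C c * s ^ 2 := by
    apply mul_left_cancel₀ hf0
    linear_combination h
  have h3 : f ∣ s := by
    rw [← hf.dvd_pow_iff_dvd two_ne_zero,
      ← hu.dvd_mul_left, ← h2]
    exact dvd_mul_right _ _
  obtain ⟨v, rfl⟩ := h3
  have h4 : t ^ 2 = C c * f * v ^ 2 := by
    apply mul_left_cancel₀ hf0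
    linear_combination h2
  by_contra hv
  have hv0 : v ≠ 0 := by rintro rfl; simp at hv
  rw [natDegree_mul hf0 hv0] at hs
  exact hv0 (ih v.natDegree (by omega) t v le_rfl h4)

lemma expand_pow_eq_pow (r : (ZMod p)[X]) (n : ℕ) : expand (ZMod p) (p ^ n) r = r ^ p ^ n := by
  induction n with
  | zero => simp
  | succ k ih => rw [pow_succ, mul_comm, expand_mul, ih, ZMod.expand_card, ← pow_mul, mul_comm]

/-- The Stepanov auxiliary polynomials do not vanish. -/
lemma stepanov_nonvanishing (hp2 : p ≠ 2) {e : ZMod p} (he : e ≠ 0) (n h J : ℕ)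
    (hQ : p ^ n = 2 * h + 1) (r s : ℕ → (ZMod p)[X])
    (hr : ∀ j, (r j).natDegree ≤ h) (hs : ∀ j, (s j).natDegree + p ≤ h)
    (h0 : ∑ j ∈ Finset.range J, (r j + s j * artinSchreierQuad p e ^ (h + 1)) * X ^ (j * p ^ n)
      = 0) :
    ∀ j < J, r j = 0 ∧ s j = 0 := by
  set f := artinSchreierQuad p e with hf
  have hfd : f.natDegree = 2 * p := natDegree_artinSchreierQuad e
  have hp0 := hp.out.pos
  intro k
  induction k using Nat.strong_induction_on with
  | _ k ih =>
  intro hk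
  set Q := p ^ n with hQd
  have hX0 : (X : (ZMod p)[X]) ≠ 0 := X_ne_zero
  have hdvd : X ^ Q ∣ r k + s k * f ^ (h + 1) := by
    have h1 : X ^ ((k + 1) * Q) ∣ (r k + s k * f ^ (h + 1)) * X ^ (k * Q) := by
      have hmem : k ∈ Finset.range J := Finset.mem_range.2 hk
      rw [← Finset.add_sum_erase _ _ hmem, add_eq_zero_iff_eq_neg] at h0
      rw [h0, dvd_neg]
      apply Finset.dvd_sum
      intro j hj
      obtain ⟨hjk, hjJ⟩ := Finset.mem_erase.1 hj
      rcases lt_or_gt_of_ne hjk with hlt | hgt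
      · obtain ⟨a, b⟩ := ih j hlt (Finset.mem_range.1 hjJ)
        simp [a, b]
      · exact (pow_dvd_pow _ (Nat.mul_le_mul_right _ hgt)).mul_left _
    rw [add_mul, one_mul, add_comm, pow_add] at h1
    exact (mul_dvd_mul_iff_right (pow_ne_zero _ hX0)).1 h1
  have hfQ : X ^ Q ∣ f ^ Q - C (-e) := by
    have h1 : X ∣ f - C (-e) := by
      rw [X_dvd_iff]
      simp [hf, artinSchreierQuad, coeff_zero_eq_eval_zero, hp0.ne']
    have h2 := pow_dvd_pow_of_dvd h1 Q
    rwa [hQd, sub_pow_char_pow, ← C_pow, ZMod.pow_card_pow] at h2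
  have h2 : X ^ Q ∣ r k ^ 2 - C (-e) * f * s k ^ 2 := by
    have e1 : r k ^ 2 - C (-e) * f * s k ^ 2 =
        (r k + s k * f ^ (h + 1)) * (r k - s k * f ^ (h + 1)) +
          (f ^ Q - C (-e)) * (f * s k ^ 2) := by
      rw [hQ]; ring
    rw [e1]
    exact dvd_add (hdvd.mul_right _) (hfQ.mul_right _)
  have h3 : r k ^ 2 - C (-e) * f * s k ^ 2 = 0 := by
    apply eq_zero_of_dvd_of_natDegree_lt h2
    rw [natDegree_X_pow, hQ, Nat.lt_succ_iff]
    refine (natDegree_sub_le _ _).trans (max_le ?_ ?_)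
    · exact natDegree_pow_le.trans (Nat.mul_le_mul_left _ (hr k))
    · refine natDegree_mul_le.trans ?_
      have a := natDegree_C_mul_le (-e) f
      have b := natDegree_pow_le (p := s k) (n := 2)
      have := hs k
      omega
  have h4 : s k = 0 := eq_zero_of_sq_eq_C_mul_mul_sq (squarefree_artinSchreierQuad hp2 he)
    (by rw [natDegree_artinSchreierQuad]; omega) (neg_ne_zero.2 he) _ (r k) (s k) le_rfl
    (sub_eq_zero.1 h3)
  refine ⟨?_, h4⟩
  rw [h4] at h3
  simpa using h3

/-- Existence of nontrivial coefficients for the Stepanov auxiliary polynomial. -/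
lemma stepanov_exists (e a : ZMod p) (n h : ℕ) (hQ : p ^ n = 2 * h + 1) (hph : p < h) :
    ∃ r s : ℕ → (ZMod p)[X], (∀ j, (r j).natDegree ≤ h) ∧ (∀ j, (s j).natDegree + p ≤ h) ∧
      (∃ j < h + p, r j ≠ 0 ∨ s j ≠ 0) ∧
      ∑ j ∈ Finset.range (h + p),
        (r j ^ p ^ n + C a * s j ^ p ^ n * artinSchreierQuad p e ^ (h + 1)) * X ^ j = 0 := by
  set f := artinSchreierQuad p e with hf
  set J := h + p with hJ
  have hp0 := hp.out.pos
  let L0 : ((Fin J → degreeLT (ZMod p) (h + 1)) × (Fin J → degreeLT (ZMod p) (h + 1 - p)))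
      →ₗ[(ZMod p)] (ZMod p)[X] :=
    { toFun := fun v => ∑ j : Fin J, (expand (ZMod p) (p ^ n) (v.1 j : (ZMod p)[X]) +
        C a * expand (ZMod p) (p ^ n) (v.2 j : (ZMod p)[X]) * f ^ (h + 1)) * X ^ (j : ℕ)
      map_add' := by
        intro v w
        rw [← Finset.sum_add_distrib]
        refine Finset.sum_congr rfl fun j _ => ?_
        simp only [Prod.fst_add, Prod.snd_add, Pi.add_apply, Submodule.coe_add, map_add]
        ring
      map_smul' := by
        intro c v
        rw [Finset.smul_sum]
        refine Finset.sum_congr rfl fun j _ => ?_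
        simp only [Prod.smul_fst, Prod.smul_snd, Pi.smul_apply, Submodule.coe_smul, map_mul,
          expand_C, smul_eq_C_mul, RingHom.id_apply]
        ring }
  have hdegLT : ∀ (m : ℕ) (q : (ZMod p)[X]), 0 < m →
      q ∈ degreeLT (ZMod p) m → q.natDegree ≤ m - 1 := by
    intro m q hm hq
    rw [mem_degreeLT] at hq
    by_cases h0 : q = 0
    · simp [h0]
    · have := (natDegree_lt_iff_degree_lt h0).2 hq
      omega
  have hL0 : ∀ v, L0 v ∈ degreeLT (ZMod p) ((2 * h + 1) * h + p + J) := by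
    intro v
    show (∑ j : Fin J, _) ∈ _
    refine Submodule.sum_mem _ fun j _ => ?_
    rw [mem_degreeLT]
    have hj := j.2
    refine lt_of_le_of_lt (degree_le_natDegree) ?_
    norm_cast
    have h1 : (expand (ZMod p) (p ^ n) (v.1 j : (ZMod p)[X])).natDegree ≤ (2 * h + 1) * h := by
      rw [natDegree_expand, hQ, mul_comm]
      exact Nat.mul_le_mul_left _ (hdegLT _ _ (by omega) (v.1 j).2)
    have h2 : (C a * expand (ZMod p) (p ^ n) (v.2 j : (ZMod p)[X]) * f ^ (h + 1)).natDegree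
        ≤ (2 * h + 1) * h + p := by
      refine natDegree_mul_le.trans ?_
      have a1 := natDegree_C_mul_le a (expand (ZMod p) (p ^ n) (v.2 j : (ZMod p)[X]))
      have a2 := natDegree_pow_le (p := f) (n := h + 1)
      have a5 : f.natDegree = 2 * p := natDegree_artinSchreierQuad e
      rw [a5] at a2
      rw [natDegree_expand, show ((v.2 j : (ZMod p)[X]).natDegree * p ^ n) = _ * (2 * h + 1) by rw [hQ]] at a1
      have a3 := Nat.mul_le_mul_right (2 * h + 1) (hdegLT _ _ (by omega) (v.2 j).2)
      obtain ⟨b, hb⟩ := Nat.exists_eq_add_of_lt hph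
      have a4 : h + 1 - p - 1 = b + 1 := by omega
      rw [a4] at a3
      calc _ ≤ (b + 1) * (2 * h + 1) + (h + 1) * (2 * p) := add_le_add (a1.trans a3) a2
        _ = (2 * h + 1) * h + p := by rw [hb]; ring
    have h3 := natDegree_add_le (expand (ZMod p) (p ^ n) (v.1 j : (ZMod p)[X]))
      (C a * expand (ZMod p) (p ^ n) (v.2 j : (ZMod p)[X]) * f ^ (h + 1))
    have h4 := natDegree_mul_le (p := expand (ZMod p) (p ^ n) (v.1 j : (ZMod p)[X]) +
      C a * expand (ZMod p) (p ^ n) (v.2 j : (ZMod p)[X]) * f ^ (h + 1)) (q := (X ^ (j : ℕ) : (ZMod p)[X]))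
    rw [natDegree_X_pow] at h4
    have h5 := max_le (h1.trans (Nat.le_add_right _ p)) h2
    omega
  let L : ((Fin J → degreeLT (ZMod p) (h + 1)) × (Fin J → degreeLT (ZMod p) (h + 1 - p)))
      →ₗ[(ZMod p)] degreeLT (ZMod p) ((2 * h + 1) * h + p + J) := L0.codRestrict _ hL0
  have hfr : ∀ m, Module.finrank (ZMod p) (degreeLT (ZMod p) m) = m := fun m => by
    rw [(degreeLTEquiv (ZMod p) m).finrank_eq, Module.finrank_fin_fun]
  have : ∀ m, FiniteDimensional (ZMod p) (degreeLT (ZMod p) m) := fun m =>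
    Module.Finite.equiv (degreeLTEquiv (ZMod p) m).symm
  have hlt : Module.finrank (ZMod p) (degreeLT (ZMod p) ((2 * h + 1) * h + p + J)) <
      Module.finrank (ZMod p) ((Fin J → degreeLT (ZMod p) (h + 1)) ×
        (Fin J → degreeLT (ZMod p) (h + 1 - p))) := by
    rw [hfr, Module.finrank_prod, Module.finrank_pi_fintype, Module.finrank_pi_fintype]
    simp only [hfr, Finset.sum_const, Finset.card_univ, Fintype.card_fin, smul_eq_mul]
    obtain ⟨b, hb⟩ := Nat.exists_eq_add_of_lt hph
    have a4 : h + 1 - p = b + 2 := by omega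
    rw [a4, hJ, hb]
    nlinarith
  have hker := LinearMap.ker_ne_bot_of_finrank_lt hlt (f := L)
  obtain ⟨v, hv, hv0⟩ := (Submodule.ne_bot_iff _).1 hker
  have hLv : L0 v = 0 := by
    have := LinearMap.mem_ker.1 hv
    exact congrArg Subtype.val this
  refine ⟨fun j => if hj : j < J then v.1 ⟨j, hj⟩ else 0, fun j => if hj : j < J then v.2 ⟨j, hj⟩ else 0,
    ?_, ?_, ?_, ?_⟩
  · intro j
    dsimp only
    split_ifs with hj
    · exact hdegLT _ _ (by omega) (v.1 ⟨j, hj⟩).2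
    · simp
  · intro j
    dsimp only
    split_ifs with hj
    · have := hdegLT _ _ (by omega) (v.2 ⟨j, hj⟩).2
      omega
    · simp; omega
  · by_contra! hcon
    apply hv0
    ext j : 3
    · have := (hcon j.1 j.2).1
      simpa using this
    · have := (hcon j.1 j.2).2
      simpa using this
  · rw [Finset.sum_range, ← hLv]
    refine Finset.sum_congr rfl fun j _ => ?_
    simp [expand_pow_eq_pow]

/-- Stepanov's bound for the number of `x` with `f(x) ^ ((Q² - 1) / 2) = a`. -/
lemma stepanov_card_le (hp2 : p ≠ 2) {e : ZMod p} (he : e ≠ 0) (a : ZMod p) (n h : ℕ)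
    (hQ : p ^ n = 2 * h + 1) (hph : p < h) {K : Type*} [Field K] [Fintype K] [DecidableEq K]
    [Algebra (ZMod p) K] (hK : Fintype.card K = (p ^ n) ^ 2) :
    2 * (Finset.univ.filter fun x : K =>
      (aeval x (artinSchreierQuad p e)) ^ ((p ^ n) ^ 2 / 2) = algebraMap (ZMod p) K a).card ≤
      (p ^ n) ^ 2 + 6 * p * p ^ n := by
  obtain ⟨r, s, hr, hs, hne, hH⟩ := stepanov_exists e a n h hQ hph
  set f := artinSchreierQuad p e with hf
  set G := ∑ j ∈ Finset.range (h + p), (r j + s j * f ^ (h + 1)) * X ^ (j * p ^ n) with hG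
  have hG0 : G ≠ 0 := by
    intro h0
    obtain ⟨j, hj, hj'⟩ := hne
    have := stepanov_nonvanishing hp2 he n h (h + p) hQ r s hr hs h0 j hj
    tauto
  have : CharP K p := charP_of_injective_algebraMap (algebraMap (ZMod p) K).injective p
  have hroot : ∀ x : K, (aeval x f) ^ ((p ^ n) ^ 2 / 2) = algebraMap (ZMod p) K a →
      aeval x G = 0 := by
    intro x hx
    have h1 : (aeval x G) ^ p ^ n = 0 := by
      have h2 := congrArg (aeval x) hH
      rw [map_zero] at h2
      rw [← h2, hG, map_sum, sum_pow_char_pow, map_sum]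
      refine Finset.sum_congr rfl fun j _ => ?_
      have hxQ : x ^ ((p ^ n) ^ 2) = x := by rw [← hK, FiniteField.pow_card]
      have e1 : (x ^ (j * p ^ n)) ^ p ^ n = x ^ j := by
        rw [← pow_mul, mul_assoc, ← sq, mul_comm, pow_mul, hxQ]
      have e2 : ((aeval x f) ^ (h + 1)) ^ p ^ n =
          algebraMap (ZMod p) K a * (aeval x f) ^ (h + 1) := by
        rw [← hx, ← pow_mul, ← pow_add]
        congr 1
        have : (p ^ n) ^ 2 / 2 = 2 * h * (h + 1) := by
          rw [hQ]
          have : (2 * h + 1) ^ 2 = 2 * (2 * h * (h + 1)) + 1 := by ring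
          omega
        rw [this, hQ]; ring
      simp only [map_mul, map_add, map_pow, aeval_X, aeval_C]
      rw [mul_pow, add_pow_char_pow, mul_pow, e1, e2]
      ring
    exact pow_eq_zero_iff (pow_ne_zero _ hp.out.ne_zero) |>.1 h1
  have hdeg : G.natDegree ≤ h + 2 * p * (h + 1) + (h + p) * p ^ n := by
    apply natDegree_sum_le_of_forall_le
    intro j hj
    have hj := Finset.mem_range.1 hj
    refine natDegree_mul_le.trans (add_le_add ?_ ?_)
    · refine (natDegree_add_le _ _).trans (max_le ((hr j).trans (by omega)) ?_)
      refine natDegree_mul_le.trans (add_le_add ?_ ?_)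
      · have := hs j; omega
      · refine natDegree_pow_le.trans ?_
        rw [hf, natDegree_artinSchreierQuad, mul_comm]
    · rw [natDegree_X_pow]
      exact Nat.mul_le_mul_right _ hj.le
  have hcard : (Finset.univ.filter fun x : K =>
      (aeval x f) ^ ((p ^ n) ^ 2 / 2) = algebraMap (ZMod p) K a).card ≤ G.natDegree := by
    have hGm : G.map (algebraMap (ZMod p) K) ≠ 0 := by
      rwa [Polynomial.map_ne_zero_iff (algebraMap (ZMod p) K).injective]
    calc _ ≤ (G.map (algebraMap (ZMod p) K)).roots.toFinset.card := by
          apply Finset.card_le_card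
          intro x hx
          rw [Finset.mem_filter] at hx
          rw [Multiset.mem_toFinset, mem_roots hGm, IsRoot, eval_map_algebraMap]
          exact hroot x hx.2
      _ ≤ _ := Multiset.toFinset_card_le _
      _ ≤ _ := (card_roots' _).trans natDegree_map_le
  have := hcard.trans hdeg
  rw [hQ] at this ⊢
  nlinarith [hp.out.two_le]

end Stepanov


section PointCount

open Polynomial

variable {p : ℕ} [hp : Fact p.Prime]

lemma aeval_artinSchreierQuad {K : Type*} [Field K] [Algebra (ZMod p) K] (e : ZMod p) (x : K) :
    aeval x (artinSchreierQuad p e) = (x ^ p - x) ^ 2 - algebraMap (ZMod p) K e := by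
  simp [artinSchreierQuad]

lemma card_quadratic_roots {K : Type*} [Field K] [Fintype K] [DecidableEq K]
    (h2 : ringChar K ≠ 2) (t D : K) :
    ((Finset.univ.filter fun u : K => u ^ 2 + D = t * u).card : ℤ) =
      quadraticChar K (t ^ 2 - 4 * D) + 1 := by
  have h2' : (2 : K) ≠ 0 := Ring.two_ne_zero h2
  rw [← quadraticChar_card_sqrts h2]
  norm_cast
  refine Finset.card_bij (fun u _ => 2 * u - t) ?_ ?_ ?_
  · intro u hu
    have hu := (Finset.mem_filter.1 hu).2
    simp only [Set.mem_toFinset, Set.mem_ofPred_eq]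
    linear_combination 4 * hu
  · intro u _ v _ h
    have : 2 * u = 2 * v := by linear_combination h
    exact mul_left_cancel₀ h2' this
  · intro v hv
    simp only [Set.mem_toFinset, Set.mem_ofPred_eq] at hv
    refine ⟨2⁻¹ * (v + t), ?_, ?_⟩
    · rw [Finset.mem_filter]
      refine ⟨Finset.mem_univ _, ?_⟩
      have h4 : (2 : K) * 2⁻¹ = 1 := mul_inv_cancel₀ h2'
      linear_combination 2⁻¹ ^ 2 * hv + (2⁻¹ * (t ^ 2 + v * t) - D * (1 + 2 * 2⁻¹)) * h4
    · field_simp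
      ring

lemma card_artinSchreier_le {K : Type*} [Field K] [Fintype K] [DecidableEq K]
    [Algebra (ZMod p) K] (w : K) :
    (Finset.univ.filter fun x : K => x ^ p - x = w).card ≤
      if Algebra.trace (ZMod p) K w = 0 then p else 0 := by
  have : CharP K p := charP_of_injective_algebraMap (algebraMap (ZMod p) K).injective p
  split_ifs with h
  · have hdeg : (X ^ p - X - C w : K[X]).natDegree = p := by
      rw [natDegree_sub_C]
      exact FiniteField.X_pow_card_sub_X_natDegree_eq _ hp.out.one_lt
    have h0 : (X ^ p - X - C w : K[X]) ≠ 0 := by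
      intro h0
      rw [h0, natDegree_zero] at hdeg
      exact hp.out.ne_zero hdeg.symm
    calc _ ≤ (X ^ p - X - C w : K[X]).roots.toFinset.card := by
          apply Finset.card_le_card
          intro x hx
          rw [Finset.mem_filter] at hx
          rw [Multiset.mem_toFinset, mem_roots h0, IsRoot]
          simp [hx.2]
      _ ≤ _ := Multiset.toFinset_card_le _
      _ ≤ _ := card_roots' _
      _ = p := hdeg
  · rw [Nat.le_zero, Finset.card_eq_zero, Finset.filter_eq_empty_iff]
    rintro x - rfl
    apply h
    have h1 := Algebra.trace_eq_of_algEquiv (FiniteField.frobeniusAlgEquivOfAlgebraic (ZMod p) K) x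
    rw [FiniteField.coe_frobeniusAlgEquivOfAlgebraic, ZMod.card] at h1
    rw [map_sub, h1, sub_self]

/-- A lower bound for the number of points with trace zero, from Stepanov's method. -/
lemma card_trace_eq_zero_ge (hp2 : p ≠ 2) {D : ZMod p} (hD : D ≠ 0) (n h : ℕ)
    (hQ : p ^ n = 2 * h + 1) (hph : p < h) {K : Type*} [Field K] [Fintype K] [DecidableEq K]
    [Algebra (ZMod p) K] (hK : Fintype.card K = (p ^ n) ^ 2) :
    (p ^ n) ^ 2 ≤ p * (Finset.univ.filter fun u : K => u ≠ 0 ∧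
      Algebra.trace (ZMod p) K (u + algebraMap _ K D * u⁻¹) = 0).card + 6 * p * p ^ n + 2 * p := by
  have : CharP K p := charP_of_injective_algebraMap (algebraMap (ZMod p) K).injective p
  have hK2 : ringChar K ≠ 2 := by rwa [ringChar.eq K p]
  have h4 : (4 : ZMod p) ≠ 0 := by
    have : (2 : ZMod p) ≠ 0 := Ring.two_ne_zero (by rwa [ZMod.ringChar_zmod_n])
    rw [show (4 : ZMod p) = 2 * 2 by norm_num]
    exact mul_ne_zero this this
  have he : 4 * D ≠ 0 := mul_ne_zero h4 hD
  have hD' : algebraMap (ZMod p) K D ≠ 0 := by simpa using hD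
  set f := artinSchreierQuad p (4 * D) with hf
  have hneg := stepanov_card_le hp2 he (-1) n h hQ hph hK
  rw [← hf] at hneg
  have hzero : (Finset.univ.filter fun x : K => aeval x f = 0).card ≤ 2 * p := by
    have hf0 : f.map (algebraMap (ZMod p) K) ≠ 0 := by
      rw [Polynomial.map_ne_zero_iff (algebraMap (ZMod p) K).injective]
      intro h0
      have := natDegree_artinSchreierQuad (4 * D)
      rw [← hf, h0, natDegree_zero] at this
      have := hp.out.pos
      omega
    calc _ ≤ (f.map (algebraMap (ZMod p) K)).roots.toFinset.card := by
          apply Finset.card_le_card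
          intro x hx
          rw [Finset.mem_filter] at hx
          rw [Multiset.mem_toFinset, mem_roots hf0, IsRoot, eval_map_algebraMap]
          exact hx.2
      _ ≤ _ := Multiset.toFinset_card_le _
      _ ≤ _ := (card_roots' _).trans natDegree_map_le
      _ = 2 * p := natDegree_artinSchreierQuad _
  have hM1 : 2 * (p ^ n) ^ 2 ≤ (∑ x : K, (Finset.univ.filter fun u : K =>
        u ^ 2 + algebraMap _ K D = (x ^ p - x) * u).card)
      + 2 * (Finset.univ.filter fun x : K =>
        (aeval x f) ^ ((p ^ n) ^ 2 / 2) = algebraMap (ZMod p) K (-1)).card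
      + (Finset.univ.filter fun x : K => aeval x f = 0).card := by
    rw [← hK]
    have e1 : 2 * Fintype.card K = ∑ x : K, 2 := by simp [mul_comm]
    rw [e1, Finset.card_filter, Finset.card_filter, Finset.mul_sum, ← Finset.sum_add_distrib,
      ← Finset.sum_add_distrib]
    refine Finset.sum_le_sum fun x _ => ?_
    zify
    rw [card_quadratic_roots hK2]
    have e2 : (x ^ p - x) ^ 2 - 4 * algebraMap _ K D = aeval x f := by
      rw [hf, aeval_artinSchreierQuad, map_mul, map_ofNat]
    rw [e2]
    by_cases h0 : aeval x f = 0
    · simp only [h0, if_true, MulChar.map_zero]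
      split_ifs <;> norm_num
    · rcases quadraticChar_dichotomy h0 with h1 | h1
      · rw [h1]
        split_ifs <;> norm_num
      · rw [h1, if_pos]
        · split_ifs
          norm_num
        · have := quadraticChar_eq_pow_of_char_ne_two' hK2 (aeval x f)
          rw [h1] at this
          rw [← this]
          simp
  have hM2 : (∑ x : K, (Finset.univ.filter fun u : K =>
        u ^ 2 + algebraMap _ K D = (x ^ p - x) * u).card) ≤
      p * (Finset.univ.filter fun u : K => u ≠ 0 ∧
        Algebra.trace (ZMod p) K (u + algebraMap _ K D * u⁻¹) = 0).card := by
    simp_rw [Finset.card_filter]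
    rw [Finset.sum_comm, Finset.mul_sum]
    refine Finset.sum_le_sum fun u _ => ?_
    rw [← Finset.card_filter]
    by_cases hu : u = 0
    · subst hu
      simp [hD']
    · have e3 : (Finset.univ.filter fun x : K => u ^ 2 + algebraMap _ K D = (x ^ p - x) * u) =
          (Finset.univ.filter fun x : K => x ^ p - x = u + algebraMap _ K D * u⁻¹) := by
        ext x
        simp only [Finset.mem_filter, Finset.mem_univ, true_and]
        constructor
        · intro h
          field_simp
          rw [h]
        · intro h
          rw [h]
          field_simp
      rw [e3]
      refine (card_artinSchreier_le _).trans ?_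
      simp [hu]
  nlinarith

end PointCount


section LFunction

open Polynomial Finset

variable {F : Type*} [Field F]

variable [DecidableEq F]

/-- The multiplicative function on monic polynomials attached to the Kloosterman sum
`∑ ψ (x + D / x)`. -/
def kloostermanWeight (ψ : AddChar F ℂ) (D : F) (h : F[X]) : ℂ :=
  if h.coeff 0 = 0 then 0 else ψ (-h.nextCoeff - D * (h.coeff 1 / h.coeff 0))

lemma kloostermanWeight_mul (ψ : AddChar F ℂ) (D : F) {g h : F[X]} (hg : g.Monic) (hh : h.Monic) :
    kloostermanWeight ψ D (g * h) = kloostermanWeight ψ D g * kloostermanWeight ψ D h := by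
  unfold kloostermanWeight
  by_cases h1 : g.coeff 0 = 0
  · simp [h1, mul_coeff_zero]
  by_cases h2 : h.coeff 0 = 0
  · simp [h2, mul_coeff_zero]
  rw [if_neg h1, if_neg h2, if_neg (by rw [mul_coeff_zero]; exact mul_ne_zero h1 h2),
    ← AddChar.map_add_eq_mul, hg.nextCoeff_mul hh, mul_coeff_one, mul_coeff_zero]
  congr 1
  field_simp
  ring

lemma kloostermanWeight_one (ψ : AddChar F ℂ) (D : F) : kloostermanWeight ψ D 1 = 1 := by
  simp [kloostermanWeight, nextCoeff, coeff_one]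

lemma kloostermanWeight_pow (ψ : AddChar F ℂ) (D : F) {g : F[X]} (hg : g.Monic) (j : ℕ) :
    kloostermanWeight ψ D (g ^ j) = kloostermanWeight ψ D g ^ j := by
  induction j with
  | zero => simp [kloostermanWeight_one]
  | succ j ih => rw [pow_succ, kloostermanWeight_mul ψ D (hg.pow j) hg, ih, pow_succ]

variable [Fintype F]

variable (F) in
/-- The monic polynomials of degree `n`. -/
def monicsOfDegree (n : ℕ) : Finset F[X] :=
  open Classical in
  univ.image fun f : Fin n → F => X ^ n + ∑ i, C (f i) * X ^ (i : ℕ)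

lemma mem_monicsOfDegree {n : ℕ} {h : F[X]} :
    h ∈ monicsOfDegree F n ↔ h.Monic ∧ h.natDegree = n := by
  classical
  simp only [monicsOfDegree, mem_image, mem_univ, true_and]
  constructor
  · rintro ⟨f, rfl⟩
    have hdeg : (∑ i, C (f i) * X ^ (i : ℕ) : F[X]).degree < n := by
      refine (degree_sum_le _ _).trans_lt ?_
      rw [Finset.sup_lt_iff (by exact WithBot.bot_lt_coe n)]
      intro i _
      exact (degree_C_mul_X_pow_le _ _).trans_lt (by exact_mod_cast i.2)
    refine ⟨monic_X_pow_add hdeg, ?_⟩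
    rw [natDegree_add_eq_left_of_degree_lt (by rwa [degree_X_pow]), natDegree_X_pow]
  · rintro ⟨hm, rfl⟩
    refine ⟨fun i => h.coeff i, ?_⟩
    conv_rhs => rw [hm.as_sum]
    rw [Finset.sum_range]

/-- The coefficients of the `L`-function. -/
def kloostermanCoeff (ψ : AddChar F ℂ) (D : F) (n : ℕ) : ℂ :=
  ∑ h ∈ monicsOfDegree F n, kloostermanWeight ψ D h

lemma kloostermanCoeff_zero (ψ : AddChar F ℂ) (D : F) : kloostermanCoeff ψ D 0 = 1 := by
  have : monicsOfDegree F 0 = {1} := by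
    ext h
    rw [mem_monicsOfDegree, mem_singleton]
    constructor
    · rintro ⟨h1, h2⟩
      exact h1.natDegree_eq_zero.1 h2
    · rintro rfl
      simp
  simp [kloostermanCoeff, this, kloostermanWeight_one]

lemma kloostermanCoeff_one (ψ : AddChar F ℂ) (D : F) :
    kloostermanCoeff ψ D 1 = ∑ x : F, if x = 0 then 0 else ψ (x + D * x⁻¹) := by
  unfold kloostermanCoeff
  symm
  refine Finset.sum_bij (fun x _ => X - C x) ?_ ?_ ?_ ?_
  · intro x _
    rw [mem_monicsOfDegree]
    exact ⟨monic_X_sub_C x, natDegree_X_sub_C x⟩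
  · intro x _ y _ h
    simpa using h
  · intro h hh
    rw [mem_monicsOfDegree] at hh
    refine ⟨-h.coeff 0, mem_univ _, ?_⟩
    have := hh.1.as_sum
    rw [hh.2] at this
    rw [this]
    simp
  · intro x _
    by_cases hx : x = 0
    · simp [kloostermanWeight, hx]
    · rw [if_neg hx, kloostermanWeight, if_neg (by simpa using hx), nextCoeff_X_sub_C]
      simp [coeff_X, div_eq_mul_inv, coeff_C]

lemma kloostermanCoeff_two {ψ : AddChar F ℂ} (hψ : ψ ≠ 1) {D : F} (hD : D ≠ 0) :
    kloostermanCoeff ψ D 2 = Fintype.card F := by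
  unfold kloostermanCoeff
  have hprim : ψ.IsPrimitive := AddChar.IsPrimitive.of_ne_one hψ
  have h1 : ∑ h ∈ monicsOfDegree F 2, kloostermanWeight ψ D h =
      ∑ b : F, ∑ a : F, if b = 0 then 0 else ψ (a * (-(1 + D / b))) := by
    rw [← Finset.sum_product']
    symm
    refine Finset.sum_bij (fun x _ => X ^ 2 + C x.2 * X + C x.1) ?_ ?_ ?_ ?_
    · rintro ⟨b, a⟩ _
      rw [mem_monicsOfDegree]
      constructor
      · monicity!
      · compute_degree!
    · rintro ⟨b, a⟩ _ ⟨b', a'⟩ _ h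
      have e0 := congrArg (fun q => coeff q 0) h
      have e1 := congrArg (fun q => coeff q 1) h
      simp [coeff_X, coeff_C, coeff_X_pow] at e0 e1
      simp [e0, e1]
    · intro h hh
      rw [mem_monicsOfDegree] at hh
      refine ⟨(h.coeff 0, h.coeff 1), mem_univ _, ?_⟩
      have := hh.1.as_sum
      rw [hh.2] at this
      conv_rhs => rw [this]
      simp [sum_range_succ]
      ring
    · rintro ⟨b, a⟩ _
      have hd : (X ^ 2 + C a * X + C b : F[X]).natDegree = 2 := by compute_degree!
      have c0 : (X ^ 2 + C a * X + C b : F[X]).coeff 0 = b := by simp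
      have c1 : (X ^ 2 + C a * X + C b : F[X]).coeff 1 = a := by
        simp [coeff_C, coeff_X_pow]
      simp only [kloostermanWeight, c0, c1, nextCoeff, hd]
      norm_num [c1]
      congr 2
      ring
  rw [h1, Finset.sum_eq_single (-D)]
  · simp [hD]
  · intro b _ hb
    by_cases hb0 : b = 0
    · simp [hb0]
    · simp only [hb0, if_false]
      have h : -(1 + D / b) ≠ 0 := by
        intro h
        rw [neg_eq_zero] at h
        field_simp at h
        exact hb (eq_neg_of_add_eq_zero_left (by simpa using h))
      rw [AddChar.sum_mulShift _ hprim, if_neg h, Nat.cast_zero]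
  · simp

lemma kloostermanCoeff_eq_zero {ψ : AddChar F ℂ} (hψ : ψ ≠ 1) (D : F) {n : ℕ} (hn : 3 ≤ n) :
    kloostermanCoeff ψ D n = 0 := by
  obtain ⟨t, ht⟩ := AddChar.ne_one_iff.1 hψ
  have key : kloostermanCoeff ψ D n = ψ t * kloostermanCoeff ψ D n := by
    unfold kloostermanCoeff
    rw [Finset.mul_sum]
    have hdeg : ∀ (s : F) (h : F[X]), h.Monic ∧ h.natDegree = n →
        (h + C s * X ^ (n - 1)).Monic ∧ (h + C s * X ^ (n - 1)).natDegree = n := by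
      rintro s h ⟨h1, h2⟩
      have hlt : (C s * X ^ (n - 1)).degree < h.degree := by
        rw [degree_eq_natDegree h1.ne_zero, h2]
        exact (degree_C_mul_X_pow_le _ _).trans_lt (by exact_mod_cast (by omega))
      exact ⟨h1.add_of_left hlt, by rw [natDegree_add_eq_left_of_degree_lt hlt, h2]⟩
    refine Finset.sum_bij' (fun h _ => h + C t * X ^ (n - 1)) (fun h _ => h + C (-t) * X ^ (n - 1))
      ?_ ?_ ?_ ?_ ?_
    · intro h hh
      rw [mem_monicsOfDegree] at hh ⊢
      exact hdeg _ _ hh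
    · intro h hh
      rw [mem_monicsOfDegree] at hh ⊢
      exact hdeg _ _ hh
    · intro h _
      simp
    · intro h _
      simp
    · intro h hh
      rw [mem_monicsOfDegree] at hh
      have h2 := hdeg t h hh
      have c0 : (h + C t * X ^ (n - 1)).coeff 0 = h.coeff 0 := by
        simp [coeff_X_pow]; omega
      have c1 : (h + C t * X ^ (n - 1)).coeff 1 = h.coeff 1 := by
        simp [coeff_X_pow]; omega
      have c2 : (h + C t * X ^ (n - 1)).nextCoeff = h.nextCoeff + t := by
        rw [nextCoeff_of_natDegree_pos (by omega), nextCoeff_of_natDegree_pos (by omega), h2.2, hh.2]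
        simp
      simp only [kloostermanWeight, c0, c1, c2]
      split_ifs
      · simp
      · rw [← AddChar.map_add_eq_mul]
        congr 1
        ring
  have : (1 - ψ t) * kloostermanCoeff ψ D n = 0 := by linear_combination key
  exact (mul_eq_zero.1 this).resolve_left (sub_ne_zero.2 (Ne.symm ht))


variable (F) in
/-- The monic irreducible polynomials of degree `m`. -/
def monicIrreduciblesOfDegree (m : ℕ) : Finset F[X] :=
  open Classical in
  (monicsOfDegree F m).filter Irreducible

lemma mem_monicIrreduciblesOfDegree {m : ℕ} {P : F[X]} :
    P ∈ monicIrreduciblesOfDegree F m ↔ P.Monic ∧ P.natDegree = m ∧ Irreducible P := by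
  classical
  rw [monicIrreduciblesOfDegree, mem_filter, mem_monicsOfDegree, and_assoc]

open Classical in
lemma sum_card_pow_dvd_mul_natDegree {n : ℕ} {h : F[X]} (hh : h ∈ monicsOfDegree F n) :
    ∑ m ∈ Icc 1 n, ∑ P ∈ monicIrreduciblesOfDegree F m,
      ∑ j ∈ Icc 1 n, (if P ^ j ∣ h then m else 0) = n := by
  rw [mem_monicsOfDegree] at hh
  obtain ⟨hm, hn⟩ := hh
  have hprod : (UniqueFactorizationMonoid.normalizedFactors h).prod = h := by
    rw [UniqueFactorizationMonoid.prod_normalizedFactors_eq hm.ne_zero, hm.normalize_eq_self]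
  have hmem : ∀ P ∈ UniqueFactorizationMonoid.normalizedFactors h,
      P.Monic ∧ Irreducible P ∧ P ∣ h := by
    intro P hP
    have h1 := UniqueFactorizationMonoid.irreducible_of_normalized_factor P hP
    refine ⟨?_, h1, UniqueFactorizationMonoid.dvd_of_mem_normalizedFactors hP⟩
    rw [← UniqueFactorizationMonoid.normalize_normalized_factor P hP]
    exact monic_normalize h1.ne_zero
  have hcount : ∀ P : F[X], P.Monic → Irreducible P →
      ∑ j ∈ Icc 1 n, (if P ^ j ∣ h then P.natDegree else 0) =
        (UniqueFactorizationMonoid.normalizedFactors h).count P * P.natDegree := by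
    intro P hPm hP
    rw [← Finset.sum_filter, Finset.sum_const, smul_eq_mul]
    congr 1
    have hiff : ∀ j, P ^ j ∣ h ↔ j ≤ (UniqueFactorizationMonoid.normalizedFactors h).count P := by
      intro j
      rw [UniqueFactorizationMonoid.dvd_iff_normalizedFactors_le_normalizedFactors
        (pow_ne_zero _ hP.ne_zero) hm.ne_zero, UniqueFactorizationMonoid.normalizedFactors_pow,
        UniqueFactorizationMonoid.normalizedFactors_irreducible hP, hPm.normalize_eq_self,
        Multiset.nsmul_singleton, Multiset.le_count_iff_replicate_le]
    have hle : (UniqueFactorizationMonoid.normalizedFactors h).count P ≤ n := by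
      have h1 := (hiff _).2 le_rfl
      have h2 := natDegree_le_of_dvd h1 hm.ne_zero
      rw [natDegree_pow, hn] at h2
      exact (Nat.le_mul_of_pos_right _ hP.natDegree_pos).trans h2
    have : ((Icc 1 n).filter fun j => P ^ j ∣ h) =
        Icc 1 ((UniqueFactorizationMonoid.normalizedFactors h).count P) := by
      ext j
      rw [mem_filter, hiff, mem_Icc, mem_Icc]
      omega
    rw [this, Nat.card_Icc, Nat.add_sub_cancel]
  calc ∑ m ∈ Icc 1 n, ∑ P ∈ monicIrreduciblesOfDegree F m,
        ∑ j ∈ Icc 1 n, (if P ^ j ∣ h then m else 0)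
      = ∑ m ∈ Icc 1 n, ∑ P ∈ monicIrreduciblesOfDegree F m,
          (UniqueFactorizationMonoid.normalizedFactors h).count P * P.natDegree := by
        refine Finset.sum_congr rfl fun m _ => Finset.sum_congr rfl fun P hP => ?_
        rw [mem_monicIrreduciblesOfDegree] at hP
        rw [← hcount P hP.1 hP.2.2, hP.2.1]
    _ = ∑ P ∈ (Icc 1 n).biUnion (monicIrreduciblesOfDegree F),
          (UniqueFactorizationMonoid.normalizedFactors h).count P * P.natDegree := by
        rw [Finset.sum_biUnion]
        intro a _ b _ hab
        rw [Function.onFun, Finset.disjoint_left]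
        intro P h1 h2
        rw [mem_monicIrreduciblesOfDegree] at h1 h2
        exact hab (h1.2.1.symm.trans h2.2.1)
    _ = ∑ P ∈ (UniqueFactorizationMonoid.normalizedFactors h).toFinset,
          (UniqueFactorizationMonoid.normalizedFactors h).count P * P.natDegree := by
        symm
        refine Finset.sum_subset ?_ ?_
        · intro P hP
          obtain ⟨h1, h2, h3⟩ := hmem P (Multiset.mem_toFinset.1 hP)
          rw [mem_biUnion]
          refine ⟨P.natDegree, mem_Icc.2 ⟨h2.natDegree_pos, ?_⟩,
            mem_monicIrreduciblesOfDegree.2 ⟨h1, rfl, h2⟩⟩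
          exact (natDegree_le_of_dvd h3 hm.ne_zero).trans hn.le
        · intro P _ hP
          rw [Multiset.mem_toFinset] at hP
          rw [Multiset.count_eq_zero_of_notMem hP, zero_mul]
    _ = ((UniqueFactorizationMonoid.normalizedFactors h).map natDegree).sum := by
        rw [Finset.sum_multiset_map_count]
        rfl
    _ = n := by
        rw [← natDegree_multiset_prod_of_monic _ fun P hP => (hmem P hP).1, hprod, hn]

open Classical in
lemma sum_kloostermanWeight_of_dvd (ψ : AddChar F ℂ) (D : F) {n k : ℕ} {Q : F[X]} (hQ : Q.Monic)
    (hk : Q.natDegree = k) :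
    ∑ h ∈ monicsOfDegree F n, (if Q ∣ h then kloostermanWeight ψ D h else 0) =
      if k ≤ n then kloostermanWeight ψ D Q * kloostermanCoeff ψ D (n - k) else 0 := by
  split_ifs with hkn
  · rw [kloostermanCoeff, Finset.mul_sum, ← Finset.sum_filter]
    symm
    refine Finset.sum_bij (fun g _ => Q * g) ?_ ?_ ?_ ?_
    · intro g hg
      rw [mem_monicsOfDegree] at hg
      rw [mem_filter, mem_monicsOfDegree]
      refine ⟨⟨hQ.mul hg.1, ?_⟩, dvd_mul_right _ _⟩
      rw [hQ.natDegree_mul hg.1]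
      omega
    · intro a _ b _ hab
      exact mul_left_cancel₀ hQ.ne_zero hab
    · intro h hh
      rw [mem_filter, mem_monicsOfDegree] at hh
      obtain ⟨⟨h1, h2⟩, g, rfl⟩ := hh
      have hg := hQ.of_mul_monic_left h1
      refine ⟨g, mem_monicsOfDegree.2 ⟨hg, ?_⟩, rfl⟩
      rw [hQ.natDegree_mul hg] at h2
      omega
    · intro g hg
      rw [mem_monicsOfDegree] at hg
      rw [kloostermanWeight_mul ψ D hQ hg.1]
  · refine Finset.sum_eq_zero fun h hh => ?_
    rw [mem_monicsOfDegree] at hh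
    rw [if_neg]
    intro hd
    have := natDegree_le_of_dvd hd hh.1.ne_zero
    omega

/-- The power sums of the `L`-function. -/
def kloostermanPowerSum (ψ : AddChar F ℂ) (D : F) (k : ℕ) : ℂ :=
  ∑ m ∈ k.divisors, ∑ P ∈ monicIrreduciblesOfDegree F m, m * kloostermanWeight ψ D P ^ (k / m)

/-- Newton's identity between the coefficients and the power sums. -/
lemma natCast_mul_kloostermanCoeff (ψ : AddChar F ℂ) (D : F) (n : ℕ) :
    n * kloostermanCoeff ψ D n =
      ∑ k ∈ Icc 1 n, kloostermanPowerSum ψ D k * kloostermanCoeff ψ D (n - k) := by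
  classical
  have h1 : n * kloostermanCoeff ψ D n = ∑ m ∈ Icc 1 n, ∑ j ∈ Icc 1 n,
      ∑ P ∈ monicIrreduciblesOfDegree F m, if m * j ≤ n then
        m * kloostermanWeight ψ D P ^ j * kloostermanCoeff ψ D (n - m * j) else 0 := by
    calc n * kloostermanCoeff ψ D n
        = ∑ h ∈ monicsOfDegree F n, ∑ m ∈ Icc 1 n, ∑ j ∈ Icc 1 n,
          ∑ P ∈ monicIrreduciblesOfDegree F m,
            m * (if P ^ j ∣ h then kloostermanWeight ψ D h else 0) := by
          rw [kloostermanCoeff, Finset.mul_sum]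
          refine Finset.sum_congr rfl fun h hh => ?_
          conv_lhs => rw [← sum_card_pow_dvd_mul_natDegree hh]
          push_cast
          rw [Finset.sum_mul]
          refine Finset.sum_congr rfl fun m _ => ?_
          rw [Finset.sum_mul, Finset.sum_comm]
          refine Finset.sum_congr rfl fun P _ => ?_
          rw [Finset.sum_mul]
          refine Finset.sum_congr rfl fun j _ => ?_
          split_ifs <;> simp
      _ = _ := by
          rw [Finset.sum_comm]
          refine Finset.sum_congr rfl fun m _ => ?_
          rw [Finset.sum_comm]
          refine Finset.sum_congr rfl fun j _ => ?_
          rw [Finset.sum_comm]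
          refine Finset.sum_congr rfl fun P hP => ?_
          rw [mem_monicIrreduciblesOfDegree] at hP
          rw [← Finset.mul_sum, sum_kloostermanWeight_of_dvd ψ D (hP.1.pow j) rfl, natDegree_pow,
            hP.2.1, mul_comm j m, kloostermanWeight_pow ψ D hP.1]
          split_ifs
          · ring
          · simp
  have h2 : ∀ k ∈ Icc 1 n, kloostermanPowerSum ψ D k * kloostermanCoeff ψ D (n - k) =
      ∑ m ∈ Icc 1 n, ∑ j ∈ Icc 1 n, ∑ P ∈ monicIrreduciblesOfDegree F m, if m * j = k then
        m * kloostermanWeight ψ D P ^ j * kloostermanCoeff ψ D (n - m * j) else 0 := by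
    intro k hk
    rw [mem_Icc] at hk
    have hd : k.divisors = (Icc 1 n).filter (· ∣ k) := by
      ext m
      rw [Nat.mem_divisors, mem_filter, mem_Icc]
      constructor
      · rintro ⟨h, _⟩
        exact ⟨⟨Nat.pos_of_dvd_of_pos h hk.1, (Nat.le_of_dvd hk.1 h).trans hk.2⟩, h⟩
      · rintro ⟨_, h⟩
        exact ⟨h, by omega⟩
    rw [kloostermanPowerSum, hd, Finset.sum_mul, Finset.sum_filter]
    refine Finset.sum_congr rfl fun m hm => ?_
    rw [mem_Icc] at hm
    split_ifs with hmk
    · obtain ⟨j, rfl⟩ := hmk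
      have hj : 1 ≤ j := by
        by_contra hj
        have : j = 0 := by omega
        simp [this] at hk
      rw [Finset.sum_eq_single j]
      · rw [Nat.mul_div_cancel_left _ hm.1, Finset.sum_mul]
        exact Finset.sum_congr rfl fun P _ => by simp
      · intro i _ hij
        refine Finset.sum_eq_zero fun P _ => ?_
        rw [if_neg]
        intro h
        exact hij (Nat.eq_of_mul_eq_mul_left hm.1 h)
      · intro h
        rw [mem_Icc] at h
        have : j ≤ m * j := Nat.le_mul_of_pos_left _ hm.1
        omega
    · symm
      refine Finset.sum_eq_zero fun j _ => Finset.sum_eq_zero fun P _ => ?_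
      rw [if_neg]
      rintro rfl
      exact hmk (dvd_mul_right _ _)
  rw [Finset.sum_congr rfl h2]
  refine h1.trans (Eq.symm ?_)
  rw [Finset.sum_comm]
  refine Finset.sum_congr rfl fun m hm => ?_
  rw [Finset.sum_comm]
  refine Finset.sum_congr rfl fun j hj => ?_
  rw [Finset.sum_comm]
  refine Finset.sum_congr rfl fun P _ => ?_
  rw [Finset.sum_ite_eq]
  rw [mem_Icc] at hm hj
  have : 1 ≤ m * j := Nat.mul_pos hm.1 hj.1
  simp [mem_Icc, this]

lemma kloostermanPowerSum_one (ψ : AddChar F ℂ) (D : F) :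
    kloostermanPowerSum ψ D 1 = kloostermanCoeff ψ D 1 := by
  have := natCast_mul_kloostermanCoeff ψ D 1
  simpa [kloostermanCoeff_zero] using this.symm

lemma kloostermanPowerSum_two {ψ : AddChar F ℂ} (hψ : ψ ≠ 1) {D : F} (hD : D ≠ 0) :
    kloostermanPowerSum ψ D 2 = 2 * Fintype.card F - kloostermanCoeff ψ D 1 ^ 2 := by
  have := natCast_mul_kloostermanCoeff ψ D 2
  have e : Icc 1 2 = ({1, 2} : Finset ℕ) := rfl
  rw [e, Finset.sum_pair (by norm_num)] at this
  simp only [kloostermanCoeff_two hψ hD, kloostermanPowerSum_one] at this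
  norm_num [kloostermanCoeff_zero] at this
  linear_combination -this

lemma kloostermanPowerSum_add_three {ψ : AddChar F ℂ} (hψ : ψ ≠ 1) {D : F} (hD : D ≠ 0) (n : ℕ) :
    kloostermanPowerSum ψ D (n + 3) = -kloostermanCoeff ψ D 1 * kloostermanPowerSum ψ D (n + 2) -
      Fintype.card F * kloostermanPowerSum ψ D (n + 1) := by
  have := natCast_mul_kloostermanCoeff ψ D (n + 3)
  rw [kloostermanCoeff_eq_zero hψ D (by omega), mul_zero, Finset.sum_Icc_succ_top (by omega),
    Finset.sum_Icc_succ_top (by omega), Finset.sum_Icc_succ_top (by omega),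
    Finset.sum_eq_zero] at this
  · have e1 : n + 3 - (n + 1) = 2 := by omega
    have e2 : n + 3 - (n + 1 + 1) = 1 := by omega
    have e3 : n + 3 - (n + 2 + 1) = 0 := by omega
    rw [e1, e2, e3, kloostermanCoeff_two hψ hD, kloostermanCoeff_zero] at this
    linear_combination -this
  · intro k hk
    rw [mem_Icc] at hk
    rw [kloostermanCoeff_eq_zero hψ D (by omega), mul_zero]

/-- The power sums are those of the reciprocal roots of the `L`-function. -/
lemma kloostermanPowerSum_eq {ψ : AddChar F ℂ} (hψ : ψ ≠ 1) {D : F} (hD : D ≠ 0) {α β : ℂ}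
    (h1 : α + β = -kloostermanCoeff ψ D 1) (h2 : α * β = Fintype.card F) (n : ℕ) :
    kloostermanPowerSum ψ D (n + 1) = -(α ^ (n + 1) + β ^ (n + 1)) := by
  induction n using Nat.strong_induction_on with
  | _ n ih =>
    match n, ih with
    | 0, _ =>
      rw [kloostermanPowerSum_one]
      linear_combination h1
    | 1, _ =>
      rw [kloostermanPowerSum_two hψ hD]
      linear_combination -2 * h2 + (α + β - kloostermanCoeff ψ D 1) * h1
    | n + 2, ih =>
      have e1 := ih (n + 1) (by omega)
      have e2 := ih n (by omega)
      rw [kloostermanPowerSum_add_three hψ hD, e1, e2, ← h2]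
      linear_combination (α ^ (n + 2) + β ^ (n + 2)) * h1

end LFunction

section PowerSum

open Polynomial Finset

variable {F : Type*} [Field F] {K : Type*} [Field K] [Algebra F K]

lemma aeval_inv_reverse_minpoly [FiniteDimensional F K] {x : K} (hx : x ≠ 0) :
    aeval x⁻¹ (minpoly F x).reverse = 0 := by
  let _ := invertibleOfNonzero hx
  have := (eval₂_reverse_eq_zero_iff (algebraMap F K) x (minpoly F x)).2 (minpoly.aeval F x)
  rwa [invOf_eq_inv] at this

lemma coeff_zero_minpoly_ne_zero [FiniteDimensional F K] {x : K} (hx : x ≠ 0) :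
    (minpoly F x).coeff 0 ≠ 0 :=
  minpoly.coeff_zero_ne_zero (Algebra.IsIntegral.isIntegral x) hx

lemma natDegree_minpoly_inv [FiniteDimensional F K] {x : K} (hx : x ≠ 0) :
    (minpoly F x⁻¹).natDegree = (minpoly F x).natDegree := by
  have key : ∀ y : K, y ≠ 0 → (minpoly F y⁻¹).natDegree ≤ (minpoly F y).natDegree := by
    intro y hy
    refine (natDegree_le_of_dvd (minpoly.dvd F _ (aeval_inv_reverse_minpoly hy)) ?_).trans
      (reverse_natDegree_le _)
    rw [Ne, reverse_eq_zero]
    exact minpoly.ne_zero (Algebra.IsIntegral.isIntegral y)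
  refine le_antisymm (key x hx) ?_
  simpa using key x⁻¹ (inv_ne_zero hx)

lemma nextCoeff_minpoly_inv [FiniteDimensional F K] {x : K} (hx : x ≠ 0) :
    (minpoly F x⁻¹).nextCoeff = (minpoly F x).coeff 1 / (minpoly F x).coeff 0 := by
  set P := minpoly F x with hP
  have h0 : P.coeff 0 ≠ 0 := coeff_zero_minpoly_ne_zero hx
  have hInt : IsIntegral F x := Algebra.IsIntegral.isIntegral x
  have hpos : 0 < P.natDegree := minpoly.natDegree_pos hInt
  have htr : P.natTrailingDegree = 0 := by
    rw [natTrailingDegree_eq_zero]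
    exact Or.inr h0
  have hdeg : P.reverse.natDegree = P.natDegree := by rw [reverse_natDegree, htr, Nat.sub_zero]
  have hlead : P.reverse.leadingCoeff = P.coeff 0 := by
    rw [reverse_leadingCoeff, trailingCoeff, htr]
  have hrev : P.reverse ≠ 0 := by
    rw [Ne, reverse_eq_zero]
    exact minpoly.ne_zero hInt
  have hQ : minpoly F x⁻¹ = P.reverse * C P.reverse.leadingCoeff⁻¹ := by
    symm
    refine eq_of_monic_of_dvd_of_natDegree_le (minpoly.monic (Algebra.IsIntegral.isIntegral x⁻¹))
      (monic_mul_leadingCoeff_inv hrev) ?_ ?_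
    · exact (minpoly.dvd F _ (aeval_inv_reverse_minpoly hx)).mul_right _
    · rw [natDegree_mul_leadingCoeff_self_inv, hdeg, natDegree_minpoly_inv hx]
  rw [hQ, nextCoeff_mul_C, hlead, div_eq_mul_inv, nextCoeff_of_natDegree_pos (by omega), hdeg,
    coeff_reverse, revAt_le (by omega)]
  congr 2
  omega

variable [Fintype F] [DecidableEq F] [Fintype K]

lemma card_filter_minpoly_eq [DecidableEq K] {P : F[X]} (hm : P.Monic) (hP : Irreducible P)
    (hd : P.natDegree ∣ Module.finrank F K) :
    (univ.filter fun x : K => minpoly F x = P).card = P.natDegree := by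
  have : Module.Finite F K := .of_finite
  rw [hP.natDegree_dvd_iff_dvd_X_pow_card_pow_sub_X, Nat.card_eq_fintype_card,
    ← Module.card_eq_pow_finrank] at hd
  have hs : (P.map (algebraMap F K)).Splits := by
    refine Splits.of_dvd (FiniteField.isSplittingField_sub K F).splits ?_ (Polynomial.map_dvd _ hd)
    rw [Polynomial.map_ne_zero_iff (algebraMap F K).injective]
    exact FiniteField.X_pow_card_sub_X_ne_zero F Fintype.one_lt_card
  rw [← card_rootSet_eq_natDegree (PerfectField.separable_of_irreducible hP) hs,
    ← Set.toFinset_card]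
  congr 1
  ext x
  rw [mem_filter, Set.mem_toFinset, mem_rootSet_of_ne hP.ne_zero]
  constructor
  · rintro ⟨_, rfl⟩
    exact minpoly.aeval F x
  · intro hx
    exact ⟨mem_univ _, (minpoly.eq_of_irreducible_of_monic hP hx hm).symm⟩

lemma sum_addChar_trace_eq_kloostermanPowerSum (ψ : AddChar F ℂ) (D : F) [DecidableEq K] :
    ∑ x : K, (if x = 0 then 0 else ψ (Algebra.trace F K (x + algebraMap F K D * x⁻¹))) =
      kloostermanPowerSum ψ D (Module.finrank F K) := by
  classical
  have : Module.Finite F K := .of_finite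
  have hInt : ∀ x : K, IsIntegral F x := fun x => Algebra.IsIntegral.isIntegral x
  have hdvd : ∀ x : K, (minpoly F x).natDegree ∣ Module.finrank F K := fun x =>
    minpoly.degree_dvd (hInt x)
  have hne : Module.finrank F K ≠ 0 := Module.finrank_pos.ne'
  have hval : ∀ x : K, (if x = 0 then 0 else
      ψ (Algebra.trace F K (x + algebraMap F K D * x⁻¹))) =
      kloostermanWeight ψ D (minpoly F x) ^ (Module.finrank F K / (minpoly F x).natDegree) := by
    intro x
    have hpos := minpoly.natDegree_pos (hInt x)
    have hexp : Module.finrank F K / (minpoly F x).natDegree ≠ 0 :=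
      (Nat.div_pos (Nat.le_of_dvd Module.finrank_pos (hdvd x)) hpos).ne'
    by_cases hx : x = 0
    · subst hx
      rw [if_pos rfl, kloostermanWeight, if_pos (by simp [minpoly.zero]), zero_pow hexp]
    · have hfr : ∀ y : K, Module.finrank (IntermediateField.adjoin F {y}) K =
          Module.finrank F K / (minpoly F y).natDegree := by
        intro y
        rw [← IntermediateField.adjoin.finrank (hInt y), eq_comm]
        refine Nat.div_eq_of_eq_mul_right Module.finrank_pos ?_
        rw [Module.finrank_mul_finrank]
      rw [if_neg hx, kloostermanWeight, if_neg (coeff_zero_minpoly_ne_zero hx),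
        ← AddChar.map_nsmul_eq_pow, map_add, ← Algebra.smul_def, map_smul,
        trace_eq_finrank_mul_minpoly_nextCoeff, trace_eq_finrank_mul_minpoly_nextCoeff, hfr, hfr,
        nextCoeff_minpoly_inv hx, natDegree_minpoly_inv hx]
      congr 1
      simp only [smul_eq_mul, nsmul_eq_mul]
      ring
  simp_rw [hval]
  have hmaps : ∀ x ∈ (univ : Finset K), minpoly F x ∈
      (Module.finrank F K).divisors.biUnion (monicIrreduciblesOfDegree F) := by
    intro x _
    rw [mem_biUnion]
    exact ⟨_, Nat.mem_divisors.2 ⟨hdvd x, hne⟩, mem_monicIrreduciblesOfDegree.2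
      ⟨minpoly.monic (hInt x), rfl, minpoly.irreducible (hInt x)⟩⟩
  rw [← Finset.sum_fiberwise_of_maps_to hmaps, Finset.sum_biUnion, kloostermanPowerSum]
  · refine Finset.sum_congr rfl fun m hm => Finset.sum_congr rfl fun P hP => ?_
    rw [mem_monicIrreduciblesOfDegree] at hP
    rw [Finset.sum_congr rfl (g := fun _ => kloostermanWeight ψ D P ^ (Module.finrank F K / m)),
      Finset.sum_const, card_filter_minpoly_eq hP.1 hP.2.2, hP.2.1, nsmul_eq_mul]
    · rw [hP.2.1]
      exact Nat.dvd_of_mem_divisors hm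
    · intro x hx
      rw [mem_filter] at hx
      rw [hx.2, hP.2.1]
  · intro a _ b _ hab
    rw [Function.onFun, Finset.disjoint_left]
    intro P h1 h2
    rw [mem_monicIrreduciblesOfDegree] at h1 h2
    exact hab (h1.2.1.symm.trans h2.2.1)

end PowerSum

section WeilBound

open Finset

lemma re_pow_add_pow_ge {r P : ℝ} (hP : 0 ≤ P) :
    ∃ α β : ℂ, α + β = -r ∧ α * β = P ∧ (∀ n : ℕ, -(2 * P ^ n) ≤ (α ^ (2 * n) + β ^ (2 * n)).re) ∧
      (4 * P < r ^ 2 → ∃ A : ℝ, P < A ∧ ∀ n : ℕ, A ^ n ≤ (α ^ (2 * n) + β ^ (2 * n)).re) := by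
  rcases le_or_gt (r ^ 2) (4 * P) with h | h
  · set s := √(4 * P - r ^ 2) with hs
    have hs2 : s ^ 2 = 4 * P - r ^ 2 := Real.sq_sqrt (by linarith)
    have hs2' : (s : ℂ) ^ 2 = 4 * P - r ^ 2 := by exact_mod_cast hs2
    have hI := Complex.I_sq
    refine ⟨(-r + s * Complex.I) / 2, (-r - s * Complex.I) / 2, by ring, ?_, ?_,
      fun h' => absurd h (not_le.2 h')⟩
    · linear_combination (-(s : ℂ) ^ 2 / 4) * hI + (1 / 4) * hs2'
    · have key : ∀ z : ℂ, Complex.normSq z = P → ∀ n : ℕ, -P ^ n ≤ (z ^ (2 * n)).re := by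
        intro z hz n
        have h1 := Complex.abs_re_le_norm (z ^ (2 * n))
        rw [norm_pow, pow_mul ‖z‖, ← Complex.normSq_eq_norm_sq, hz] at h1
        exact (abs_le.1 h1).1
      intro n
      have h1 : Complex.normSq ((-r + s * Complex.I) / 2) = P := by
        simp [Complex.normSq_apply]
        linear_combination hs2 / 4
      have h2 : Complex.normSq ((-r - s * Complex.I) / 2) = P := by
        simp [Complex.normSq_apply]
        linear_combination hs2 / 4
      have := key _ h1 n
      have := key _ h2 n
      rw [Complex.add_re]
      linarith
  · set s := √(r ^ 2 - 4 * P) with hs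
    have hs2 : s ^ 2 = r ^ 2 - 4 * P := Real.sq_sqrt (by linarith)
    set a := (-r + s) / 2 with ha
    set b := (-r - s) / 2 with hb
    have e : ∀ n : ℕ, ((a : ℂ) ^ (2 * n) + (b : ℂ) ^ (2 * n)).re = (a ^ 2) ^ n + (b ^ 2) ^ n := by
      intro n
      rw [← pow_mul, ← pow_mul]
      norm_cast
    refine ⟨a, b, ?_, ?_, ?_, fun _ => ?_⟩
    · rw [← Complex.ofReal_add, ← Complex.ofReal_neg]
      congr 1
      rw [ha, hb]
      ring
    · rw [← Complex.ofReal_mul]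
      congr 1
      rw [ha, hb]
      linear_combination -hs2 / 4
    · intro n
      rw [e]
      have : 0 ≤ P ^ n := by positivity
      have : 0 ≤ (a ^ 2) ^ n := by positivity
      have : 0 ≤ (b ^ 2) ^ n := by positivity
      linarith
    · have hsum : a ^ 2 + b ^ 2 > 2 * P := by
        have : a ^ 2 + b ^ 2 = r ^ 2 - 2 * P := by
          rw [ha, hb]
          linear_combination hs2 / 2
        linarith
      rcases lt_or_ge P (a ^ 2) with h1 | h1
      · refine ⟨a ^ 2, h1, fun n => ?_⟩
        rw [e]
        have : 0 ≤ (b ^ 2) ^ n := by positivity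
        linarith
      · refine ⟨b ^ 2, by linarith, fun n => ?_⟩
        rw [e]
        have : 0 ≤ (a ^ 2) ^ n := by positivity
        linarith

variable {p : ℕ} [hp : Fact p.Prime]

lemma kloostermanCoeff_one_im (ψ : AddChar (ZMod p) ℂ) (D : ZMod p) :
    ((kloostermanCoeff ψ D 1).re : ℂ) = kloostermanCoeff ψ D 1 := by
  rw [← Complex.conj_eq_iff_re, kloostermanCoeff_one, map_sum]
  refine Fintype.sum_equiv (Equiv.neg _) _ _ fun x => ?_
  simp only [Equiv.neg_apply, neg_eq_zero]
  split_ifs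
  · simp
  · rw [← AddChar.map_neg_eq_conj]
    congr 1
    rw [inv_neg]
    ring

lemma sum_kloostermanPowerSum_mulShift (hp2 : p ≠ 2) {ψ : AddChar (ZMod p) ℂ} (hψ : ψ ≠ 1)
    {D : ZMod p} (hD : D ≠ 0) {n : ℕ} (hn : 2 ≤ n) :
    -(6 * p * p ^ n + 2 * p : ℝ) ≤
      ∑ c ∈ univ.erase (0 : ZMod p), (kloostermanPowerSum (ψ.mulShift c) D (2 * n)).re := by
  classical
  have hprim : ψ.IsPrimitive := AddChar.IsPrimitive.of_ne_one hψ
  let K := GaloisField p (2 * n)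
  let _ : Fintype K := Fintype.ofFinite K
  have hfr : Module.finrank (ZMod p) K = 2 * n := GaloisField.finrank p (by omega)
  have hcard : Fintype.card K = (p ^ n) ^ 2 := by
    rw [← Nat.card_eq_fintype_card, GaloisField.card p _ (by omega), ← pow_mul, mul_comm n 2]
  have hodd : Odd (p ^ n) := (hp.out.odd_of_ne_two hp2).pow
  obtain ⟨h, hh⟩ := hodd
  have hp3 : 3 ≤ p := by
    have := hp.out.two_le
    omega
  have hph : p < h := by
    have h1 : p ^ 2 ≤ p ^ n := Nat.pow_le_pow_right (by omega) hn
    nlinarith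
  have hcount := card_trace_eq_zero_ge hp2 hD n h hh hph (K := K) hcard
  set T : K → ZMod p := fun u => Algebra.trace (ZMod p) K (u + algebraMap _ K D * u⁻¹) with hT
  have htot : ∑ c : ZMod p, ∑ u : K, (if u = 0 then (0 : ℂ) else ψ.mulShift c (T u)) =
      p * (univ.filter fun u : K => u ≠ 0 ∧ T u = 0).card := by
    rw [Finset.sum_comm, Finset.card_filter, Nat.cast_sum, Finset.mul_sum]
    refine Finset.sum_congr rfl fun u _ => ?_
    by_cases hu : u = 0
    · simp [hu]
    · simp only [hu, if_false, AddChar.mulShift_apply]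
      rw [AddChar.sum_mulShift _ hprim, ZMod.card]
      by_cases hTu : T u = 0 <;> simp [hTu, hu]
  have hzero : ∑ u : K, (if u = 0 then (0 : ℂ) else ψ.mulShift 0 (T u)) = (p ^ n) ^ 2 - 1 := by
    rw [Finset.sum_ite, Finset.sum_const_zero, zero_add]
    simp only [AddChar.mulShift_apply, zero_mul, AddChar.map_zero_eq_one, Finset.sum_const,
      nsmul_eq_mul, mul_one]
    have : (univ.filter fun u : K => ¬ u = 0) = univ.erase 0 := by
      ext u
      simp
    rw [this, Finset.card_erase_of_mem (mem_univ _), card_univ, hcard, Nat.cast_sub]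
    · push_cast
      ring
    · exact Nat.one_le_pow _ _ (pow_pos hp.out.pos n)
  have hrest : ∑ c ∈ univ.erase (0 : ZMod p), kloostermanPowerSum (ψ.mulShift c) D (2 * n) =
      p * (univ.filter fun u : K => u ≠ 0 ∧ T u = 0).card - ((p ^ n) ^ 2 - 1) := by
    rw [← htot, ← hzero, ← Finset.add_sum_erase univ _ (mem_univ (0 : ZMod p)), add_sub_cancel_left]
    refine Finset.sum_congr rfl fun c _ => ?_
    have := sum_addChar_trace_eq_kloostermanPowerSum (K := K) (ψ.mulShift c) D
    rw [hfr] at this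
    exact this.symm
  have hre := congrArg Complex.re hrest
  rw [Complex.re_sum] at hre
  rw [hre]
  have e : ((p : ℂ) * (univ.filter fun u : K => u ≠ 0 ∧ T u = 0).card - (((p : ℂ) ^ n) ^ 2 - 1)).re =
      (p : ℝ) * (univ.filter fun u : K => u ≠ 0 ∧ T u = 0).card - (((p : ℝ) ^ n) ^ 2 - 1) := by
    norm_cast
  rw [e]
  have : (((p ^ n) ^ 2 : ℕ) : ℝ) ≤
      ((p * (univ.filter fun u : K => u ≠ 0 ∧ T u = 0).card + 6 * p * p ^ n + 2 * p : ℕ) : ℝ) := by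
    exact_mod_cast hcount
  push_cast at this
  linarith

/-- Weil's bound for Kloosterman sums over a prime field. -/
theorem norm_kloosterman_le (hp2 : p ≠ 2) {ψ : AddChar (ZMod p) ℂ} (hψ : ψ ≠ 1)
    {D : ZMod p} (hD : D ≠ 0) :
    ‖∑ x : ZMod p, if x = 0 then 0 else ψ (x + D * x⁻¹)‖ ≤ 2 * √p := by
  have hprim : ψ.IsPrimitive := AddChar.IsPrimitive.of_ne_one hψ
  rw [← kloostermanCoeff_one, ← kloostermanCoeff_one_im, Complex.norm_real, Real.norm_eq_abs]
  set r := (kloostermanCoeff ψ D 1).re with hr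
  have hp0 : (0 : ℝ) < p := by exact_mod_cast hp.out.pos
  by_contra! hlt
  have hlt2 : 4 * (p : ℝ) < r ^ 2 := by
    have := pow_lt_pow_left₀ hlt (by positivity) two_ne_zero
    rw [sq_abs, mul_pow, Real.sq_sqrt hp0.le] at this
    linarith
  have hpow : ∀ c : ZMod p, c ≠ 0 → ∀ n : ℕ, 1 ≤ n →
      (kloostermanPowerSum (ψ.mulShift c) D (2 * n)).re ≤ 2 * (p : ℝ) ^ n := by
    intro c hc n hn
    obtain ⟨α, β, h1, h2, h3, -⟩ :=
      re_pow_add_pow_ge (r := (kloostermanCoeff (ψ.mulShift c) D 1).re) hp0.le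
    rw [kloostermanCoeff_one_im] at h1
    have e := kloostermanPowerSum_eq (hprim hc) hD h1 (by rw [h2, ZMod.card]; simp) (2 * n - 1)
    rw [Nat.sub_add_cancel (by omega)] at e
    rw [e, Complex.neg_re]
    linarith [h3 n]
  obtain ⟨α, β, h1, h2, -, h4⟩ := re_pow_add_pow_ge (r := r) hp0.le
  obtain ⟨A, hA, hAn⟩ := h4 hlt2
  rw [hr, kloostermanCoeff_one_im] at h1
  have hbound : ∀ n : ℕ, 2 ≤ n → A ^ n ≤ 10 * p * (p : ℝ) ^ n := by
    intro n hn
    have e := kloostermanPowerSum_eq hψ hD h1 (by rw [h2, ZMod.card]; simp) (2 * n - 1)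
    rw [Nat.sub_add_cancel (by omega)] at e
    have hs := sum_kloostermanPowerSum_mulShift hp2 hψ hD hn
    rw [← Finset.add_sum_erase _ _ (show (1 : ZMod p) ∈ univ.erase 0 by simp),
      show ψ.mulShift 1 = ψ by ext; simp, e, Complex.neg_re] at hs
    have hrest : ∑ c ∈ (univ.erase (0 : ZMod p)).erase 1,
        (kloostermanPowerSum (ψ.mulShift c) D (2 * n)).re ≤ p * (2 * (p : ℝ) ^ n) := by
      refine (Finset.sum_le_card_nsmul _ _ (2 * (p : ℝ) ^ n) fun c hc => ?_).trans ?_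
      · exact hpow c (by simpa using (mem_erase.1 (mem_erase.1 hc).2).1) n (by omega)
      · rw [nsmul_eq_mul]
        gcongr
        refine (card_le_univ _).trans ?_
        rw [ZMod.card]
    have hone : (1 : ℝ) ≤ (p : ℝ) ^ n := one_le_pow₀ (by exact_mod_cast hp.out.one_le)
    have := hAn n
    nlinarith
  have hq : 1 < A / p := by rwa [one_lt_div hp0]
  obtain ⟨n, hn⟩ := pow_unbounded_of_one_lt (10 * (p : ℝ)) hq
  have h5 := hbound (n + 2) (by omega)
  have h6 : (A / p) ^ (n + 2) ≤ 10 * p := by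
    rw [div_pow, div_le_iff₀ (by positivity)]
    exact h5
  have h7 : (A / p) ^ n ≤ (A / p) ^ (n + 2) := pow_le_pow_right₀ hq.le (by omega)
  linarith

end WeilBound

section QuadraticSums

open Finset

variable {R : Type*} [CommRing R] [Fintype R] [DecidableEq R]

lemma quadraticSum_mul_conj {ψ : AddChar R ℂ} (hψ : ψ.IsPrimitive) (L Q : R) :
    (∑ t, ψ (L * t + Q * t ^ 2)) * (starRingEnd ℂ) (∑ t, ψ (L * t + Q * t ^ 2)) =
      Fintype.card R * ∑ h ∈ univ.filter fun h : R => 2 * Q * h = 0, ψ (L * h + Q * h ^ 2) := by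
  rw [map_sum, Finset.sum_mul_sum, Finset.sum_comm]
  have h1 : ∀ t' : R, ∑ t, ψ (L * t + Q * t ^ 2) * (starRingEnd ℂ) (ψ (L * t' + Q * t' ^ 2)) =
      ∑ h, ψ (L * h + Q * h ^ 2) * ψ (t' * (2 * Q * h)) := by
    intro t'
    refine (Fintype.sum_equiv (Equiv.addLeft t') _ _ fun h => ?_).symm
    rw [← AddChar.map_neg_eq_conj, ← AddChar.map_add_eq_mul, ← AddChar.map_add_eq_mul]
    congr 1
    simp only [Equiv.coe_addLeft]
    ring
  rw [Finset.sum_congr rfl fun t' _ => h1 t', Finset.sum_comm, Finset.mul_sum, Finset.sum_filter]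
  refine Finset.sum_congr rfl fun h _ => ?_
  rw [← Finset.mul_sum, AddChar.sum_mulShift _ hψ]
  split_ifs
  · ring
  · simp

lemma norm_quadraticSum_sq_le {ψ : AddChar R ℂ} (hψ : ψ.IsPrimitive) (L Q : R) :
    ‖∑ t, ψ (L * t + Q * t ^ 2)‖ ^ 2 ≤
      Fintype.card R * (univ.filter fun h : R => 2 * Q * h = 0).card := by
  have h := congrArg norm (quadraticSum_mul_conj hψ L Q)
  rw [norm_mul, RCLike.norm_conj, ← sq, norm_mul, Complex.norm_natCast] at h
  rw [h]
  gcongr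
  refine (norm_sum_le _ _).trans ?_
  simp

lemma norm_gaussSum_sq {ψ : AddChar R ℂ} (hψ : ψ.IsPrimitive) (h2 : IsUnit (2 : R)) (u : Rˣ) :
    ‖∑ t, ψ (u * t ^ 2)‖ ^ 2 = Fintype.card R := by
  have h := congrArg norm (quadraticSum_mul_conj hψ 0 (u : R))
  rw [norm_mul, RCLike.norm_conj, ← sq, norm_mul, Complex.norm_natCast] at h
  have e : (univ.filter fun h : R => 2 * (u : R) * h = 0) = {0} := by
    ext x
    rw [mem_filter, mem_singleton, (h2.mul u.isUnit).mul_right_eq_zero]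
    simp
  rw [e] at h
  simpa using h

omit [Fintype R] [DecidableEq R] in
lemma addChar_map_sum {ι : Type*} (ψ : AddChar R ℂ) (s : Finset ι) (f : ι → R) :
    ψ (∑ i ∈ s, f i) = ∏ i ∈ s, ψ (f i) := by
  classical
  induction s using Finset.induction_on with
  | empty => simp
  | insert a s ha ih => rw [Finset.sum_insert ha, Finset.prod_insert ha, AddChar.map_add_eq_mul, ih]

/-- The complete exponential sum `∑ ψ(-uN) ∏ ∑ ψ(ub² + bnᵢ)` over a finite ring. -/
def sphereSum {d : ℕ} (ψ : AddChar R ℂ) (N : R) (n : Fin d → R) : ℂ :=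
  ∑ u : Rˣ, ψ (-(u * N)) * ∏ i, ∑ b : R, ψ (u * b ^ 2 + b * n i)

lemma sphereSum_eq {d : ℕ} (ψ : AddChar R ℂ) (h2 : IsUnit (2 : R)) (N : R) (n : Fin d → R) :
    ∃ c : R, sphereSum ψ N n =
      ∑ u : Rˣ, (∑ t, ψ (u * t ^ 2)) ^ d * ψ (-(u * N) + c * (u⁻¹ : Rˣ)) := by
  obtain ⟨z, hz⟩ := h2.exists_right_inv
  refine ⟨∑ i, -(z * n i) ^ 2, ?_⟩
  unfold sphereSum
  refine Finset.sum_congr rfl fun u _ => ?_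
  have h1 : ∀ i, ∑ b : R, ψ (u * b ^ 2 + b * n i) =
      ψ (-(z * n i) ^ 2 * (u⁻¹ : Rˣ)) * ∑ t, ψ (u * t ^ 2) := by
    intro i
    rw [Finset.mul_sum]
    refine Fintype.sum_equiv (Equiv.addRight ((u⁻¹ : Rˣ) * (z * n i))) _ _ fun b => ?_
    rw [← AddChar.map_add_eq_mul]
    congr 1
    simp only [Equiv.coe_addRight]
    have hu : (u : R) * (u⁻¹ : Rˣ) = 1 := u.mul_inv
    linear_combination (-(b * n i)) * hz +
      (-2 * b * z * n i - (z * n i) ^ 2 * (u⁻¹ : Rˣ)) * hu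
  rw [Finset.prod_congr rfl fun i _ => h1 i, Finset.prod_mul_distrib, Finset.prod_const,
    Finset.card_univ, Fintype.card_fin, AddChar.map_add_eq_mul, Finset.sum_mul,
    addChar_map_sum]
  ring

end QuadraticSums

section ChineseRemainder

open Finset

variable {R R₁ R₂ : Type*} [CommRing R] [CommRing R₁] [CommRing R₂] [Fintype R] [Fintype R₁]
  [Fintype R₂] [DecidableEq R] [DecidableEq R₁] [DecidableEq R₂]

lemma exists_sphereSum_eq_mul (e : R ≃+* R₁ × R₂) {ψ : AddChar R ℂ} (hψ : ψ.IsPrimitive) :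
    ∃ (ψ₁ : AddChar R₁ ℂ) (ψ₂ : AddChar R₂ ℂ), ψ₁.IsPrimitive ∧ ψ₂.IsPrimitive ∧
      ∀ {d : ℕ} (N : R) (n : Fin d → R), sphereSum ψ N n =
        sphereSum ψ₁ (e N).1 (fun i => (e (n i)).1) *
          sphereSum ψ₂ (e N).2 (fun i => (e (n i)).2) := by
  let ψ₁ : AddChar R₁ ℂ :=
    { toFun := fun x => ψ (e.symm (x, 0))
      map_zero_eq_one' := by
        rw [show ((0 : R₁), (0 : R₂)) = 0 from rfl, map_zero, AddChar.map_zero_eq_one]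
      map_add_eq_mul' := fun x y => by
        rw [← AddChar.map_add_eq_mul, ← map_add, Prod.mk_add_mk, add_zero] }
  let ψ₂ : AddChar R₂ ℂ :=
    { toFun := fun x => ψ (e.symm (0, x))
      map_zero_eq_one' := by
        rw [show ((0 : R₁), (0 : R₂)) = 0 from rfl, map_zero, AddChar.map_zero_eq_one]
      map_add_eq_mul' := fun x y => by
        rw [← AddChar.map_add_eq_mul, ← map_add, Prod.mk_add_mk, add_zero] }
  have hmul : ∀ x y, ψ (e.symm (x, y)) = ψ₁ x * ψ₂ y := by
    intro x y
    change _ = ψ (e.symm (x, 0)) * ψ (e.symm (0, y))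
    rw [← AddChar.map_add_eq_mul, ← map_add, Prod.mk_add_mk, add_zero, zero_add]
  refine ⟨ψ₁, ψ₂, ?_, ?_, ?_⟩
  · intro a ha h
    refine hψ (a := e.symm (a, 0)) (by simpa using ha) ?_
    ext x
    have h1 := DFunLike.congr_fun h (e x).1
    rw [AddChar.mulShift_apply, AddChar.one_apply] at h1 ⊢
    rw [← h1]
    change _ = ψ (e.symm (a * (e x).1, 0))
    congr 1
    apply e.injective
    rw [map_mul, e.apply_symm_apply, e.apply_symm_apply]
    ext <;> simp
  · intro a ha h
    refine hψ (a := e.symm (0, a)) (by simpa using ha) ?_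
    ext x
    have h1 := DFunLike.congr_fun h (e x).2
    rw [AddChar.mulShift_apply, AddChar.one_apply] at h1 ⊢
    rw [← h1]
    change _ = ψ (e.symm (0, a * (e x).2))
    congr 1
    apply e.injective
    rw [map_mul, e.apply_symm_apply, e.apply_symm_apply]
    ext <;> simp
  · intro d N n
    unfold sphereSum
    rw [Finset.sum_mul_sum, ← Finset.sum_product']
    refine Fintype.sum_equiv
      ((Units.mapEquiv e.toMulEquiv).trans MulEquiv.prodUnits).toEquiv _ _ fun u => ?_
    have hψe : ∀ x : R, ψ x = ψ₁ (e x).1 * ψ₂ (e x).2 := by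
      intro x
      rw [← hmul, Prod.mk.eta, e.symm_apply_apply]
    have hG : ∀ i, ∑ b : R, ψ (u * b ^ 2 + b * n i) =
        (∑ b : R₁, ψ₁ ((e u).1 * b ^ 2 + b * (e (n i)).1)) *
          ∑ b : R₂, ψ₂ ((e u).2 * b ^ 2 + b * (e (n i)).2) := by
      intro i
      rw [Finset.sum_mul_sum, ← Finset.sum_product']
      refine Fintype.sum_equiv e.toEquiv _ _ fun b => ?_
      rw [hψe]
      simp
    rw [Finset.prod_congr rfl fun i _ => hG i, Finset.prod_mul_distrib, hψe]
    simp only [map_neg, map_mul, Prod.fst_neg, Prod.snd_neg, Prod.fst_mul, Prod.snd_mul]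
    simp [MulEquiv.prodUnits]
    ring

end ChineseRemainder

section PrimeField

open Finset

variable {p : ℕ} [hp : Fact p.Prime]

lemma sum_comp_sq (hp2 : p ≠ 2) (f : ZMod p → ℂ) :
    ∑ x, f (x ^ 2) = ∑ y, (1 + (quadraticChar (ZMod p) y : ℂ)) * f y := by
  have h2 : ringChar (ZMod p) ≠ 2 := by rwa [ZMod.ringChar_zmod_n]
  rw [← Finset.sum_fiberwise (s := univ) (g := fun x : ZMod p => x ^ 2)]
  refine Finset.sum_congr rfl fun y _ => ?_
  have h1 := quadraticChar_card_sqrts h2 y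
  rw [Finset.sum_congr rfl (g := fun _ => f y), Finset.sum_const, nsmul_eq_mul]
  · congr 1
    have : ((univ.filter fun x : ZMod p => x ^ 2 = y).card : ℤ) =
        quadraticChar (ZMod p) y + 1 := by
      rw [← h1]
      congr 2
      ext x
      simp
    have h3 := congrArg (Int.cast : ℤ → ℂ) this
    push_cast at h3
    rw [h3, add_comm]
  · intro x hx
    rw [(mem_filter.1 hx).2]

lemma sum_quadraticChar_mul (hp2 : p ≠ 2) {ψ : AddChar (ZMod p) ℂ} (hψ : ψ.IsPrimitive)
    {s : ZMod p} (hs : s ≠ 0) :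
    ∑ y, (quadraticChar (ZMod p) y : ℂ) * ψ (s * y) = ∑ x, ψ (s * x ^ 2) := by
  rw [sum_comp_sq hp2 fun y => ψ (s * y)]
  simp only [add_mul, one_mul, Finset.sum_add_distrib]
  have := AddChar.sum_mulShift s hψ
  rw [if_neg hs] at this
  simp only [mul_comm _ s] at this
  rw [this]
  simp

lemma quadraticChar_mul_gaussSum (hp2 : p ≠ 2) {ψ : AddChar (ZMod p) ℂ} (hψ : ψ.IsPrimitive)
    {s t : ZMod p} (hs : s ≠ 0) (ht : t ≠ 0) :
    (quadraticChar (ZMod p) s : ℂ) * ∑ x, ψ (t * x ^ 2) = ∑ x, ψ (t * s * x ^ 2) := by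
  rw [← sum_quadraticChar_mul hp2 hψ ht, ← sum_quadraticChar_mul hp2 hψ (mul_ne_zero ht hs),
    Finset.mul_sum]
  refine (Fintype.sum_equiv (Equiv.mulLeft₀ s hs) _ _ fun y => ?_).symm
  have h1 := quadraticChar_sq_one (F := ZMod p) hs
  have h2 : (quadraticChar (ZMod p) s : ℂ) ^ 2 = 1 := by exact_mod_cast h1
  rw [Equiv.mulLeft₀_apply, map_mul (quadraticChar (ZMod p)), ← mul_assoc t]
  push_cast
  linear_combination (-(quadraticChar (ZMod p) y : ℂ) * ψ (t * s * y)) * h2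

lemma sum_units_eq (f : ZMod p → ℂ) : ∑ u : (ZMod p)ˣ, f u = ∑ x ∈ univ.erase 0, f x := by
  refine Finset.sum_bij (fun u _ => (u : ZMod p)) ?_ ?_ ?_ ?_
  · intro u _
    simp
  · intro u _ v _ h
    exact Units.ext h
  · intro x hx
    exact ⟨Units.mk0 x (mem_erase.1 hx).1, mem_univ _, rfl⟩
  · intro u _
    rfl

lemma sum_units_mul (ψ : AddChar (ZMod p) ℂ) (hψ : ψ.IsPrimitive) (y : ZMod p) :
    ∑ u : (ZMod p)ˣ, ψ (u * y) = (if y = 0 then (p : ℂ) else 0) - 1 := by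
  rw [sum_units_eq fun x => ψ (x * y), Finset.sum_erase_eq_sub (mem_univ _),
    AddChar.sum_mulShift _ hψ, ZMod.card]
  simp

/-- The bound for Salié sums. -/
lemma norm_salie_le (hp2 : p ≠ 2) {ψ : AddChar (ZMod p) ℂ} (hψ : ψ.IsPrimitive)
    (a : ZMod p) {b : ZMod p} (hb : b ≠ 0) :
    ‖∑ u : (ZMod p)ˣ, (quadraticChar (ZMod p) u : ℂ) * ψ (u * a + b * (u⁻¹ : (ZMod p)ˣ))‖ ≤
      2 * √p := by
  have h2 : IsUnit (2 : ZMod p) :=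
    (Ring.two_ne_zero (by rwa [ZMod.ringChar_zmod_n])).isUnit
  set t := -b with ht
  have ht0 : t ≠ 0 := neg_ne_zero.2 hb
  have hg : ‖∑ x, ψ (t * x ^ 2)‖ = √p := by
    have := norm_gaussSum_sq hψ h2 (Units.mk0 t ht0)
    rw [ZMod.card, Units.val_mk0] at this
    rw [← this, Real.sqrt_sq (norm_nonneg _)]
  have key : (∑ u : (ZMod p)ˣ, (quadraticChar (ZMod p) u : ℂ) *
      ψ (u * a + b * (u⁻¹ : (ZMod p)ˣ))) * ∑ x, ψ (t * x ^ 2) =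
      p * ∑ x ∈ univ.filter (fun x : ZMod p => t * x ^ 2 + a = 0), ψ (x * (2 * t)) := by
    have hlin : ∑ x, ψ (x * (2 * t)) = 0 := by
      rw [AddChar.sum_mulShift _ hψ, if_neg (mul_ne_zero h2.ne_zero ht0), Nat.cast_zero]
    calc _ = ∑ u : (ZMod p)ˣ, ∑ x : ZMod p, ψ (x * (2 * t)) * ψ (u * (t * x ^ 2 + a)) := by
          rw [Finset.sum_mul]
          refine Finset.sum_congr rfl fun u _ => ?_
          rw [mul_right_comm, quadraticChar_mul_gaussSum hp2 hψ u.ne_zero ht0, Finset.sum_mul]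
          refine (Fintype.sum_equiv (Equiv.addRight ((u⁻¹ : (ZMod p)ˣ) : ZMod p)) _ _
            fun x => ?_).symm
          rw [← AddChar.map_add_eq_mul, ← AddChar.map_add_eq_mul]
          congr 1
          have hu : (u : ZMod p) * (u⁻¹ : (ZMod p)ˣ) = 1 := u.mul_inv
          simp only [Equiv.coe_addRight]
          linear_combination (-(2 * t * x) - t * (u⁻¹ : (ZMod p)ˣ)) * hu +
            (u⁻¹ : (ZMod p)ˣ) * ht
      _ = ∑ x : ZMod p, ψ (x * (2 * t)) * ((if t * x ^ 2 + a = 0 then (p : ℂ) else 0) - 1) := by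
          rw [Finset.sum_comm]
          refine Finset.sum_congr rfl fun x _ => ?_
          rw [← Finset.mul_sum, sum_units_mul ψ hψ]
      _ = _ := by
          simp only [mul_sub, mul_one, Finset.sum_sub_distrib, hlin, sub_zero]
          rw [Finset.mul_sum, Finset.sum_filter]
          refine Finset.sum_congr rfl fun x _ => ?_
          split_ifs <;> ring
  have hcard : (univ.filter (fun x : ZMod p => t * x ^ 2 + a = 0)).card ≤ 2 := by
    have h3 : (univ.filter (fun x : ZMod p => t * x ^ 2 + a = 0)) ⊆
        (Polynomial.nthRoots 2 (-a / t)).toFinset := by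
      intro x hx
      rw [mem_filter] at hx
      rw [Multiset.mem_toFinset, Polynomial.mem_nthRoots two_pos, eq_div_iff ht0]
      linear_combination hx.2
    exact (card_le_card h3).trans ((Multiset.toFinset_card_le _).trans
      (Polynomial.card_nthRoots 2 _))
  have hn := congrArg norm key
  rw [norm_mul, norm_mul, hg, Complex.norm_natCast] at hn
  have h4 : ‖∑ x ∈ univ.filter (fun x : ZMod p => t * x ^ 2 + a = 0), ψ (x * (2 * t))‖ ≤ 2 := by
    refine (norm_sum_le _ _).trans ?_
    simp only [AddChar.norm_apply, Finset.sum_const, nsmul_eq_mul, mul_one]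
    exact_mod_cast hcard
  have hp0 : (0 : ℝ) < p := by exact_mod_cast hp.out.pos
  have hs : √(p : ℝ) * √p = p := Real.mul_self_sqrt hp0.le
  have hs0 : 0 < √(p : ℝ) := Real.sqrt_pos.2 hp0
  refine le_of_mul_le_mul_right ?_ hs0
  rw [hn, mul_assoc, hs]
  nlinarith

lemma norm_sum_units_addChar_le (hp2 : p ≠ 2) {ψ : AddChar (ZMod p) ℂ} (hψ : ψ ≠ 1)
    {a : ZMod p} (ha : a ≠ 0) (b : ZMod p) :
    ‖∑ u : (ZMod p)ˣ, ψ (u * a + b * (u⁻¹ : (ZMod p)ˣ))‖ ≤ 2 * √p := by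
  have hprim : ψ.IsPrimitive := AddChar.IsPrimitive.of_ne_one hψ
  by_cases hb : b = 0
  · simp only [hb, zero_mul, add_zero]
    rw [sum_units_mul ψ hprim, if_neg ha, zero_sub, norm_neg, norm_one]
    have : 1 ≤ √(p : ℝ) := Real.one_le_sqrt.2 (by exact_mod_cast hp.out.one_le)
    linarith
  · refine le_of_eq_of_le ?_ (norm_kloosterman_le hp2 hψ (mul_ne_zero ha hb))
    congr 1
    rw [← Finset.add_sum_erase univ _ (mem_univ (0 : ZMod p)), if_pos rfl, zero_add,
      ← sum_units_eq fun x => if x = 0 then 0 else ψ (x + a * b * x⁻¹)]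
    refine Fintype.sum_equiv (Equiv.mulRight (Units.mk0 a ha)) _ _ fun u => ?_
    rw [if_neg (Units.ne_zero _)]
    congr 1
    simp only [Equiv.coe_mulRight, Units.val_mul, Units.val_mk0, Units.val_inv_eq_inv_val]
    field_simp

/-- A square-invariant weight on the units is a combination of the trivial and the quadratic
character. -/
lemma exists_eq_add_quadraticChar (w : (ZMod p)ˣ → ℂ) (hw : ∀ u v, w (u * v ^ 2) = w u)
    (hw1 : ∀ u, ‖w u‖ ≤ 1) :
    ∃ A B : ℂ, ‖A‖ ≤ 1 ∧ ‖B‖ ≤ 1 ∧ ∀ u, w u = A + B * quadraticChar (ZMod p) u := by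
  have hsq : ∀ u : (ZMod p)ˣ, quadraticChar (ZMod p) u = 1 → w u = w 1 := by
    intro u hu
    obtain ⟨v, hv⟩ := (quadraticChar_one_iff_isSquare u.ne_zero).1 hu
    have hv0 : v ≠ 0 := by
      rintro rfl
      exact u.ne_zero (by rw [hv, mul_zero])
    rw [← hw 1 (Units.mk0 v hv0)]
    congr 1
    ext
    simp [hv, sq]
  by_cases hex : ∃ n : (ZMod p)ˣ, quadraticChar (ZMod p) n = -1
  · obtain ⟨n, hn⟩ := hex
    refine ⟨(w 1 + w n) / 2, (w 1 - w n) / 2, ?_, ?_, ?_⟩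
    · rw [norm_div, div_le_iff₀ (by simp)]
      simpa using (norm_add_le _ _).trans (by linarith [hw1 1, hw1 n] : ‖w 1‖ + ‖w n‖ ≤ 2)
    · rw [norm_div, div_le_iff₀ (by simp)]
      simpa using (norm_sub_le _ _).trans (by linarith [hw1 1, hw1 n] : ‖w 1‖ + ‖w n‖ ≤ 2)
    · intro u
      rcases quadraticChar_dichotomy u.ne_zero with h | h
      · rw [h, hsq u h]
        push_cast
        ring
      · have h1 : quadraticChar (ZMod p) ((u * n⁻¹ : (ZMod p)ˣ) : ZMod p) = 1 := by
          have : quadraticChar (ZMod p) (u : ZMod p) =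
              quadraticChar (ZMod p) ((u * n⁻¹ : (ZMod p)ˣ) : ZMod p) *
                quadraticChar (ZMod p) n := by
            rw [← map_mul, ← Units.val_mul, inv_mul_cancel_right]
          rw [h, hn] at this
          linarith
        obtain ⟨v, hv⟩ := (quadraticChar_one_iff_isSquare (Units.ne_zero _)).1 h1
        have hv0 : v ≠ 0 := by
          rintro rfl
          exact (u * n⁻¹).ne_zero (by rw [hv, mul_zero])
        have h2 : w u = w n := by
          rw [← hw n (Units.mk0 v hv0)]
          congr 1
          have : Units.mk0 v hv0 ^ 2 = u * n⁻¹ := by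
            ext
            simp [hv, sq]
          rw [this, mul_comm, inv_mul_cancel_right]
        rw [h, h2]
        push_cast
        ring
  · refine ⟨w 1, 0, hw1 1, by simp, fun u => ?_⟩
    rw [zero_mul, add_zero]
    exact hsq u ((quadraticChar_dichotomy u.ne_zero).resolve_right fun h => hex ⟨u, h⟩)

lemma norm_twistedSum_prime_le (hp2 : p ≠ 2) {ψ : AddChar (ZMod p) ℂ} (hψ : ψ.IsPrimitive)
    (w : (ZMod p)ˣ → ℂ) (hw : ∀ u v, w (u * v ^ 2) = w u) (hw1 : ∀ u, ‖w u‖ ≤ 1)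
    (N : ℕ) (b : ZMod p) :
    ‖∑ u : (ZMod p)ˣ, w u * ψ (-(u * N) + b * (u⁻¹ : (ZMod p)ˣ))‖ ≤
      4 * √p * √(Nat.gcd N p) := by
  have hp0 : (0 : ℝ) < p := by exact_mod_cast hp.out.pos
  by_cases hN : (N : ZMod p) = 0
  · rw [ZMod.natCast_eq_zero_iff] at hN
    rw [Nat.gcd_eq_right hN, mul_assoc, Real.mul_self_sqrt hp0.le]
    refine (norm_sum_le _ _).trans ?_
    calc ∑ u : (ZMod p)ˣ, ‖w u * ψ (-(u * N) + b * (u⁻¹ : (ZMod p)ˣ))‖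
        ≤ ∑ u : (ZMod p)ˣ, (1 : ℝ) := by
          refine Finset.sum_le_sum fun u _ => ?_
          rw [norm_mul, AddChar.norm_apply, mul_one]
          exact hw1 u
      _ ≤ p := by
          rw [Finset.sum_const, nsmul_eq_mul, mul_one, card_univ, ZMod.card_units_eq_totient]
          exact_mod_cast Nat.totient_le p
      _ ≤ 4 * p := by linarith
  · have hgcd : 1 ≤ √(Nat.gcd N p : ℝ) := by
      rw [Real.one_le_sqrt]
      exact_mod_cast Nat.gcd_pos_of_pos_right _ hp.out.pos
    refine le_trans ?_ (le_mul_of_one_le_right (by positivity) hgcd)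
    have hψ1 : ψ ≠ 1 := by
      have := hψ one_ne_zero
      rwa [show ψ.mulShift 1 = ψ by ext; simp] at this
    obtain ⟨A, B, hA, hB, hAB⟩ := exists_eq_add_quadraticChar w hw hw1
    have hN' : -(N : ZMod p) ≠ 0 := neg_ne_zero.2 hN
    have e : ∑ u : (ZMod p)ˣ, w u * ψ (-(u * N) + b * (u⁻¹ : (ZMod p)ˣ)) =
        A * ∑ u : (ZMod p)ˣ, ψ (u * (-(N : ZMod p)) + b * (u⁻¹ : (ZMod p)ˣ)) +
        B * ∑ u : (ZMod p)ˣ, (quadraticChar (ZMod p) u : ℂ) *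
          ψ (u * (-(N : ZMod p)) + b * (u⁻¹ : (ZMod p)ˣ)) := by
      rw [Finset.mul_sum, Finset.mul_sum, ← Finset.sum_add_distrib]
      refine Finset.sum_congr rfl fun u _ => ?_
      rw [hAB, mul_neg]
      ring
    have h1 := norm_sum_units_addChar_le hp2 hψ1 hN' b
    have h2 : ‖∑ u : (ZMod p)ˣ, (quadraticChar (ZMod p) u : ℂ) *
          ψ (u * (-(N : ZMod p)) + b * (u⁻¹ : (ZMod p)ˣ))‖ ≤ 2 * √p := by
      by_cases hb : b = 0
      · have h3 : ∑ u : (ZMod p)ˣ, (quadraticChar (ZMod p) u : ℂ) *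
            ψ (u * (-(N : ZMod p)) + b * (u⁻¹ : (ZMod p)ˣ)) =
            ∑ x, ψ (-(N : ZMod p) * x ^ 2) := by
          rw [← sum_quadraticChar_mul hp2 hψ hN',
            ← Finset.add_sum_erase univ _ (mem_univ (0 : ZMod p)), ← sum_units_eq
              fun x => (quadraticChar (ZMod p) x : ℂ) * ψ (-(N : ZMod p) * x)]
          rw [MulChar.map_zero, Int.cast_zero, zero_mul, zero_add]
          refine Finset.sum_congr rfl fun u _ => ?_
          rw [hb, zero_mul, add_zero, mul_comm (u : ZMod p)]
        have h4 := norm_gaussSum_sq hψ (Ring.two_ne_zero (by rwa [ZMod.ringChar_zmod_n])).isUnit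
          (Units.mk0 _ hN')
        rw [ZMod.card, Units.val_mk0] at h4
        rw [h3, ← Real.sqrt_sq (norm_nonneg _), h4]
        linarith [Real.sqrt_nonneg (p : ℝ)]
      · exact norm_salie_le hp2 hψ _ hb
    rw [e]
    refine (norm_add_le _ _).trans ?_
    rw [norm_mul, norm_mul]
    have := mul_le_mul hA h1 (norm_nonneg _) zero_le_one
    have := mul_le_mul hB h2 (norm_nonneg _) zero_le_one
    linarith

end PrimeField

section PrimePower

open Finset

variable {p : ℕ} [hp : Fact p.Prime] {k : ℕ}

lemma prime_dvd_or_isUnit (x : ZMod (p ^ k)) : (p : ZMod (p ^ k)) ∣ x ∨ IsUnit x := by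
  rw [← ZMod.natCast_zmod_val x, ZMod.isUnit_iff_coprime]
  by_cases h : p ∣ x.val
  · exact Or.inl ((Nat.cast_dvd_cast h))
  · exact Or.inr (Nat.Coprime.pow_right _ ((hp.out.coprime_iff_not_dvd.2 h).symm))

omit hp in
lemma prime_pow_eq_zero : (p : ZMod (p ^ k)) ^ k = 0 := by
  rw [← Nat.cast_pow, ZMod.natCast_self]

omit hp in
lemma prime_pow_eq_zero_of_le {j : ℕ} (hj : k ≤ j) : (p : ZMod (p ^ k)) ^ j = 0 := by
  rw [← Nat.sub_add_cancel hj, pow_add, prime_pow_eq_zero, mul_zero]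

lemma prime_pow_ne_zero {j : ℕ} (hj : j < k) : (p : ZMod (p ^ k)) ^ j ≠ 0 := by
  rw [← Nat.cast_pow, Ne, ZMod.natCast_eq_zero_iff, Nat.pow_dvd_pow_iff_le_right hp.out.one_lt]
  omega

lemma not_isUnit_of_prime_dvd (hk : k ≠ 0) {x : ZMod (p ^ k)} (hx : (p : ZMod (p ^ k)) ∣ x) :
    ¬ IsUnit x := by
  intro h
  have h1 : IsUnit ((p : ZMod (p ^ k)) ^ k) := (isUnit_of_dvd_unit hx h).pow k
  rw [prime_pow_eq_zero] at h1
  have : (0 : ZMod (p ^ k)) = p ^ 0 := isUnit_zero_iff.1 h1 |>.trans (pow_zero _).symm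
  exact prime_pow_ne_zero (Nat.pos_of_ne_zero hk) this.symm

lemma prime_dvd_iff_not_isUnit (hk : k ≠ 0) {x : ZMod (p ^ k)} :
    (p : ZMod (p ^ k)) ∣ x ↔ ¬ IsUnit x :=
  ⟨not_isUnit_of_prime_dvd hk, (prime_dvd_or_isUnit x).resolve_right⟩

lemma isUnit_two_of_odd {q : ℕ} (hq : Odd q) : IsUnit (2 : ZMod q) := by
  have := (ZMod.isUnit_iff_coprime 2 q).2 (Nat.coprime_two_left.2 hq)
  simpa using this

lemma exists_sq_of_prime_dvd_sub_one (hp2 : p ≠ 2) (hk : k ≠ 0) {e : (ZMod (p ^ k))ˣ}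
    (he : (p : ZMod (p ^ k)) ∣ e - 1) : ∃ v : (ZMod (p ^ k))ˣ, e = v ^ 2 := by
  have h1 : e ^ p ^ (k - 1) = 1 := by
    have h2 := dvd_sub_pow_of_dvd_sub he (k - 1)
    rw [Nat.sub_add_cancel (Nat.pos_of_ne_zero hk), prime_pow_eq_zero, zero_dvd_iff, one_pow,
      sub_eq_zero] at h2
    ext
    simpa using h2
  obtain ⟨j, hj⟩ : Odd (p ^ (k - 1)) := (hp.out.odd_of_ne_two hp2).pow
  refine ⟨(e ^ j)⁻¹, ?_⟩
  rw [hj, pow_succ, mul_comm 2 j, pow_mul] at h1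
  rw [inv_pow, eq_inv_iff_mul_eq_one, mul_comm]
  exact h1

lemma card_pow_mul_eq_zero_le {s : ℕ} (hs : s ≤ k) :
    (univ.filter fun x : ZMod (p ^ k) => (p : ZMod (p ^ k)) ^ s * x = 0).card ≤ p ^ s := by
  have h1 : (univ.filter fun x : ZMod (p ^ k) => (p : ZMod (p ^ k)) ^ s * x = 0) ⊆
      (range (p ^ s)).image fun j : ℕ => ((p ^ (k - s) * j : ℕ) : ZMod (p ^ k)) := by
    intro x hx
    rw [mem_filter, ← ZMod.natCast_zmod_val x, ← Nat.cast_pow, ← Nat.cast_mul,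
      ZMod.natCast_eq_zero_iff] at hx
    have h2 : p ^ k = p ^ s * p ^ (k - s) := by rw [← pow_add, Nat.add_sub_cancel' hs]
    have h3 := hx.2
    conv_lhs at h3 => rw [h2]
    obtain ⟨j, hj⟩ := Nat.dvd_of_mul_dvd_mul_left (pow_pos hp.out.pos s) h3
    rw [mem_image]
    refine ⟨j, mem_range.2 ?_, by rw [← hj, ZMod.natCast_zmod_val]⟩
    have h4 := ZMod.val_lt x
    conv_rhs at h4 => rw [h2]
    rw [hj, mul_comm] at h4
    exact lt_of_mul_lt_mul_right h4 (Nat.zero_le _)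
  exact (card_le_card h1).trans (card_image_le.trans (card_range _).le)

lemma card_stationary_le (hp2 : p ≠ 2) {s : ℕ} (hs : s < k) {a b : ZMod (p ^ k)}
    (hab : IsUnit a ∨ IsUnit b) :
    (univ.filter fun u : (ZMod (p ^ k))ˣ =>
      (p : ZMod (p ^ k)) ^ s * (a * u ^ 2 - b) = 0).card ≤ 2 * p ^ s ∧
    ∀ u : (ZMod (p ^ k))ˣ, (p : ZMod (p ^ k)) ^ s * (a * u ^ 2 - b) = 0 → IsUnit b := by
  have hk : k ≠ 0 := by omega
  have hdvd : ∀ u : (ZMod (p ^ k))ˣ, (p : ZMod (p ^ k)) ^ s * (a * u ^ 2 - b) = 0 →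
      (p : ZMod (p ^ k)) ∣ a * u ^ 2 - b := by
    intro u hu
    rw [prime_dvd_iff_not_isUnit hk]
    intro h
    rw [h.mul_left_eq_zero] at hu
    exact prime_pow_ne_zero hs hu
  have hboth : ∀ u : (ZMod (p ^ k))ˣ, (p : ZMod (p ^ k)) ^ s * (a * u ^ 2 - b) = 0 →
      IsUnit a ∧ IsUnit b := by
    intro u hu
    have h1 := hdvd u hu
    by_contra hcon
    have h2 : (p : ZMod (p ^ k)) ∣ a ∨ (p : ZMod (p ^ k)) ∣ b := by
      rw [prime_dvd_iff_not_isUnit hk, prime_dvd_iff_not_isUnit hk]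
      tauto
    have h3 : (p : ZMod (p ^ k)) ∣ a ∧ (p : ZMod (p ^ k)) ∣ b := by
      rcases h2 with h | h
      · refine ⟨h, ?_⟩
        have := dvd_sub (h.mul_right (u ^ 2 : ZMod (p ^ k))) h1
        rwa [sub_sub_cancel] at this
      · refine ⟨?_, h⟩
        have := dvd_add h1 h
        rw [sub_add_cancel] at this
        have h4 := this.mul_right ((u⁻¹ : (ZMod (p ^ k))ˣ) ^ 2 : ZMod (p ^ k))
        rwa [mul_assoc, ← mul_pow, Units.mul_inv, one_pow, mul_one] at h4
    rw [prime_dvd_iff_not_isUnit hk, prime_dvd_iff_not_isUnit hk] at h3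
    tauto
  refine ⟨?_, fun u hu => (hboth u hu).2⟩
  rcases (univ.filter fun u : (ZMod (p ^ k))ˣ =>
      (p : ZMod (p ^ k)) ^ s * (a * u ^ 2 - b) = 0).eq_empty_or_nonempty with h0 | ⟨u₀, hu₀⟩
  · rw [h0]
    simp
  rw [mem_filter] at hu₀
  have ha := (hboth u₀ hu₀.2).1
  have h2 : IsUnit (2 : ZMod (p ^ k)) := isUnit_two_of_odd (hp.out.odd_of_ne_two hp2).pow
  set Z := univ.filter fun x : ZMod (p ^ k) => (p : ZMod (p ^ k)) ^ s * x = 0 with hZ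
  have hsub : (univ.filter fun u : (ZMod (p ^ k))ˣ =>
      (p : ZMod (p ^ k)) ^ s * (a * u ^ 2 - b) = 0).image (Units.val (α := ZMod (p ^ k))) ⊆
      Z.image (fun z => z + u₀) ∪ Z.image (fun z => z - u₀) := by
    intro x hx
    rw [mem_image] at hx
    obtain ⟨u, hu, rfl⟩ := hx
    rw [mem_filter] at hu
    have h3 : (p : ZMod (p ^ k)) ^ s * ((u - u₀) * (u + u₀)) = 0 := by
      have : a * ((p : ZMod (p ^ k)) ^ s * ((u - u₀) * (u + u₀))) = 0 := by
        linear_combination hu.2 - hu₀.2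
      rwa [ha.mul_right_eq_zero] at this
    have h4 : IsUnit (u - u₀ : ZMod (p ^ k)) ∨ IsUnit (u + u₀ : ZMod (p ^ k)) := by
      by_contra! hcon
      rw [← prime_dvd_iff_not_isUnit hk, ← prime_dvd_iff_not_isUnit hk] at hcon
      have h5 := dvd_add hcon.1 hcon.2
      rw [show (u - u₀ + (u + u₀) : ZMod (p ^ k)) = 2 * u by ring] at h5
      exact not_isUnit_of_prime_dvd hk h5 (h2.mul u.isUnit)
    rw [mem_union, mem_image, mem_image]
    rcases h4 with h4 | h4
    · right
      refine ⟨u + u₀, ?_, by ring⟩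
      rw [hZ, mem_filter]
      refine ⟨mem_univ _, ?_⟩
      rw [← h4.mul_right_eq_zero]
      linear_combination h3
    · left
      refine ⟨u - u₀, ?_, by ring⟩
      rw [hZ, mem_filter]
      refine ⟨mem_univ _, ?_⟩
      rw [← h4.mul_left_eq_zero]
      linear_combination h3
  rw [← card_image_of_injective _ (Units.val_injective (α := ZMod (p ^ k)))]
  refine (card_le_card hsub).trans ((card_union_le _ _).trans ?_)
  have hZc := card_pow_mul_eq_zero_le (p := p) hs.le
  have h6 : (Z.image (fun z => z + (u₀ : ZMod (p ^ k)))).card ≤ Z.card := card_image_le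
  have h7 : (Z.image (fun z => z - (u₀ : ZMod (p ^ k)))).card ≤ Z.card := card_image_le
  rw [← hZ] at hZc
  omega

lemma isUnit_one_add_and_sq (hp2 : p ≠ 2) (hk : k ≠ 0) {x y : ZMod (p ^ k)}
    (hx : (p : ZMod (p ^ k)) ∣ x) (hxy : (1 + x) * y = 1) :
    ∃ v : (ZMod (p ^ k))ˣ, ((v ^ 2 : (ZMod (p ^ k))ˣ) : ZMod (p ^ k)) = 1 + x ∧
      (((v ^ 2)⁻¹ : (ZMod (p ^ k))ˣ) : ZMod (p ^ k)) = y := by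
  obtain ⟨v, hv⟩ := exists_sq_of_prime_dvd_sub_one (p := p) (k := k) hp2 hk
    (e := ⟨1 + x, y, hxy, by rw [mul_comm, hxy]⟩) (by simpa using hx)
  exact ⟨v, by rw [← hv], by rw [← hv]; rfl⟩

lemma sum_eq_sum_stationary (hp2 : p ≠ 2) {s : ℕ} (hs : s < k) (hks : k ≤ 2 * s)
    {ψ : AddChar (ZMod (p ^ k)) ℂ} (hψ : ψ.IsPrimitive) {w : (ZMod (p ^ k))ˣ → ℂ}
    (hw : ∀ u v, w (u * v ^ 2) = w u) (a b : ZMod (p ^ k)) :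
    ∑ u : (ZMod (p ^ k))ˣ, w u * ψ (a * u + b * (u⁻¹ : (ZMod (p ^ k))ˣ)) =
      ∑ u ∈ univ.filter fun u : (ZMod (p ^ k))ˣ => (p : ZMod (p ^ k)) ^ s * (a * u ^ 2 - b) = 0,
        w u * ψ (a * u + b * (u⁻¹ : (ZMod (p ^ k))ˣ)) := by
  have hk : k ≠ 0 := by omega
  have hs0 : s ≠ 0 := by omega
  have h0 : (p : ZMod (p ^ k)) ^ (2 * s) = 0 := prime_pow_eq_zero_of_le hks
  have hv : ∀ t : ZMod (p ^ k), ∃ v : (ZMod (p ^ k))ˣ,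
      ((v ^ 2 : (ZMod (p ^ k))ˣ) : ZMod (p ^ k)) = 1 + p ^ s * t ∧
      (((v ^ 2)⁻¹ : (ZMod (p ^ k))ˣ) : ZMod (p ^ k)) = 1 - p ^ s * t := by
    intro t
    refine isUnit_one_add_and_sq hp2 hk ((dvd_pow_self _ hs0).mul_right _) ?_
    linear_combination (-t ^ 2) * h0
  choose v hv1 hv2 using hv
  have hq : (Fintype.card (ZMod (p ^ k)) : ℂ) ≠ 0 := Nat.cast_ne_zero.2 Fintype.card_ne_zero
  rw [Finset.sum_filter]
  refine mul_left_cancel₀ hq ?_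
  have h1 : ∀ t, ∑ u : (ZMod (p ^ k))ˣ, w u * ψ (a * u + b * (u⁻¹ : (ZMod (p ^ k))ˣ)) =
      ∑ u : (ZMod (p ^ k))ˣ, w u * ψ (a * u + b * (u⁻¹ : (ZMod (p ^ k))ˣ)) *
        ψ (t * (p ^ s * (a * u - b * (u⁻¹ : (ZMod (p ^ k))ˣ)))) := by
    intro t
    refine (Fintype.sum_equiv (Equiv.mulRight (v t ^ 2)) _ _ fun u => ?_).symm
    rw [Equiv.coe_mulRight, hw, mul_assoc, ← AddChar.map_add_eq_mul, mul_inv, Units.val_mul,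
      Units.val_mul, hv1, hv2]
    congr 2
    ring
  calc (Fintype.card (ZMod (p ^ k)) : ℂ) * _
      = ∑ t : ZMod (p ^ k), ∑ u : (ZMod (p ^ k))ˣ,
          w u * ψ (a * u + b * (u⁻¹ : (ZMod (p ^ k))ˣ)) := by
        rw [Finset.sum_const, Finset.card_univ, nsmul_eq_mul]
    _ = _ := by
        rw [Finset.sum_congr rfl fun t _ => h1 t, Finset.sum_comm, Finset.mul_sum]
        refine Finset.sum_congr rfl fun u _ => ?_
        rw [← Finset.mul_sum, AddChar.sum_mulShift _ hψ]
        have h2 : (p : ZMod (p ^ k)) ^ s * (a * u - b * (u⁻¹ : (ZMod (p ^ k))ˣ)) = 0 ↔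
            (p : ZMod (p ^ k)) ^ s * (a * u ^ 2 - b) = 0 := by
          rw [← u.isUnit.mul_left_eq_zero (a := (p : ZMod (p ^ k)) ^ s * _)]
          have hu := u.inv_mul
          constructor
          · intro h
            linear_combination h + p ^ s * b * hu
          · intro h
            linear_combination h - p ^ s * b * hu
        simp only [h2]
        split_ifs
        · ring
        · simp

lemma norm_sum_le_of_isUnit (hp2 : p ≠ 2) (hk : 2 ≤ k) {ψ : AddChar (ZMod (p ^ k)) ℂ}
    (hψ : ψ.IsPrimitive) {w : (ZMod (p ^ k))ˣ → ℂ} (hw : ∀ u v, w (u * v ^ 2) = w u)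
    (hw1 : ∀ u, ‖w u‖ ≤ 1) {a b : ZMod (p ^ k)} (hab : IsUnit a ∨ IsUnit b) :
    ‖∑ u : (ZMod (p ^ k))ˣ, w u * ψ (a * u + b * (u⁻¹ : (ZMod (p ^ k))ˣ))‖ ≤
      2 * √((p : ℝ) ^ k) := by
  have hk0 : k ≠ 0 := by omega
  have hG : ∀ u : (ZMod (p ^ k))ˣ, ‖w u * ψ (a * u + b * (u⁻¹ : (ZMod (p ^ k))ˣ))‖ ≤ 1 := by
    intro u
    rw [norm_mul, AddChar.norm_apply, mul_one]
    exact hw1 u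
  obtain ⟨m, hm | hm⟩ := Nat.even_or_odd' k
  · rw [sum_eq_sum_stationary hp2 (s := m) (by omega) (by omega) hψ hw]
    have hc := (card_stationary_le hp2 (s := m) (by omega) hab).1
    refine (norm_sum_le_of_le _ fun u _ => hG u).trans ?_
    have hsq : √((p : ℝ) ^ k) = p ^ m := by
      rw [hm, mul_comm 2 m, pow_mul, Real.sqrt_sq (by positivity)]
    rw [hsq, Finset.sum_const, nsmul_eq_mul, mul_one]
    exact_mod_cast hc
  · have hm0 : m ≠ 0 := by omega
    rw [sum_eq_sum_stationary hp2 (s := m + 1) (by omega) (by omega) hψ hw]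
    obtain ⟨hc, hb⟩ := card_stationary_le hp2 (s := m + 1) (by omega) hab
    set U := univ.filter fun u : (ZMod (p ^ k))ˣ =>
      (p : ZMod (p ^ k)) ^ (m + 1) * (a * u ^ 2 - b) = 0 with hU
    have h0 : (p : ZMod (p ^ k)) ^ (2 * m + 1) = 0 := prime_pow_eq_zero_of_le hm.le
    have h0' : (p : ZMod (p ^ k)) ^ (3 * m) = 0 := prime_pow_eq_zero_of_le (by omega)
    have hv : ∀ t : ZMod (p ^ k), ∃ v : (ZMod (p ^ k))ˣ,
        ((v ^ 2 : (ZMod (p ^ k))ˣ) : ZMod (p ^ k)) = 1 + p ^ m * t ∧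
        (((v ^ 2)⁻¹ : (ZMod (p ^ k))ˣ) : ZMod (p ^ k)) =
          1 - p ^ m * t + p ^ (2 * m) * t ^ 2 := by
      intro t
      refine isUnit_one_add_and_sq hp2 hk0 ((dvd_pow_self _ hm0).mul_right _) ?_
      linear_combination (t ^ 3) * h0'
    choose v hv1 hv2 using hv
    have hinv : ∀ t u, u * v t ^ 2 ∈ U ↔ u ∈ U := by
      intro t u
      rw [hU, mem_filter, mem_filter, Units.val_mul, hv1]
      simp only [mem_univ, true_and]
      constructor
      · intro h
        linear_combination h - (a * u ^ 2 * (2 * t + p ^ m * t ^ 2)) * h0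
      · intro h
        linear_combination h + (a * u ^ 2 * (2 * t + p ^ m * t ^ 2)) * h0
    have h1 : ∀ t, ∑ u ∈ U, w u * ψ (a * u + b * (u⁻¹ : (ZMod (p ^ k))ˣ)) =
        ∑ u ∈ U, w u * ψ (a * u + b * (u⁻¹ : (ZMod (p ^ k))ˣ)) *
          ψ (p ^ m * (a * u - b * (u⁻¹ : (ZMod (p ^ k))ˣ)) * t +
            p ^ (2 * m) * (b * (u⁻¹ : (ZMod (p ^ k))ˣ)) * t ^ 2) := by
      intro t
      refine (Finset.sum_equiv (Equiv.mulRight (v t ^ 2)) (fun u => (hinv t u).symm)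
        fun u _ => ?_).symm
      rw [Equiv.coe_mulRight, hw, mul_assoc, ← AddChar.map_add_eq_mul, mul_inv, Units.val_mul,
        Units.val_mul, hv1, hv2]
      congr 2
      ring
    have hq : (0 : ℝ) < (p : ℝ) ^ k := pow_pos (Nat.cast_pos.2 hp.out.pos) k
    have h2 : ∀ u ∈ U, ‖∑ t, ψ (p ^ m * (a * u - b * (u⁻¹ : (ZMod (p ^ k))ˣ)) * t +
            p ^ (2 * m) * (b * (u⁻¹ : (ZMod (p ^ k))ˣ)) * t ^ 2)‖ ≤ √((p : ℝ) ^ k) * p ^ m := by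
      intro u hu
      rw [hU, mem_filter] at hu
      have hbu := (hb u hu.2).mul (u⁻¹).isUnit
      have h2 : IsUnit (2 : ZMod (p ^ k)) := isUnit_two_of_odd (hp.out.odd_of_ne_two hp2).pow
      refine abs_le_of_sq_le_sq' ((norm_quadraticSum_sq_le hψ _ _).trans ?_) (by positivity) |>.2
      have h3 : (univ.filter fun h : ZMod (p ^ k) =>
          2 * (p ^ (2 * m) * (b * (u⁻¹ : (ZMod (p ^ k))ˣ))) * h = 0) =
          univ.filter fun h : ZMod (p ^ k) => (p : ZMod (p ^ k)) ^ (2 * m) * h = 0 := by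
        ext h
        rw [mem_filter, mem_filter,
          show 2 * (p ^ (2 * m) * (b * (u⁻¹ : (ZMod (p ^ k))ˣ))) * h =
            2 * (b * (u⁻¹ : (ZMod (p ^ k))ˣ)) * (p ^ (2 * m) * h) by ring,
          (h2.mul hbu).mul_right_eq_zero]
      rw [h3, mul_pow, Real.sq_sqrt hq.le, ZMod.card, Nat.cast_pow, ← pow_mul, mul_comm m 2]
      gcongr
      exact_mod_cast card_pow_mul_eq_zero_le (p := p) (k := k) (s := 2 * m) (by omega)
    have h3 : (p : ℝ) ^ k * ‖∑ u ∈ U, w u * ψ (a * u + b * (u⁻¹ : (ZMod (p ^ k))ˣ))‖ ≤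
        (p : ℝ) ^ k * (2 * √((p : ℝ) ^ k)) := by
      calc (p : ℝ) ^ k * ‖∑ u ∈ U, w u * ψ (a * u + b * (u⁻¹ : (ZMod (p ^ k))ˣ))‖
          = ‖∑ t : ZMod (p ^ k), ∑ u ∈ U,
              w u * ψ (a * u + b * (u⁻¹ : (ZMod (p ^ k))ˣ))‖ := by
            rw [Finset.sum_const, Finset.card_univ, ZMod.card, nsmul_eq_mul, norm_mul,
              Complex.norm_natCast, Nat.cast_pow]
        _ ≤ ∑ u ∈ U, √((p : ℝ) ^ k) * p ^ m := by
            rw [Finset.sum_congr rfl fun t _ => h1 t, Finset.sum_comm]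
            refine norm_sum_le_of_le _ fun u hu => ?_
            rw [← Finset.mul_sum, norm_mul]
            have := mul_le_mul (hG u) (h2 u hu) (norm_nonneg _) zero_le_one
            rwa [one_mul] at this
        _ ≤ (2 * p ^ (m + 1)) * (√((p : ℝ) ^ k) * p ^ m) := by
            rw [Finset.sum_const, nsmul_eq_mul]
            gcongr
            exact_mod_cast hc
        _ = (p : ℝ) ^ k * (2 * √((p : ℝ) ^ k)) := by
            conv_rhs => rw [show (p : ℝ) ^ k = p ^ (m + 1) * p ^ m by
              rw [← pow_add, hm]; congr 1; omega]
            rw [show √((p : ℝ) ^ (m + 1) * p ^ m) = √((p : ℝ) ^ k) by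
              rw [← pow_add, hm]; congr 2; omega]
            ring
    exact le_of_mul_le_mul_left h3 hq

lemma sum_comp_of_surjective {G H : Type*} [Group G] [Group H] [Fintype G] [Fintype H]
    [DecidableEq H] {φ : G →* H} (hφ : Function.Surjective φ) {c : ℕ}
    (hc : Fintype.card G = c * Fintype.card H) (F : H → ℂ) :
    ∑ g, F (φ g) = c * ∑ h, F h := by
  have h1 : ∀ h, (univ.filter fun g => φ g = h).card = (univ.filter fun g => φ g = 1).card :=
    fun h => MonoidHom.card_fiber_eq_of_mem_range φ (hφ h) (hφ 1)
  have h2 : (univ.filter fun g => φ g = 1).card = c := by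
    have h3 : Fintype.card G = ∑ h : H, (univ.filter fun g => φ g = h).card := by
      rw [← Finset.card_univ, Finset.card_eq_sum_card_fiberwise fun g _ => mem_univ (φ g)]
    rw [Finset.sum_congr rfl fun h _ => h1 h, Finset.sum_const, Finset.card_univ, smul_eq_mul, hc,
      mul_comm] at h3
    exact (Nat.eq_of_mul_eq_mul_left Fintype.card_pos h3).symm
  rw [← Finset.sum_fiberwise univ φ, Finset.mul_sum]
  refine Finset.sum_congr rfl fun h _ => ?_
  rw [Finset.sum_congr rfl fun g hg => by rw [(mem_filter.1 hg).2], Finset.sum_const, h1, h2,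
    nsmul_eq_mul]

lemma exists_descent {j : ℕ} (hj : j ≠ 0) (hp2 : p ≠ 2) {ψ : AddChar (ZMod (p ^ (j + 1))) ℂ}
    (hψ : ψ.IsPrimitive) {w : (ZMod (p ^ (j + 1)))ˣ → ℂ} (hw : ∀ u v, w (u * v ^ 2) = w u)
    (hw1 : ∀ u, ‖w u‖ ≤ 1) (N : ℕ) (b : ZMod (p ^ (j + 1))) :
    ∃ (ψ' : AddChar (ZMod (p ^ j)) ℂ) (w' : (ZMod (p ^ j))ˣ → ℂ) (b' : ZMod (p ^ j)),
      ψ'.IsPrimitive ∧ (∀ u v, w' (u * v ^ 2) = w' u) ∧ (∀ u, ‖w' u‖ ≤ 1) ∧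
      ∑ u : (ZMod (p ^ (j + 1)))ˣ,
          w u * ψ (-(u * (p * N : ℕ)) + p * b * (u⁻¹ : (ZMod (p ^ (j + 1)))ˣ)) =
        p * ∑ u : (ZMod (p ^ j))ˣ, w' u * ψ' (-(u * N) + b' * (u⁻¹ : (ZMod (p ^ j))ˣ)) := by
  have hdvd : p ^ j ∣ p ^ (j + 1) := pow_dvd_pow p j.le_succ
  set π := ZMod.castHom hdvd (ZMod (p ^ j)) with hπ
  have hπs : Function.Surjective π := ZMod.castHom_surjective hdvd
  have hπp : ∀ x y, π x = π y → (p : ZMod (p ^ (j + 1))) * x = p * y := by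
    intro x y h
    rw [← ZMod.natCast_zmod_val x, ← ZMod.natCast_zmod_val y, map_natCast, map_natCast,
      ZMod.natCast_eq_natCast_iff] at h
    rw [← ZMod.natCast_zmod_val x, ← ZMod.natCast_zmod_val y, ← Nat.cast_mul, ← Nat.cast_mul,
      ZMod.natCast_eq_natCast_iff]
    have h1 := Nat.ModEq.mul_left' p h
    rwa [← pow_succ'] at h1
  choose l hl using hπs
  let ψ' : AddChar (ZMod (p ^ j)) ℂ :=
    { toFun := fun x => ψ (p * l x)
      map_zero_eq_one' := by
        rw [hπp (l 0) 0 (by rw [hl, map_zero]), mul_zero, AddChar.map_zero_eq_one]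
      map_add_eq_mul' := fun x y => by
        rw [← AddChar.map_add_eq_mul, ← mul_add,
          hπp (l (x + y)) (l x + l y) (by rw [hl, map_add, hl, hl])] }
  have hψ' : ∀ x, ψ' (π x) = ψ (p * x) := by
    intro x
    change ψ (p * l (π x)) = _
    rw [hπp (l (π x)) x (hl _)]
  have hφs : Function.Surjective (ZMod.unitsMap hdvd) := ZMod.unitsMap_surjective hdvd
  choose g hg using hφs
  have hwg : ∀ u u', ZMod.unitsMap hdvd u = ZMod.unitsMap hdvd u' → w u = w u' := by
    intro u u' h
    have h1 : (p : ZMod (p ^ (j + 1))) ∣ (u'⁻¹ * u : (ZMod (p ^ (j + 1)))ˣ) - 1 := by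
      rw [prime_dvd_iff_not_isUnit j.succ_ne_zero]
      intro h2
      have h3 := h2.map π
      have h4 : ZMod.unitsMap hdvd (u'⁻¹ * u) = 1 := by rw [map_mul, map_inv, h, inv_mul_cancel]
      have h5 := congrArg Units.val h4
      rw [ZMod.unitsMap_val, Units.val_one] at h5
      rw [map_sub, map_one, hπ, ZMod.castHom_apply, h5, sub_self] at h3
      have h6 := isUnit_zero_iff.1 h3
      exact prime_pow_ne_zero (p := p) (Nat.pos_of_ne_zero hj) (by rw [pow_zero, h6])
    obtain ⟨v, hv⟩ := exists_sq_of_prime_dvd_sub_one hp2 j.succ_ne_zero h1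
    rw [show u = u' * v ^ 2 by rw [← hv, mul_inv_cancel_left], hw]
  refine ⟨ψ', fun u => w (g u), π b, ?_, ?_, fun u => hw1 _, ?_⟩
  · intro a ha h
    refine hψ (a := p * l a) ?_ ?_
    · intro h0
      apply ha
      rw [← hl a, ← ZMod.natCast_zmod_val (l a), map_natCast, ZMod.natCast_eq_zero_iff]
      rw [← ZMod.natCast_zmod_val (l a), ← Nat.cast_mul, ZMod.natCast_eq_zero_iff] at h0
      obtain ⟨c, hc⟩ := h0
      refine ⟨c, Nat.eq_of_mul_eq_mul_left hp.out.pos ?_⟩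
      rw [hc, pow_succ', mul_assoc]
    · ext x
      have h1 := DFunLike.congr_fun h (π x)
      rw [AddChar.mulShift_apply, AddChar.one_apply] at h1 ⊢
      rw [← h1, ← hl a, ← map_mul, hψ', hl, mul_assoc]
  · intro u v
    change w _ = w _
    rw [← hw (g u) (g v)]
    apply hwg
    rw [hg, map_mul, map_pow, hg, hg]
  · have hcard : Fintype.card (ZMod (p ^ (j + 1)))ˣ = p * Fintype.card (ZMod (p ^ j))ˣ := by
      rw [ZMod.card_units_eq_totient, ZMod.card_units_eq_totient,
        Nat.totient_prime_pow_succ hp.out, Nat.totient_prime_pow hp.out (Nat.pos_of_ne_zero hj),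
        ← mul_assoc, ← pow_succ', Nat.sub_add_cancel (Nat.pos_of_ne_zero hj)]
    rw [← sum_comp_of_surjective (ZMod.unitsMap_surjective hdvd) hcard]
    refine Finset.sum_congr rfl fun u _ => ?_
    change _ = w (g _) * _
    rw [hwg (g (ZMod.unitsMap hdvd u)) u (hg _), ← map_inv, ZMod.unitsMap_val, ZMod.unitsMap_val]
    have h1 : ψ' (-(((u : ZMod (p ^ (j + 1))).cast : ZMod (p ^ j)) * N) +
        π b * ((u⁻¹ : (ZMod (p ^ (j + 1)))ˣ) : ZMod (p ^ (j + 1))).cast) =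
        ψ' (π (-(u * N) + b * (u⁻¹ : (ZMod (p ^ (j + 1)))ˣ))) := by
      rw [map_add π, map_neg π, map_mul π, map_mul π, map_natCast π]
      rfl
    rw [h1, hψ']
    congr 2
    push_cast
    ring

theorem norm_twistedSum_prime_pow_le (hp2 : p ≠ 2) (hk : k ≠ 0)
    {ψ : AddChar (ZMod (p ^ k)) ℂ} (hψ : ψ.IsPrimitive) {w : (ZMod (p ^ k))ˣ → ℂ}
    (hw : ∀ u v, w (u * v ^ 2) = w u) (hw1 : ∀ u, ‖w u‖ ≤ 1) (N : ℕ) (b : ZMod (p ^ k)) :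
    ‖∑ u : (ZMod (p ^ k))ˣ, w u * ψ (-(u * N) + b * (u⁻¹ : (ZMod (p ^ k))ˣ))‖ ≤
      4 * √((p : ℝ) ^ k) * √(Nat.gcd N (p ^ k)) := by
  induction k generalizing N with
  | zero => exact absurd rfl hk
  | succ j ih =>
    by_cases hj : j = 0
    · subst hj
      have key : ∀ q : ℕ, q = p → ∀ {χ : AddChar (ZMod q) ℂ} (_ : χ.IsPrimitive)
          {f : (ZMod q)ˣ → ℂ} (_ : ∀ u v, f (u * v ^ 2) = f u) (_ : ∀ u, ‖f u‖ ≤ 1)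
          (c : ZMod q) [Fintype (ZMod q)ˣ],
          ‖∑ u : (ZMod q)ˣ, f u * χ (-(u * N) + c * (u⁻¹ : (ZMod q)ˣ))‖ ≤
            4 * √(q : ℝ) * √(Nat.gcd N q) := by
        intro q hq χ hχ f hf hf1 c _
        subst hq
        convert norm_twistedSum_prime_le hp2 hχ f hf hf1 N c
      have := key (p ^ (0 + 1)) (by simp) hψ hw hw1 b
      push_cast at this ⊢
      exact this
    by_cases hN : p ∣ N ∧ (p : ZMod (p ^ (j + 1))) ∣ b
    · obtain ⟨⟨N, rfl⟩, b, rfl⟩ := hN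
      obtain ⟨ψ', w', b', hψ', hw', hw1', h⟩ := exists_descent hj hp2 hψ hw hw1 N b
      rw [h, norm_mul, Complex.norm_natCast, pow_succ' p, Nat.gcd_mul_left, Nat.cast_mul,
        pow_succ' (p : ℝ), Real.sqrt_mul (Nat.cast_nonneg _), Real.sqrt_mul (Nat.cast_nonneg _)]
      have hs : √(p : ℝ) * √(p : ℝ) = p := Real.mul_self_sqrt (Nat.cast_nonneg _)
      calc _ ≤ (p : ℝ) * (4 * √((p : ℝ) ^ j) * √(Nat.gcd N (p ^ j))) := by
            gcongr
            exact ih hj hψ' hw' hw1' N b'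
        _ = _ := by
            linear_combination (-4 * √((p : ℝ) ^ j) * √(Nat.gcd N (p ^ j))) * hs
    · have hab : IsUnit (-(N : ZMod (p ^ (j + 1)))) ∨ IsUnit b := by
        by_contra! hcon
        rw [← prime_dvd_iff_not_isUnit j.succ_ne_zero, ← prime_dvd_iff_not_isUnit j.succ_ne_zero,
          dvd_neg, prime_dvd_iff_not_isUnit j.succ_ne_zero, ZMod.isUnit_iff_coprime] at hcon
        refine hN ⟨?_, hcon.2⟩
        by_contra h
        exact hcon.1 (Nat.Coprime.pow_right _ ((hp.out.coprime_iff_not_dvd.2 h).symm))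
      have h1 := norm_sum_le_of_isUnit hp2 (by omega) hψ hw hw1 hab
      have h2 : (1 : ℝ) ≤ √(Nat.gcd N (p ^ (j + 1))) := by
        rw [Real.one_le_sqrt, Nat.one_le_cast]
        exact Nat.gcd_pos_of_pos_right _ (pow_pos hp.out.pos _)
      calc _ = _ := by
            congr 1
            refine Finset.sum_congr rfl fun u _ => ?_
            rw [neg_mul, mul_comm (u : ZMod (p ^ (j + 1)))]
        _ ≤ _ := h1
        _ ≤ 4 * √((p : ℝ) ^ (j + 1)) * 1 := by
            rw [mul_one]
            gcongr
            norm_num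
        _ ≤ _ := by gcongr

end PrimePower

section OddModulus

open Finset

lemma norm_sphereSum_prime_pow_le {p k d : ℕ} [hp : Fact p.Prime] (hp2 : p ≠ 2) (hk : k ≠ 0)
    {ψ : AddChar (ZMod (p ^ k)) ℂ} (hψ : ψ.IsPrimitive) (N : ℕ) (n : Fin d → ZMod (p ^ k)) :
    ‖sphereSum ψ N n‖ ≤ 4 * √((p : ℝ) ^ k) ^ d * √((p : ℝ) ^ k) * √(Nat.gcd N (p ^ k)) := by
  have h2 : IsUnit (2 : ZMod (p ^ k)) := isUnit_two_of_odd (hp.out.odd_of_ne_two hp2).pow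
  obtain ⟨c, hc⟩ := sphereSum_eq ψ h2 (N : ZMod (p ^ k)) n
  have hs0 : 0 < √((p : ℝ) ^ k) := Real.sqrt_pos.2 (pow_pos (Nat.cast_pos.2 hp.out.pos) k)
  set s : ℝ := √((p : ℝ) ^ k) with hs
  have hg : ∀ u : (ZMod (p ^ k))ˣ, ‖∑ t, ψ (u * t ^ 2)‖ = s := by
    intro u
    have h := norm_gaussSum_sq hψ h2 u
    rw [ZMod.card] at h
    rw [hs, eq_comm, Real.sqrt_eq_iff_eq_sq (by positivity) (norm_nonneg _), h, Nat.cast_pow]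
  let w : (ZMod (p ^ k))ˣ → ℂ := fun u => (∑ t, ψ (u * t ^ 2)) ^ d / (s : ℂ) ^ d
  have hw : ∀ u v, w (u * v ^ 2) = w u := by
    intro u v
    change (_ : ℂ) ^ d / _ = _ ^ d / _
    congr 2
    refine Fintype.sum_equiv (Units.mulLeft v) _ _ fun t => ?_
    rw [Units.mulLeft_apply, Units.val_mul, Units.val_pow_eq_pow_val, mul_pow, mul_assoc]
  have hw1 : ∀ u, ‖w u‖ ≤ 1 := by
    intro u
    change ‖(_ : ℂ) ^ d / _‖ ≤ 1
    rw [norm_div, norm_pow, norm_pow, hg, Complex.norm_real, Real.norm_of_nonneg hs0.le,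
      div_self (pow_ne_zero _ hs0.ne')]
  have h := norm_twistedSum_prime_pow_le hp2 hk hψ hw hw1 N c
  have hsw : ∀ u, (∑ t, ψ ((u : (ZMod (p ^ k))ˣ) * t ^ 2)) ^ d = (s : ℂ) ^ d * w u := by
    intro u
    exact (mul_div_cancel₀ _ (pow_ne_zero _ (Complex.ofReal_ne_zero.2 hs0.ne'))).symm
  rw [hc, Finset.sum_congr rfl fun u _ => by rw [hsw, mul_assoc], ← Finset.mul_sum, norm_mul,
    norm_pow, Complex.norm_real, Real.norm_of_nonneg hs0.le]
  calc _ ≤ s ^ d * (4 * s * √(Nat.gcd N (p ^ k))) := by gcongr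
    _ = _ := by ring

lemma norm_sphereSum_le (d : ℕ) (q : ℕ) (hq : Odd q) (N : ℕ) [inst : NeZero q]
    {ψ : AddChar (ZMod q) ℂ} (hψ : ψ.IsPrimitive) (n : Fin d → ZMod q) :
    ‖sphereSum ψ (N : ZMod q) n‖ ≤
      4 ^ q.primeFactors.card * √(q : ℝ) ^ d * √(q : ℝ) * √(Nat.gcd N q) := by
  revert inst
  induction q using Nat.recOnPosPrimePosCoprime with
  | prime_pow p k hp hk =>
    intro inst
    have : Fact p.Prime := ⟨hp⟩
    have hp2 : p ≠ 2 := by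
      rintro rfl
      exact absurd hq (Nat.not_odd_iff_even.2 ((even_two).pow_of_ne_zero hk.ne'))
    rw [Nat.primeFactors_prime_pow hk.ne' hp, card_singleton, pow_one, Nat.cast_pow]
    convert norm_sphereSum_prime_pow_le hp2 hk.ne' hψ N n
  | zero => exact absurd hq (by decide)
  | one =>
    intro inst
    simp only [sphereSum]
    refine (norm_sum_le _ _).trans ?_
    simp only [norm_mul, norm_prod, AddChar.norm_apply, one_mul]
    have h1 : ∀ i, ∀ u : (ZMod 1)ˣ, ‖∑ b : ZMod 1, ψ (u * b ^ 2 + b * n i)‖ ≤ 1 := by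
      intro i u
      refine (norm_sum_le_of_le _ (fun b _ => (AddChar.norm_apply ψ _).le)).trans ?_
      simp
    calc _ ≤ ∑ u : (ZMod 1)ˣ, ∏ i : Fin d, (1 : ℝ) := by
          gcongr with u _ i _
          exact h1 i u
      _ ≤ _ := by
        rw [Finset.prod_const_one, Finset.sum_const, Finset.card_univ]
        simp
  | coprime a b ha hb hab iha ihb =>
    intro inst
    have ha0 : NeZero a := ⟨by omega⟩
    have hb0 : NeZero b := ⟨by omega⟩
    rw [Nat.odd_mul] at hq
    obtain ⟨ψ₁, ψ₂, h1, h2, h⟩ := exists_sphereSum_eq_mul (ZMod.chineseRemainder hab) hψ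
    rw [h, map_natCast, Prod.fst_natCast, Prod.snd_natCast, norm_mul, hab.gcd_mul, Nat.cast_mul,
      Nat.cast_mul, Real.sqrt_mul (Nat.cast_nonneg _), Real.sqrt_mul (Nat.cast_nonneg _),
      hab.primeFactors_mul, card_union_of_disjoint hab.disjoint_primeFactors]
    calc _ ≤ _ := mul_le_mul (iha hq.1 h1 fun i => (ZMod.chineseRemainder hab (n i)).1)
            (ihb hq.2 h2 fun i => (ZMod.chineseRemainder hab (n i)).2) (norm_nonneg _)
            (by positivity)
      _ = _ := by ring

lemma exists_pow_card_primeFactors_le {ε : ℝ} (hε : 0 < ε) :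
    ∃ C : ℝ, 1 ≤ C ∧ ∀ q : ℕ, q ≠ 0 → (4 : ℝ) ^ q.primeFactors.card ≤ C * (q : ℝ) ^ ε := by
  obtain ⟨P, hP⟩ : ∃ P : ℕ, ∀ p : ℕ, P ≤ p → (4 : ℝ) ≤ (p : ℝ) ^ ε := by
    have h := ((tendsto_rpow_atTop hε).comp tendsto_natCast_atTop_atTop).eventually_ge_atTop 4
    exact Filter.eventually_atTop.1 h
  refine ⟨4 ^ P, one_le_pow₀ (by norm_num), fun q hq => ?_⟩
  have h1 : ∀ p ∈ q.primeFactors, (4 : ℝ) ≤ (if p ∈ range P then 4 else 1) * (p : ℝ) ^ ε := by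
    intro p hp
    have hp1 : (1 : ℝ) ≤ (p : ℝ) ^ ε :=
      Real.one_le_rpow (Nat.one_le_cast.2 (Nat.prime_of_mem_primeFactors hp).one_le) hε.le
    split_ifs with h
    · linarith
    · rw [one_mul]
      exact hP p (by simpa using h)
  calc (4 : ℝ) ^ q.primeFactors.card = ∏ p ∈ q.primeFactors, (4 : ℝ) := by rw [prod_const]
    _ ≤ ∏ p ∈ q.primeFactors, (if p ∈ range P then 4 else 1) * (p : ℝ) ^ ε :=
      prod_le_prod (fun _ _ => by norm_num) h1
    _ ≤ 4 ^ P * (q : ℝ) ^ ε := by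
      rw [prod_mul_distrib]
      refine mul_le_mul ?_ ?_ (by positivity) (by positivity)
      · rw [← prod_filter, prod_const]
        refine pow_le_pow_right₀ (by norm_num) ?_
        refine (card_le_card ?_).trans (card_range P).le
        intro x hx
        exact (mem_filter.1 hx).2
      · rw [Real.finsetProd_rpow _ _ fun p _ => Nat.cast_nonneg p]
        refine Real.rpow_le_rpow (by positivity) ?_ hε.le
        rw [← Nat.cast_prod]
        exact Nat.cast_le.2 (Nat.le_of_dvd (Nat.pos_of_ne_zero hq) (Nat.prod_primeFactors_dvd q))

end OddModulus

section Kloosterman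

open Finset

lemma eC_div_eq_stdAddChar {q : ℕ} [NeZero q] (j : ℤ) :
    eC ((j : ℝ) / q) = ZMod.stdAddChar (j : ZMod q) := by
  rw [ZMod.stdAddChar_coe, eC]
  congr 1
  push_cast
  ring

/-- The residue classes modulo `q` represented by `0, …, q - 1`. -/
def finEquivZMod (q : ℕ) [NeZero q] : Fin q ≃ ZMod q :=
  Equiv.ofBijective (fun u => ((u : ℕ) : ZMod q)) <| by
    rw [Fintype.bijective_iff_injective_and_card]
    refine ⟨fun u v h => ?_, by rw [Fintype.card_fin, ZMod.card]⟩
    change ((u : ℕ) : ZMod q) = ((v : ℕ) : ZMod q) at h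
    rw [ZMod.natCast_eq_natCast_iff] at h
    exact Fin.ext (Nat.ModEq.eq_of_lt_of_lt h u.2 v.2)

lemma finEquivZMod_apply (q : ℕ) [NeZero q] (u : Fin q) :
    finEquivZMod q u = ((u : ℕ) : ZMod q) := rfl

lemma sum_coprime_eq_sum_units {q : ℕ} [NeZero q] (F : ZMod q → ℂ) :
    ∑ u : Fin q, (if Nat.Coprime (u : ℕ) q then F ((u : ℕ) : ZMod q) else 0) =
      ∑ u : (ZMod q)ˣ, F u := by
  classical
  rw [← Finset.sum_filter]
  refine (Finset.sum_nbij (fun u : (ZMod q)ˣ => (finEquivZMod q).symm u) ?_ ?_ ?_ ?_).symm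
  · intro u _
    rw [mem_filter]
    refine ⟨mem_univ _, ?_⟩
    rw [← ZMod.isUnit_iff_coprime, ← finEquivZMod_apply, Equiv.apply_symm_apply]
    exact u.isUnit
  · intro u _ v _ h
    exact Units.ext ((finEquivZMod q).symm.injective h)
  · intro u hu
    rw [mem_coe, mem_filter, ← ZMod.isUnit_iff_coprime] at hu
    obtain ⟨v, hv⟩ := hu.2
    exact ⟨v, mem_coe.2 (mem_univ _), by
      change (finEquivZMod q).symm v = u
      rw [hv, ← finEquivZMod_apply, Equiv.symm_apply_apply]⟩
  · intro u _
    rw [← finEquivZMod_apply, Equiv.apply_symm_apply]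

lemma kloosterman_eq_sphereSum {d q : ℕ} [NeZero q] (N : ℤ) (n : Fin d → ℤ) :
    kloosterman d q N n = ((q : ℂ)⁻¹) ^ d *
      sphereSum (ZMod.stdAddChar (N := q)) (N : ZMod q) (fun i => (n i : ZMod q)) := by
  unfold kloosterman sphereSum
  congr 1
  rw [← sum_coprime_eq_sum_units (fun u : ZMod q => ZMod.stdAddChar (-((u : ZMod q) * (N : ZMod q))) *
    ∏ i, ∑ b : ZMod q, ZMod.stdAddChar (u * b ^ 2 + b * (n i : ZMod q)))]
  refine Finset.sum_congr rfl fun u _ => ?_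
  split_ifs
  · congr 1
    · rw [show -(((u : ℕ) : ℝ) * (N : ℝ)) / q = ((-((u : ℕ) * N) : ℤ) : ℝ) / q by push_cast; rfl,
        eC_div_eq_stdAddChar]
      push_cast
      rfl
    · have h1 : ∀ i, ∑ b : ZMod q, ZMod.stdAddChar (((u : ℕ) : ZMod q) * b ^ 2 + b * (n i : ZMod q))
          = ∑ b : Fin q, ZMod.stdAddChar
            (((u : ℕ) : ZMod q) * ((b : ℕ) : ZMod q) ^ 2 + ((b : ℕ) : ZMod q) * (n i : ZMod q)) :=
        fun i => (Fintype.sum_equiv (finEquivZMod q) _ _ fun b => rfl).symm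
      rw [Finset.prod_congr rfl fun i _ => h1 i, Finset.prod_univ_sum, Fintype.piFinset_univ]
      refine Finset.sum_congr rfl fun b _ => ?_
      rw [← addChar_map_sum, show (((u : ℕ) : ℝ) * ∑ i, (((b i : ℕ) : ℝ)) ^ 2
          + ∑ i, ((b i : ℕ) : ℝ) * ((n i : ℝ))) / q =
          ((((u : ℕ) * ∑ i, ((b i : ℕ) : ℤ) ^ 2 + ∑ i, ((b i : ℕ) : ℤ) * n i : ℤ)) : ℝ) / q by
        push_cast; rfl, eC_div_eq_stdAddChar]
      push_cast
      rw [Finset.mul_sum, ← Finset.sum_add_distrib]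
  · rfl

lemma kloosterman_add_mul {d q : ℕ} [NeZero q] (N : ℤ) (n m : Fin d → ℤ) :
    kloosterman d q N (fun i => n i + q * m i) = kloosterman d q N n := by
  rw [kloosterman_eq_sphereSum, kloosterman_eq_sphereSum]
  congr 2
  ext i
  simp

lemma exists_norm_kloosterman_le (d : ℕ) {ε : ℝ} (hε : 0 < ε) :
    ∃ C : ℝ, 1 ≤ C ∧ ∀ q : ℕ, Odd q → ∀ (N : ℕ) (n : Fin d → ℤ),
      ‖kloosterman d q N n‖ ≤
        C * (q : ℝ) ^ (-(((d : ℝ) - 1) / 2) + ε) * (Nat.gcd q N : ℝ) ^ (1 / 2 : ℝ) := by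
  obtain ⟨C, hC1, hC⟩ := exists_pow_card_primeFactors_le hε
  refine ⟨C, hC1, fun q hq N n => ?_⟩
  have hq0 : q ≠ 0 := by
    rintro rfl
    exact absurd hq (by decide)
  have : NeZero q := ⟨hq0⟩
  have hqpos : (0 : ℝ) < q := Nat.cast_pos.2 (Nat.pos_of_ne_zero hq0)
  have h1 := norm_sphereSum_le d q hq N (ZMod.isPrimitive_stdAddChar q)
    (fun i => (n i : ZMod q))
  rw [kloosterman_eq_sphereSum, norm_mul, norm_pow, norm_inv, Complex.norm_natCast, Int.cast_natCast]
  calc _ ≤ ((q : ℝ)⁻¹) ^ d * (C * (q : ℝ) ^ ε * √(q : ℝ) ^ d * √(q : ℝ) * √(Nat.gcd N q)) := by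
        gcongr
        refine h1.trans ?_
        gcongr
        exact hC q hq0
    _ = _ := by
        rw [Nat.gcd_comm, Real.sqrt_eq_rpow (Nat.gcd q N : ℝ)]
        rw [show ((q : ℝ)⁻¹) ^ d * (C * (q : ℝ) ^ ε * √(q : ℝ) ^ d * √(q : ℝ) *
          (Nat.gcd q N : ℝ) ^ (1 / 2 : ℝ)) = C * (((q : ℝ)⁻¹) ^ d * (q : ℝ) ^ ε * √(q : ℝ) ^ d *
            √(q : ℝ)) * (Nat.gcd q N : ℝ) ^ (1 / 2 : ℝ) by ring]
        congr 2
        rw [Real.sqrt_eq_rpow, ← Real.rpow_natCast, ← Real.rpow_natCast, ← Real.rpow_mul hqpos.le,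
          ← Real.rpow_neg_one, ← Real.rpow_mul hqpos.le, ← Real.rpow_add hqpos,
          ← Real.rpow_add hqpos, ← Real.rpow_add hqpos]
        congr 1
        ring

lemma norm_sum_kloosterman_mul_le {d q : ℕ} [NeZero q] (N : ℤ) (x : Fin d → ℤ) :
    ‖∑ a : Fin d → Fin q, kloosterman d q N (fun i => ((a i : ℕ) : ℤ)) *
      eC (-∑ i, (x i : ℝ) * (((a i : ℕ) : ℝ) / q))‖ ≤ q.totient := by
  classical
  have hq : (q : ℂ) ≠ 0 := Nat.cast_ne_zero.2 (NeZero.ne q)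
  have h1 : ∀ a : Fin d → Fin q, kloosterman d q N (fun i => ((a i : ℕ) : ℤ)) *
      eC (-∑ i, (x i : ℝ) * (((a i : ℕ) : ℝ) / q)) =
      ((q : ℂ)⁻¹) ^ d * ∑ u : (ZMod q)ˣ, ZMod.stdAddChar (-((u : ZMod q) * (N : ZMod q))) *
        ∏ i, ∑ b : ZMod q, ZMod.stdAddChar ((u : ZMod q) * b ^ 2) *
          ZMod.stdAddChar (finEquivZMod q (a i) * (b - (x i : ZMod q))) := by
    intro a
    rw [kloosterman_eq_sphereSum, sphereSum, mul_assoc, Finset.sum_mul]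
    congr 1
    refine Finset.sum_congr rfl fun u _ => ?_
    rw [mul_assoc]
    congr 1
    have h2 : eC (-∑ i, (x i : ℝ) * (((a i : ℕ) : ℝ) / q)) =
        ∏ i, ZMod.stdAddChar (-(finEquivZMod q (a i) * (x i : ZMod q))) := by
      rw [← addChar_map_sum, show -∑ i, (x i : ℝ) * (((a i : ℕ) : ℝ) / q) =
          ((∑ i, -(((a i : ℕ) : ℤ) * x i) : ℤ) : ℝ) / q by
        push_cast
        rw [Finset.sum_neg_distrib, neg_div, Finset.sum_div]
        congr 1
        refine Finset.sum_congr rfl fun i _ => ?_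
        ring, eC_div_eq_stdAddChar]
      push_cast
      rfl
    rw [h2, ← Finset.prod_mul_distrib]
    refine Finset.prod_congr rfl fun i _ => ?_
    rw [Finset.sum_mul]
    refine Finset.sum_congr rfl fun b _ => ?_
    rw [← AddChar.map_add_eq_mul, ← AddChar.map_add_eq_mul, finEquivZMod_apply]
    congr 1
    push_cast
    ring
  have h3 : ∀ (u : (ZMod q)ˣ) (i : Fin d), ∑ a : Fin q, ∑ b : ZMod q,
      ZMod.stdAddChar ((u : ZMod q) * b ^ 2) *
      ZMod.stdAddChar (finEquivZMod q a * (b - (x i : ZMod q))) =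
      q * ZMod.stdAddChar ((u : ZMod q) * (x i : ZMod q) ^ 2) := by
    intro u i
    rw [Finset.sum_comm]
    have h4 : ∀ b : ZMod q, ∑ a : Fin q, ZMod.stdAddChar ((u : ZMod q) * b ^ 2) *
        ZMod.stdAddChar (finEquivZMod q a * (b - (x i : ZMod q))) =
        if b = (x i : ZMod q) then ZMod.stdAddChar ((u : ZMod q) * b ^ 2) * q else 0 := by
      intro b
      rw [← Finset.mul_sum, Fintype.sum_equiv (finEquivZMod q) _
        (fun a => ZMod.stdAddChar (a * (b - (x i : ZMod q)))) fun a => rfl,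
        AddChar.sum_mulShift _ (ZMod.isPrimitive_stdAddChar q), ZMod.card]
      simp only [sub_eq_zero]
      split_ifs <;> simp
    rw [Finset.sum_congr rfl fun b _ => h4 b, Finset.sum_ite_eq' univ, if_pos (mem_univ _), mul_comm]
  have h5 : ∑ a : Fin d → Fin q, kloosterman d q N (fun i => ((a i : ℕ) : ℤ)) *
      eC (-∑ i, (x i : ℝ) * (((a i : ℕ) : ℝ) / q)) =
      ∑ u : (ZMod q)ˣ, ZMod.stdAddChar (-((u : ZMod q) * (N : ZMod q))) *
        ∏ i, ZMod.stdAddChar ((u : ZMod q) * (x i : ZMod q) ^ 2) := by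
    rw [Finset.sum_congr rfl fun a _ => h1 a, ← Finset.mul_sum, Finset.sum_comm, Finset.mul_sum]
    refine Finset.sum_congr rfl fun u _ => ?_
    rw [← Finset.mul_sum, ← Fintype.piFinset_univ, ← Finset.prod_univ_sum (fun _ => univ)
      (fun i (a : Fin q) => ∑ b : ZMod q, ZMod.stdAddChar ((u : ZMod q) * b ^ 2) *
          ZMod.stdAddChar (finEquivZMod q a * (b - (x i : ZMod q)))),
      Finset.prod_congr rfl fun i _ => h3 u i, Finset.prod_mul_distrib, Finset.prod_const,
      Finset.card_univ, Fintype.card_fin, mul_left_comm, ← mul_assoc (((q : ℂ)⁻¹) ^ d), ← mul_pow,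
      inv_mul_cancel₀ hq, one_pow, one_mul]
  rw [h5]
  refine (norm_sum_le_of_le (n := fun _ => (1 : ℝ)) _ fun u _ => ?_).trans ?_
  · simp [norm_prod, AddChar.norm_apply]
  · rw [Finset.sum_const, Finset.card_univ, ZMod.card_units_eq_totient, nsmul_eq_mul, mul_one]

end Kloosterman

/-- The phase of `a` times `‖a‖ ^ w`, entire in `w`. -/
def phasePow (a w : ℂ) : ℂ := (a / ‖a‖) * Complex.exp (w * Real.log ‖a‖)

lemma phasePow_one (a : ℂ) : phasePow a 1 = a := by
  unfold phasePow
  by_cases h : a = 0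
  · simp [h]
  · have h' : ‖a‖ ≠ 0 := norm_ne_zero_iff.2 h
    have h'' : (‖a‖ : ℂ) ≠ 0 := by exact_mod_cast h'
    rw [one_mul, ← Complex.ofReal_exp, Real.exp_log (by positivity), div_mul_cancel₀ _ h'']

lemma norm_phasePow {a : ℂ} (ha : a ≠ 0) (w : ℂ) : ‖phasePow a w‖ = ‖a‖ ^ w.re := by
  have h' : 0 < ‖a‖ := norm_pos_iff.2 ha
  unfold phasePow
  rw [norm_mul, norm_div, Complex.norm_real, norm_norm, div_self h'.ne', one_mul,
    Complex.norm_exp, Complex.re_mul_ofReal, Real.rpow_def_of_pos h', mul_comm]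

lemma phasePow_zero_left (w : ℂ) : phasePow 0 w = 0 := by simp [phasePow]

lemma norm_phasePow_le (a w : ℂ) : ‖phasePow a w‖ ≤ ‖a‖ ^ w.re := by
  by_cases h : a = 0
  · simp [h, phasePow_zero_left, Real.rpow_nonneg]
  · exact (norm_phasePow h w).le

lemma differentiable_phasePow (a : ℂ) : Differentiable ℂ (phasePow a) := by
  unfold phasePow
  fun_prop

lemma norm_phasePow_le_exp (a : ℂ) {w : ℂ} {M : ℝ} (h0 : 0 ≤ w.re) (h1 : w.re ≤ M) :
    ‖phasePow a w‖ ≤ Real.exp (M * |Real.log ‖a‖|) := by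
  by_cases h : a = 0
  · simp only [h, phasePow_zero_left, norm_zero]; positivity
  · rw [norm_phasePow h, Real.rpow_def_of_pos (norm_pos_iff.2 h), mul_comm]
    exact Real.exp_le_exp.2 ((mul_le_mul_of_nonneg_left (le_abs_self _) h0).trans
      (mul_le_mul_of_nonneg_right h1 (abs_nonneg _)))

/-- Riesz–Thorin interpolation between `ℓ¹ → ℓ¹` and `ℓ² → ℓ²`, in bilinear form. -/
lemma norm_bilin_le_of_interp {α β : Type*} (S : Finset α) (Y : Finset β) (k : α → β → ℂ)
    {A₁ A₂ : ℝ}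
    (H1 : ∀ (f : β → ℂ) (h : α → ℂ), (∀ x, ‖h x‖ ≤ 1) → ∑ y ∈ Y, ‖f y‖ ≤ 1 →
      ‖∑ x ∈ S, ∑ y ∈ Y, k x y * f y * h x‖ ≤ A₁)
    (H2 : ∀ (f : β → ℂ) (h : α → ℂ), ∑ y ∈ Y, ‖f y‖ ^ 2 ≤ 1 → ∑ x ∈ S, ‖h x‖ ^ 2 ≤ 1 →
      ‖∑ x ∈ S, ∑ y ∈ Y, k x y * f y * h x‖ ≤ A₂)
    {p p' : ℝ} (hpp : p.HolderConjugate p') (hp2 : p ≤ 2) (f : β → ℂ) (h : α → ℂ)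
    (hf : ∑ y ∈ Y, ‖f y‖ ^ p ≤ 1) (hh : ∑ x ∈ S, ‖h x‖ ^ p' ≤ 1) :
    ‖∑ x ∈ S, ∑ y ∈ Y, k x y * f y * h x‖ ≤ A₁ ^ (2 / p - 1) * A₂ ^ (2 * (1 - 1 / p)) := by
  have hp0 : 0 < p := hpp.pos
  have hp'0 : 0 < p' := hpp.symm.pos
  have hp1 : 1 < p := hpp.lt
  set θ : ℝ := 2 * (1 - 1 / p) with hθ
  have hinv : 1 / p' = 1 - 1 / p := by
    have := hpp.inv_add_inv_eq_one
    simp only [one_div]; linarith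
  have hθ0 : 0 ≤ θ := by
    have : 1 / p ≤ 1 := by rw [div_le_one hp0]; exact hp1.le
    rw [hθ]; linarith
  have hθ1 : θ ≤ 1 := by
    have : 1 / 2 ≤ 1 / p := one_div_le_one_div_of_le hp0 hp2
    rw [hθ]; linarith
  set Φ : ℂ → ℂ := fun z => ∑ x ∈ S, ∑ y ∈ Y,
    k x y * phasePow (f y) (p * (1 - z / 2)) * phasePow (h x) (p' * (z / 2)) with hΦ
  have hre1 : ∀ z : ℂ, ((p : ℂ) * (1 - z / 2)).re = p * (1 - z.re / 2) := by
    intro z; simp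
  have hre2 : ∀ z : ℂ, ((p' : ℂ) * (z / 2)).re = p' * (z.re / 2) := by
    intro z; simp
  have hdiff : Differentiable ℂ Φ := by
    intro z
    refine DifferentiableAt.fun_sum fun x _ => DifferentiableAt.fun_sum fun y _ => ?_
    refine DifferentiableAt.mul (DifferentiableAt.mul (differentiableAt_const _) ?_) ?_
    · exact ((differentiable_phasePow (f y)) _).comp z (by fun_prop)
    · exact ((differentiable_phasePow (h x)) _).comp z (by fun_prop)
  have hθz : (θ : ℂ) ∈ Complex.HadamardThreeLines.verticalClosedStrip 0 1 := by
    simp [Complex.HadamardThreeLines.verticalClosedStrip, hθ0, hθ1]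
  have key := Complex.HadamardThreeLines.norm_le_interp_of_mem_verticalClosedStrip'
    (f := Φ) (l := 0) (u := 1) (z := (θ : ℂ)) (a := A₁) (b := A₂) one_pos hθz
    hdiff.diffContOnCl ?_ ?_ ?_
  · have e1 : (p : ℂ) * (1 - (θ : ℂ) / 2) = 1 := by
      have : p * (1 - θ / 2) = 1 := by rw [hθ]; field_simp; ring
      exact_mod_cast this
    have e2 : (p' : ℂ) * ((θ : ℂ) / 2) = 1 := by
      have : p' * (θ / 2) = 1 := by
        rw [hθ, ← hinv]; field_simp
      exact_mod_cast this
    have e3 : 1 - θ = 2 / p - 1 := by rw [hθ]; ring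
    simpa [hΦ, e1, e2, phasePow_one, e3] using key
  · refine ⟨∑ x ∈ S, ∑ y ∈ Y, ‖k x y‖ * Real.exp (p * |Real.log ‖f y‖|) *
      Real.exp (p' * |Real.log ‖h x‖|), ?_⟩
    rintro _ ⟨z, hz, rfl⟩
    have hz0 : 0 ≤ z.re := hz.1
    have hz1 : z.re ≤ 1 := hz.2
    refine (norm_sum_le _ _).trans (Finset.sum_le_sum fun x _ => (norm_sum_le _ _).trans
      (Finset.sum_le_sum fun y _ => ?_))
    rw [norm_mul, norm_mul]
    gcongr
    · apply norm_phasePow_le_exp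
      · rw [hre1]; apply mul_nonneg hp0.le; linarith
      · rw [hre1]; nlinarith
    · apply norm_phasePow_le_exp
      · rw [hre2]; positivity
      · rw [hre2]; nlinarith
  · intro z hz
    have hz0 : z.re = 0 := hz
    refine H1 (fun y => phasePow (f y) (p * (1 - z / 2)))
      (fun x => phasePow (h x) (p' * (z / 2))) (fun x => ?_) (le_trans ?_ hf)
    · refine (norm_phasePow_le _ _).trans ?_
      rw [hre2, hz0]; simp
    · refine Finset.sum_le_sum fun y _ => (norm_phasePow_le _ _).trans ?_
      rw [hre1, hz0]; simp
  · intro z hz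
    have hz0 : z.re = 1 := hz
    have aux : ∀ (a : ℂ) (w : ℂ) (s : ℝ), w.re * 2 = s → ‖phasePow a w‖ ^ 2 ≤ ‖a‖ ^ s := by
      intro a w s hs
      calc ‖phasePow a w‖ ^ 2 ≤ (‖a‖ ^ w.re) ^ 2 := by gcongr; exact norm_phasePow_le _ _
        _ = ‖a‖ ^ s := by rw [← hs, ← Real.rpow_natCast, ← Real.rpow_mul (norm_nonneg _)]; norm_num
    refine H2 (fun y => phasePow (f y) (p * (1 - z / 2)))
      (fun x => phasePow (h x) (p' * (z / 2))) (le_trans ?_ hf) (le_trans ?_ hh)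
    · refine Finset.sum_le_sum fun y _ => aux _ _ _ ?_
      rw [hre1, hz0]; ring
    · refine Finset.sum_le_sum fun y _ => aux _ _ _ ?_
      rw [hre2, hz0]; ring

/-- Riesz–Thorin interpolation between `ℓ¹ → ℓ¹` and `ℓ² → ℓ²` for a finite matrix. -/
lemma sum_norm_rpow_le_of_interp {α β : Type*} (S : Finset α) (Y : Finset β) (k : α → β → ℂ)
    {A₁ A₂ : ℝ}
    (H1 : ∀ (f : β → ℂ) (h : α → ℂ), (∀ x, ‖h x‖ ≤ 1) → ∑ y ∈ Y, ‖f y‖ ≤ 1 →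
      ‖∑ x ∈ S, ∑ y ∈ Y, k x y * f y * h x‖ ≤ A₁)
    (H2 : ∀ (f : β → ℂ) (h : α → ℂ), ∑ y ∈ Y, ‖f y‖ ^ 2 ≤ 1 → ∑ x ∈ S, ‖h x‖ ^ 2 ≤ 1 →
      ‖∑ x ∈ S, ∑ y ∈ Y, k x y * f y * h x‖ ≤ A₂)
    {p : ℝ} (hp1 : 1 < p) (hp2 : p ≤ 2) (f : β → ℂ)
    (hf : ∑ y ∈ Y, ‖f y‖ ^ p ≤ 1) :
    (∑ x ∈ S, ‖∑ y ∈ Y, k x y * f y‖ ^ p) ^ (1 / p)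
      ≤ A₁ ^ (2 / p - 1) * A₂ ^ (2 * (1 - 1 / p)) := by
  have hpp : p.HolderConjugate p.conjExponent := Real.HolderConjugate.conjExponent hp1
  set p' := p.conjExponent
  have hp0 : 0 < p := hpp.pos
  have hp'0 : 0 < p' := hpp.symm.pos
  set T : α → ℂ := fun x => ∑ y ∈ Y, k x y * f y with hT
  set N := ∑ x ∈ S, ‖T x‖ ^ p with hN
  have hA1 : 0 ≤ A₁ := (norm_nonneg _).trans (H1 0 0 (by simp) (by simp))
  have hA2 : 0 ≤ A₂ := (norm_nonneg _).trans (H2 0 0 (by simp) (by simp))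
  have hN0 : 0 ≤ N := Finset.sum_nonneg fun x _ => by positivity
  rcases hN0.eq_or_lt with h0 | hpos
  · rw [← h0, Real.zero_rpow (by positivity)]; positivity
  set h : α → ℂ := fun x => ((starRingEnd ℂ) (T x) * ((‖T x‖ ^ (p - 2) / N ^ (1 / p') : ℝ) : ℂ))
    with hh
  have hnorm : ∀ x, ‖h x‖ = ‖T x‖ ^ (p - 1) / N ^ (1 / p') := by
    intro x
    rw [hh]
    simp only [norm_mul, RCLike.norm_conj, Complex.norm_real]
    rw [Real.norm_of_nonneg (by positivity), mul_div_assoc']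
    congr 1
    by_cases hx : ‖T x‖ = 0
    · rw [hx, zero_mul, Real.zero_rpow (by linarith)]
    · rw [show p - 1 = 1 + (p - 2) by ring, Real.rpow_add (by positivity), Real.rpow_one]
  have hTh : ∀ x, T x * h x = ((‖T x‖ ^ p / N ^ (1 / p') : ℝ) : ℂ) := by
    intro x
    rw [hh]
    simp only
    rw [← mul_assoc, Complex.mul_conj, Complex.normSq_eq_norm_sq, ← Complex.ofReal_mul,
      mul_div_assoc']
    congr 2
    by_cases hx : ‖T x‖ = 0
    · rw [hx, Real.zero_rpow hp0.ne']; simp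
    · rw [← Real.rpow_natCast, ← Real.rpow_add (by positivity)]; congr 1; push_cast; ring
  have hNp : N ^ (1 / p') * N ^ (1 / p) = N := by
    rw [← Real.rpow_add hpos]
    have := hpp.symm.inv_add_inv_eq_one
    rw [one_div, one_div, this, Real.rpow_one]
  have main := norm_bilin_le_of_interp S Y k H1 H2 hpp hp2 f h hf ?_
  · refine le_trans (le_of_eq ?_) main
    have : ∑ x ∈ S, ∑ y ∈ Y, k x y * f y * h x = ((N / N ^ (1 / p') : ℝ) : ℂ) := by
      rw [hN, Finset.sum_div, Complex.ofReal_sum]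
      refine Finset.sum_congr rfl fun x _ => ?_
      rw [← hN, ← hTh, hT, Finset.sum_mul]
    rw [this, Complex.norm_real, Real.norm_of_nonneg (by positivity), eq_div_iff (by positivity),
      mul_comm, hNp]
  · have : ∀ x, ‖h x‖ ^ p' = ‖T x‖ ^ p / N := by
      intro x
      rw [hnorm, Real.div_rpow (by positivity) (by positivity), ← Real.rpow_mul (by positivity),
        ← Real.rpow_mul hN0]
      congr 1
      · congr 1
        have := hpp.symm.mul_eq_add
        linarith
      · rw [one_div, inv_mul_cancel₀ hp'0.ne', Real.rpow_one]
    simp only [this]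
    rw [← Finset.sum_div, ← hN, div_self hpos.ne']

section Multiplier

open Finset

lemma eC_zero : eC 0 = 1 := by simp [eC]

lemma eC_add (s t : ℝ) : eC (s + t) = eC s * eC t := by
  simp only [eC, ← Complex.exp_add]
  congr 1
  push_cast
  ring

lemma norm_eC (t : ℝ) : ‖eC t‖ = 1 := by
  have : 2 * (Real.pi : ℂ) * Complex.I * t = ((2 * Real.pi * t : ℝ) : ℂ) * Complex.I := by
    push_cast; ring
  rw [eC, this, Complex.norm_exp_ofReal_mul_I]

lemma eC_sum {ι : Type*} (s : Finset ι) (f : ι → ℝ) : eC (∑ i ∈ s, f i) = ∏ i ∈ s, eC (f i) := by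
  simp only [eC, ← Complex.exp_sum, Complex.ofReal_sum, Finset.mul_sum]

lemma eC_int (n : ℤ) : eC n = 1 := by
  rw [eC, Complex.exp_eq_one_iff]
  exact ⟨n, by push_cast; ring⟩

lemma conj_eC (t : ℝ) : (starRingEnd ℂ) (eC t) = eC (-t) := by
  rw [eC, eC, ← Complex.exp_conj]
  congr 1
  simp only [map_mul, Complex.conj_I, Complex.conj_ofReal, map_ofNat]
  push_cast
  ring

lemma continuous_eC : Continuous eC := by
  unfold eC
  fun_prop

lemma integral_Icc_eC_int_mul (n : ℤ) :
    ∫ x in Set.Icc (0 : ℝ) 1, eC ((n : ℝ) * x) = if n = 0 then 1 else 0 := by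
  split_ifs with h
  · simp [h, eC_zero]
  · rw [integral_Icc_eq_integral_Ioc, ← intervalIntegral.integral_of_le zero_le_one]
    have hc : (2 * Real.pi * Complex.I * n : ℂ) ≠ 0 := by
      have := Real.pi_ne_zero
      simp [h, this]
    have := integral_exp_mul_complex (a := 0) (b := 1) hc
    simp only [eC]
    calc ∫ x in (0:ℝ)..1, Complex.exp (2 * Real.pi * Complex.I * ((n : ℝ) * x : ℝ))
        = ∫ x in (0:ℝ)..1, Complex.exp (2 * Real.pi * Complex.I * n * x) := by
          congr 1; ext x; congr 1; push_cast; ring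
      _ = 0 := by
        rw [this]
        have h1 := eC_int n
        rw [eC] at h1
        push_cast at h1 ⊢
        simp [h1]

lemma volume_restrict_Icc_pi (d : ℕ) :
    (volume : Measure (Fin d → ℝ)).restrict (Set.Icc 0 1)
      = Measure.pi fun _ => (volume : Measure ℝ).restrict (Set.Icc 0 1) := by
  rw [volume_pi, ← Set.pi_univ_Icc, ← Measure.restrict_pi_pi]
  rfl

instance isProbabilityMeasure_restrict_Icc_pi (d : ℕ) :
    IsProbabilityMeasure ((volume : Measure (Fin d → ℝ)).restrict (Set.Icc 0 1)) := by
  constructor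
  simp [Real.volume_Icc_pi]

lemma integral_Icc_eC_sum (d : ℕ) (n : Fin d → ℤ) :
    ∫ ξ in Set.Icc (0 : Fin d → ℝ) 1, eC (∑ i, (n i : ℝ) * ξ i) = if n = 0 then 1 else 0 := by
  simp only [eC_sum]
  rw [volume_restrict_Icc_pi,
    integral_fintype_prod_eq_prod (f := fun (i : Fin d) (x : ℝ) => eC ((n i : ℝ) * x))]
  simp only [integral_Icc_eC_int_mul, Finset.prod_ite_zero, Finset.prod_const_one]
  simp [funext_iff]

lemma continuous_eC_sum {d : ℕ} (a : Fin d → ℝ) :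
    Continuous fun ξ : Fin d → ℝ => eC (∑ i, a i * ξ i) :=
  continuous_eC.comp (by fun_prop)

lemma integrableOn_Icc_of_continuous {d : ℕ} {E : Type*} [NormedAddCommGroup E]
    {g : (Fin d → ℝ) → E} (hg : Continuous g) : IntegrableOn g (Set.Icc (0 : Fin d → ℝ) 1) :=
  hg.continuousOn.integrableOn_compact isCompact_Icc

/-- Parseval's identity for trigonometric polynomials on the unit cube. -/
lemma integral_Icc_norm_sq_sum {d : ℕ} {α : Type*} [DecidableEq α] (Y : Finset α)
    (φ : α → Fin d → ℤ) (hφ : Function.Injective φ) (f : α → ℂ) :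
    ∫ ξ in Set.Icc (0 : Fin d → ℝ) 1, ‖∑ y ∈ Y, f y * eC (∑ i, (φ y i : ℝ) * ξ i)‖ ^ 2
      = ∑ y ∈ Y, ‖f y‖ ^ 2 := by
  have hpt : ∀ ξ : Fin d → ℝ, ((‖∑ y ∈ Y, f y * eC (∑ i, (φ y i : ℝ) * ξ i)‖ ^ 2 : ℝ) : ℂ)
      = ∑ y ∈ Y, ∑ y' ∈ Y, f y * (starRingEnd ℂ) (f y') *
        eC (∑ i, (((φ y - φ y') i : ℤ) : ℝ) * ξ i) := by
    intro ξ
    rw [← Complex.normSq_eq_norm_sq, ← Complex.mul_conj, map_sum, Finset.sum_mul_sum]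
    refine Finset.sum_congr rfl fun y _ => Finset.sum_congr rfl fun y' _ => ?_
    rw [map_mul, conj_eC]
    have : ∑ i, (((φ y - φ y') i : ℤ) : ℝ) * ξ i
        = ∑ i, (φ y i : ℝ) * ξ i + -∑ i, (φ y' i : ℝ) * ξ i := by
      rw [← sub_eq_add_neg, ← Finset.sum_sub_distrib]
      refine Finset.sum_congr rfl fun i _ => ?_
      simp [sub_mul]
    rw [this, eC_add]
    ring
  have hInt : ∀ y y', IntegrableOn (fun ξ : Fin d → ℝ => f y * (starRingEnd ℂ) (f y') *
      eC (∑ i, (((φ y - φ y') i : ℤ) : ℝ) * ξ i)) (Set.Icc (0 : Fin d → ℝ) 1) := fun y y' =>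
    integrableOn_Icc_of_continuous (continuous_const.mul (continuous_eC_sum _))
  apply Complex.ofReal_injective
  rw [← integral_complex_ofReal]
  simp only [hpt]
  rw [integral_finsetSum _ fun y _ => integrable_finsetSum _ fun y' _ => hInt y y']
  simp_rw [integral_finsetSum _ fun y' _ => hInt _ y', integral_const_mul, integral_Icc_eC_sum]
  push_cast
  refine Finset.sum_congr rfl fun y hy => ?_
  have : ∀ y', (φ y - φ y' = 0) ↔ y = y' := fun y' => by rw [sub_eq_zero, hφ.eq_iff]
  simp only [this, mul_ite, mul_one, mul_zero, Finset.sum_ite_eq, hy, if_true]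
  rw [Complex.mul_conj, Complex.normSq_eq_norm_sq]
  push_cast
  rfl

/-- The convolution kernel of a multiplier operator. -/
def mulKernel (d : ℕ) (m : (Fin d → ℝ) → ℂ) (z : Fin d → ℤ) : ℂ :=
  ∫ ξ in Set.Icc (0 : Fin d → ℝ) 1, m ξ * eC (-∑ i, (z i : ℝ) * ξ i)

lemma integrableOn_mul_continuous {d : ℕ} {m g : (Fin d → ℝ) → ℂ}
    (hm : IntegrableOn m (Set.Icc 0 1)) (hg : Continuous g) :
    IntegrableOn (fun ξ => m ξ * g ξ) (Set.Icc 0 1) :=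
  hm.mul_continuousOn hg.continuousOn isCompact_Icc

lemma mulOp_eq_sum {d : ℕ} {m : (Fin d → ℝ) → ℂ} (hm : IntegrableOn m (Set.Icc 0 1))
    {f : (Fin d → ℤ) → ℂ} (hf : f.support.Finite) (x : Fin d → ℤ) :
    mulOp d m f x = ∑ y ∈ hf.toFinset, mulKernel d m (x - y) * f y := by
  have hft : ∀ ξ, ftZ f ξ = ∑ y ∈ hf.toFinset, f y * eC (∑ i, (y i : ℝ) * ξ i) := by
    intro ξ
    refine tsum_eq_sum fun y hy => ?_
    have : f y = 0 := by simpa using hy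
    rw [this, zero_mul]
  simp only [mulOp, hft, mulKernel]
  simp_rw [← integral_mul_const]
  rw [← integral_finsetSum]
  · congr 1
    ext ξ
    rw [mul_assoc, Finset.sum_mul, Finset.mul_sum]
    refine Finset.sum_congr rfl fun y _ => ?_
    have : -∑ i, (((x - y) i : ℤ) : ℝ) * ξ i
        = ∑ i, (y i : ℝ) * ξ i + -∑ i, (x i : ℝ) * ξ i := by
      rw [← sub_eq_add_neg, ← Finset.sum_sub_distrib, ← Finset.sum_neg_distrib]
      refine Finset.sum_congr rfl fun i _ => ?_
      simp [sub_mul]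
    rw [this, eC_add]
    ring
  · intro y _
    have := integrableOn_mul_continuous hm
      (g := fun ξ => eC (-∑ i, (((x - y) i : ℤ) : ℝ) * ξ i) * f y)
      ((continuous_eC.comp (by fun_prop)).mul continuous_const)
    simpa only [IntegrableOn, mul_assoc] using this

lemma norm_bilin_mulKernel_le {d : ℕ} {m : (Fin d → ℝ) → ℂ}
    (hm : IntegrableOn m (Set.Icc 0 1)) {A : ℝ} (hA : ∀ ξ, ‖m ξ‖ ≤ A)
    (S Y : Finset (Fin d → ℤ)) (f h : (Fin d → ℤ) → ℂ)
    (hf : ∑ y ∈ Y, ‖f y‖ ^ 2 ≤ 1) (hh : ∑ x ∈ S, ‖h x‖ ^ 2 ≤ 1) :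
    ‖∑ x ∈ S, ∑ y ∈ Y, mulKernel d m (x - y) * f y * h x‖ ≤ A := by
  have hA0 : 0 ≤ A := (norm_nonneg _).trans (hA 0)
  set F : (Fin d → ℝ) → ℂ := fun ξ => ∑ y ∈ Y, f y * eC (∑ i, (y i : ℝ) * ξ i) with hF
  set G : (Fin d → ℝ) → ℂ := fun ξ => ∑ x ∈ S, h x * eC (∑ i, (((-x) i : ℤ) : ℝ) * ξ i) with hG
  have hFc : Continuous F := continuous_finsetSum _ fun y _ =>
    continuous_const.mul (continuous_eC_sum _)
  have hGc : Continuous G := continuous_finsetSum _ fun y _ =>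
    continuous_const.mul (continuous_eC_sum _)
  have heq : ∑ x ∈ S, ∑ y ∈ Y, mulKernel d m (x - y) * f y * h x
      = ∫ ξ in Set.Icc (0 : Fin d → ℝ) 1, m ξ * (F ξ * G ξ) := by
    simp only [mulKernel]
    simp_rw [← integral_mul_const]
    have hInt : ∀ x y : Fin d → ℤ, IntegrableOn (fun ξ : Fin d → ℝ =>
        m ξ * eC (-∑ i, (((x - y) i : ℤ) : ℝ) * ξ i) * f y * h x) (Set.Icc 0 1) := by
      intro x y
      have := integrableOn_mul_continuous hm
        (g := fun ξ => eC (-∑ i, (((x - y) i : ℤ) : ℝ) * ξ i) * f y * h x)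
        (((continuous_eC.comp (by fun_prop)).mul continuous_const).mul continuous_const)
      simpa only [mul_assoc] using this
    simp_rw [← integral_finsetSum _ fun y _ => hInt _ y]
    rw [← integral_finsetSum _ fun x _ => integrable_finsetSum _ fun y _ => hInt x y]
    congr 1
    ext ξ
    rw [hF, hG]
    simp only
    rw [mul_comm (∑ y ∈ Y, _) (∑ x ∈ S, _), Finset.sum_mul_sum, Finset.mul_sum]
    refine Finset.sum_congr rfl fun x _ => ?_
    rw [Finset.mul_sum]
    refine Finset.sum_congr rfl fun y _ => ?_
    have : -∑ i, (((x - y) i : ℤ) : ℝ) * ξ i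
        = ∑ i, (y i : ℝ) * ξ i + ∑ i, (((-x) i : ℤ) : ℝ) * ξ i := by
      rw [← Finset.sum_add_distrib, ← Finset.sum_neg_distrib]
      refine Finset.sum_congr rfl fun i _ => ?_
      simp only [Pi.sub_apply, Pi.neg_apply]
      push_cast
      ring
    rw [this, eC_add]
    ring
  rw [heq]
  calc ‖∫ ξ in Set.Icc (0 : Fin d → ℝ) 1, m ξ * (F ξ * G ξ)‖
      ≤ ∫ ξ in Set.Icc (0 : Fin d → ℝ) 1, A * ((‖F ξ‖ ^ 2 + ‖G ξ‖ ^ 2) / 2) := by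
        refine norm_integral_le_of_norm_le ?_ (Filter.Eventually.of_forall fun ξ => ?_)
        · exact integrableOn_Icc_of_continuous (by fun_prop)
        · rw [norm_mul, norm_mul]
          refine mul_le_mul (hA ξ) ?_ (by positivity) hA0
          nlinarith [sq_nonneg (‖F ξ‖ - ‖G ξ‖)]
    _ = A * ((∑ y ∈ Y, ‖f y‖ ^ 2 + ∑ x ∈ S, ‖h x‖ ^ 2) / 2) := by
        rw [integral_const_mul, integral_div, integral_add
          (integrableOn_Icc_of_continuous (by fun_prop))
          (integrableOn_Icc_of_continuous (by fun_prop))]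
        congr 3
        · exact integral_Icc_norm_sq_sum Y id Function.injective_id f
        · exact integral_Icc_norm_sq_sum S (fun x => -x) neg_injective h
    _ ≤ A := by nlinarith

lemma norm_bilin_le_of_sum_kernel_le {G : Type*} [AddGroup G] {k : G → ℂ} {A : ℝ}
    (hk : ∀ Z : Finset G, ∑ z ∈ Z, ‖k z‖ ≤ A) (S Y : Finset G) (f h : G → ℂ)
    (hh : ∀ x, ‖h x‖ ≤ 1) (hf : ∑ y ∈ Y, ‖f y‖ ≤ 1) :
    ‖∑ x ∈ S, ∑ y ∈ Y, k (x - y) * f y * h x‖ ≤ A := by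
  have hA0 : 0 ≤ A := by simpa using hk ∅
  have hshift : ∀ y, ∑ x ∈ S, ‖k (x - y)‖ ≤ A := by
    intro y
    have := hk (S.map (Equiv.subRight y).toEmbedding)
    rwa [Finset.sum_map] at this
  calc ‖∑ x ∈ S, ∑ y ∈ Y, k (x - y) * f y * h x‖
      ≤ ∑ x ∈ S, ∑ y ∈ Y, ‖k (x - y)‖ * ‖f y‖ := by
        refine (norm_sum_le _ _).trans (Finset.sum_le_sum fun x _ => (norm_sum_le _ _).trans
          (Finset.sum_le_sum fun y _ => ?_))
        rw [norm_mul, norm_mul]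
        exact mul_le_of_le_one_right (by positivity) (hh x)
    _ = ∑ y ∈ Y, (∑ x ∈ S, ‖k (x - y)‖) * ‖f y‖ := by
        rw [Finset.sum_comm]; simp_rw [Finset.sum_mul]
    _ ≤ ∑ y ∈ Y, A * ‖f y‖ := by
        refine Finset.sum_le_sum fun y _ => ?_
        gcongr
        exact hshift y
    _ ≤ A := by rw [← Finset.mul_sum]; exact mul_le_of_le_one_right hA0 hf

lemma sum_norm_rpow_le_one_of_lpNorm_le_one {d : ℕ} {p : ℝ} (hp : 0 < p)
    {f : (Fin d → ℤ) → ℂ} (hf : lpNorm d p f ≤ 1) (Y : Finset (Fin d → ℤ)) :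
    ∑ y ∈ Y, ‖f y‖ ^ p ≤ 1 := by
  have h1 : ∑' x : Fin d → ℤ, (‖f x‖₊ : ℝ≥0∞) ^ p ≤ 1 := by
    rw [_root_.lpNorm] at hf
    by_contra! hcon
    exact absurd hf (not_le.2 (ENNReal.one_lt_rpow hcon (by positivity)))
  have h2 := (ENNReal.sum_le_tsum Y).trans h1
  have h3 : ∑ y ∈ Y, (‖f y‖₊ : ℝ≥0∞) ^ p = ENNReal.ofReal (∑ y ∈ Y, ‖f y‖ ^ p) := by
    rw [ENNReal.ofReal_sum_of_nonneg fun _ _ => by positivity]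
    refine Finset.sum_congr rfl fun y _ => ?_
    rw [← ENNReal.ofReal_rpow_of_nonneg (norm_nonneg _) hp.le, ofReal_norm, enorm_eq_nnnorm]
  rw [h3] at h2
  simpa using (ENNReal.ofReal_le_one.1 h2)

lemma lpNorm_le_ofReal {d : ℕ} {p : ℝ} (hp : 0 < p) {g : (Fin d → ℤ) → ℂ} {A : ℝ}
    (h : ∀ S : Finset (Fin d → ℤ), (∑ x ∈ S, ‖g x‖ ^ p) ^ (1 / p) ≤ A) :
    lpNorm d p g ≤ ENNReal.ofReal A := by
  have hA : 0 ≤ A := (by positivity : (0 : ℝ) ≤ _).trans (h ∅)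
  rw [_root_.lpNorm, one_div, ENNReal.rpow_inv_le_iff hp, ENNReal.tsum_eq_iSup_sum]
  refine iSup_le fun S => ?_
  rw [← ENNReal.rpow_inv_le_iff hp, ← one_div]
  have h3 : ∑ y ∈ S, (‖g y‖₊ : ℝ≥0∞) ^ p = ENNReal.ofReal (∑ y ∈ S, ‖g y‖ ^ p) := by
    rw [ENNReal.ofReal_sum_of_nonneg fun _ _ => by positivity]
    refine Finset.sum_congr rfl fun y _ => ?_
    rw [← ENNReal.ofReal_rpow_of_nonneg (norm_nonneg _) hp.le, ofReal_norm, enorm_eq_nnnorm]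
  rw [h3, ENNReal.ofReal_rpow_of_nonneg (Finset.sum_nonneg fun _ _ => by positivity)
    (by positivity)]
  exact ENNReal.ofReal_le_ofReal (h S)

/-- Interpolated `ℓ^p` bound for a multiplier operator with bounded multiplier and summable
kernel. -/
lemma opNormLp_mulOp_le {d : ℕ} {m : (Fin d → ℝ) → ℂ} (hm : IntegrableOn m (Set.Icc 0 1))
    {A₁ A₂ : ℝ} (hk : ∀ Z : Finset (Fin d → ℤ), ∑ z ∈ Z, ‖mulKernel d m z‖ ≤ A₁)
    (hA : ∀ ξ, ‖m ξ‖ ≤ A₂) {p : ℝ} (hp1 : 1 ≤ p) (hp2 : p ≤ 2) :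
    opNormLp d p (mulOp d m) ≤ ENNReal.ofReal (A₁ ^ (2 / p - 1) * A₂ ^ (2 * (1 - 1 / p))) := by
  have hp0 : 0 < p := by linarith
  refine iSup_le fun ⟨f, hf, hfp⟩ => lpNorm_le_ofReal hp0 fun S => ?_
  have hfY := sum_norm_rpow_le_one_of_lpNorm_le_one hp0 hfp hf.toFinset
  simp only [mulOp_eq_sum hm hf]
  rcases hp1.eq_or_lt with rfl | hp1
  · norm_num
    simp only [Real.rpow_one] at hfY ⊢
    set Y := hf.toFinset
    have hA0 : 0 ≤ A₁ := by simpa using hk ∅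
    have hshift : ∀ y, ∑ x ∈ S, ‖mulKernel d m (x - y)‖ ≤ A₁ := by
      intro y
      have := hk (S.map (Equiv.subRight y).toEmbedding)
      rwa [Finset.sum_map] at this
    calc ∑ x ∈ S, ‖∑ y ∈ Y, mulKernel d m (x - y) * f y‖
        ≤ ∑ x ∈ S, ∑ y ∈ Y, ‖mulKernel d m (x - y)‖ * ‖f y‖ := by
          refine Finset.sum_le_sum fun x _ => (norm_sum_le _ _).trans
            (Finset.sum_le_sum fun y _ => (norm_mul _ _).le)
      _ = ∑ y ∈ Y, (∑ x ∈ S, ‖mulKernel d m (x - y)‖) * ‖f y‖ := by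
          rw [Finset.sum_comm]; simp_rw [Finset.sum_mul]
      _ ≤ ∑ y ∈ Y, A₁ * ‖f y‖ := by
          refine Finset.sum_le_sum fun y _ => ?_
          gcongr
          exact hshift y
      _ ≤ A₁ := by rw [← Finset.mul_sum]; exact mul_le_of_le_one_right hA0 hfY
  · exact sum_norm_rpow_le_of_interp S hf.toFinset (fun x y => mulKernel d m (x - y))
      (fun f h hh hf => norm_bilin_le_of_sum_kernel_le hk S _ f h hh hf)
      (fun f h hf hh => norm_bilin_mulKernel_le hm hA S _ f h hf hh) hp1 hp2 f hfY

end Multiplier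

section KernelDecay

open Finset

lemma summable_inv_one_add_int_sq : Summable fun n : ℤ => (1 + (n : ℝ) ^ 2)⁻¹ := by
  have h : Summable fun n : ℤ => 1 / (n : ℝ) ^ 2 := Real.summable_one_div_int_pow.2 (by norm_num)
  rw [← (Set.finite_singleton (0 : ℤ)).summable_compl_iff] at h ⊢
  refine h.of_nonneg_of_le (fun n => inv_nonneg.2 (by positivity)) fun n => ?_
  have hn : ((n : ℤ) : ℝ) ≠ 0 := by
    have : (n : ℤ) ≠ 0 := fun h0 => n.2 (by simp [h0])
    exact_mod_cast this
  simp only [Function.comp_apply, one_div]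
  exact inv_anti₀ (by positivity) (by linarith)

lemma inv_one_add_sq_le (t : ℝ) : (1 + t ^ 2)⁻¹ ≤ 3 * (1 + (⌊t⌋ : ℝ) ^ 2)⁻¹ := by
  rw [← div_eq_mul_inv, inv_eq_one_div, div_le_div_iff₀ (by positivity) (by positivity)]
  have h1 := Int.floor_le t
  have h2 := Int.lt_floor_add_one t
  set n : ℝ := (⌊t⌋ : ℝ)
  nlinarith [sq_nonneg (n - 2 * t), sq_nonneg (t - n), sq_nonneg (2 * t - n + 1), sq_nonneg (t + n)]

/-- A Riemann sum at scale `q` of `1 / (1 + t ^ 2)` is bounded uniformly in `q`. -/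
lemma sum_inv_one_add_sq_div_le {q : ℕ} (hq : 0 < q) (x : ℝ) (Z : Finset ℤ) :
    ∑ z ∈ Z, (q : ℝ)⁻¹ * (1 + ((x - z) / q) ^ 2)⁻¹ ≤ 3 * ∑' n : ℤ, (1 + (n : ℝ) ^ 2)⁻¹ := by
  have hq' : (0 : ℝ) < q := by exact_mod_cast hq
  set S := ∑' n : ℤ, (1 + (n : ℝ) ^ 2)⁻¹
  have hclass : ∀ a : ℤ, ∑ z ∈ Z with z % q = a, (1 + ((x - z) / q) ^ 2)⁻¹ ≤ 3 * S := by
    intro a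
    calc ∑ z ∈ Z with z % q = a, (1 + ((x - z) / q) ^ 2)⁻¹
        ≤ ∑ z ∈ Z with z % q = a, 3 * (1 + (⌊(x - z) / q⌋ : ℝ) ^ 2)⁻¹ :=
          Finset.sum_le_sum fun z _ => inv_one_add_sq_le _
      _ = ∑ n ∈ (Z.filter (fun z => z % q = a)).image (fun z : ℤ => ⌊(x - z) / q⌋),
            3 * (1 + (n : ℝ) ^ 2)⁻¹ := by
          rw [Finset.sum_image]
          intro z hz z' hz' h
          simp only [Finset.coe_filter, Set.mem_ofPred_eq] at hz hz'
          obtain ⟨k, hk⟩ : (q : ℤ) ∣ z' - z :=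
            Int.ModEq.dvd (hz.2.trans hz'.2.symm)
          have hz'e : z' = z + q * k := by linarith
          have hfl : (x - z') / q = (x - z) / q - (k : ℤ) := by
            rw [hz'e]; push_cast; field_simp; ring
          simp only [hfl, Int.floor_sub_intCast] at h
          have hk0 : k = 0 := by linarith
          rw [hz'e, hk0]; ring
      _ ≤ 3 * S := by
          rw [← Finset.mul_sum]
          gcongr
          exact summable_inv_one_add_int_sq.sum_le_tsum _ fun _ _ => by positivity
  calc ∑ z ∈ Z, (q : ℝ)⁻¹ * (1 + ((x - z) / q) ^ 2)⁻¹
      = (q : ℝ)⁻¹ * ∑ a ∈ Finset.Ico (0 : ℤ) q, ∑ z ∈ Z with z % q = a,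
          (1 + ((x - z) / q) ^ 2)⁻¹ := by
        rw [← Finset.mul_sum, Finset.sum_fiberwise_of_maps_to]
        intro z _
        have : (0 : ℤ) < q := by exact_mod_cast hq
        simp [Int.emod_nonneg _ this.ne', Int.emod_lt_of_pos _ this]
    _ ≤ (q : ℝ)⁻¹ * ∑ a ∈ Finset.Ico (0 : ℤ) q, 3 * S := by
        gcongr with a
        exact hclass a
    _ = 3 * S := by
        simp
        field_simp

lemma sum_prod_inv_one_add_sq_div_le {d q : ℕ} (hq : 0 < q) (x : Fin d → ℝ)
    (Z : Finset (Fin d → ℤ)) :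
    ∑ z ∈ Z, ((q : ℝ)⁻¹) ^ d * ∏ i, (1 + ((x i - z i) / q) ^ 2)⁻¹
      ≤ (3 * ∑' n : ℤ, (1 + (n : ℝ) ^ 2)⁻¹) ^ d := by
  classical
  have hsub : Z ⊆ Fintype.piFinset fun i => Z.image fun z => z i := by
    intro z hz
    simp only [Fintype.mem_piFinset, Finset.mem_image]
    exact fun i => ⟨z, hz, rfl⟩
  calc ∑ z ∈ Z, ((q : ℝ)⁻¹) ^ d * ∏ i, (1 + ((x i - z i) / q) ^ 2)⁻¹
      = ∑ z ∈ Z, ∏ i, (q : ℝ)⁻¹ * (1 + ((x i - z i) / q) ^ 2)⁻¹ := by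
        simp [Finset.prod_mul_distrib]
    _ ≤ ∑ z ∈ Fintype.piFinset fun i => Z.image fun z => z i,
          ∏ i, (q : ℝ)⁻¹ * (1 + ((x i - z i) / q) ^ 2)⁻¹ :=
        Finset.sum_le_sum_of_subset_of_nonneg hsub fun _ _ _ =>
          Finset.prod_nonneg fun _ _ => by positivity
    _ = ∏ i, ∑ z ∈ Z.image fun z => z i, (q : ℝ)⁻¹ * (1 + ((x i - z) / q) ^ 2)⁻¹ :=
        (Finset.prod_univ_sum _ fun i (z : ℤ) => (q : ℝ)⁻¹ * (1 + ((x i - z) / q) ^ 2)⁻¹).symm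
    _ ≤ ∏ _i : Fin d, 3 * ∑' n : ℤ, (1 + (n : ℝ) ^ 2)⁻¹ :=
        Finset.prod_le_prod (fun _ _ => Finset.sum_nonneg fun _ _ => by positivity)
          fun i _ => sum_inv_one_add_sq_div_le hq _ _
    _ = _ := by simp

lemma IsBump.continuous {d : ℕ} {Ψ : (Fin d → ℝ) → ℝ} (h : IsBump d Ψ) : Continuous Ψ :=
  h.1.continuous

lemma IsBump.hasCompactSupport {d : ℕ} {Ψ : (Fin d → ℝ) → ℝ} (h : IsBump d Ψ) :
    HasCompactSupport Ψ :=
  HasCompactSupport.intro isCompact_Icc h.2.1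

open FourierTransform in
/-- The Fourier transform of a bump function decays rapidly. -/
lemma IsBump.exists_norm_ft_le {d : ℕ} {Ψ : (Fin d → ℝ) → ℝ} (h : IsBump d Ψ) :
    ∃ C : ℝ, 0 ≤ C ∧ ∀ ζ : Fin d → ℝ,
      ‖∫ t : Fin d → ℝ, (Ψ t : ℂ) * eC (∑ i, t i * ζ i)‖ ≤ C * ∏ i, (1 + ζ i ^ 2)⁻¹ := by
  set g : EuclideanSpace ℝ (Fin d) → ℂ := fun v => (Ψ (WithLp.ofLp v) : ℂ) with hg
  have hgs : ContDiff ℝ (⊤ : ℕ∞) g :=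
    Complex.ofRealCLM.contDiff.comp
      (h.1.comp (PiLp.continuousLinearEquiv 2 ℝ fun _ : Fin d => ℝ).contDiff)
  have hgc : HasCompactSupport g := by
    have h1 : HasCompactSupport (fun v : EuclideanSpace ℝ (Fin d) => Ψ (WithLp.ofLp v)) :=
      h.hasCompactSupport.comp_homeomorph (PiLp.continuousLinearEquiv 2 ℝ fun _ : Fin d => ℝ).toHomeomorph
    exact h1.comp_left (g := fun x : ℝ => (x : ℂ)) Complex.ofReal_zero
  set φ := 𝓕⁻ (hgc.toSchwartzMap hgs) with hφ
  set C := 2 ^ (2 * d) * ((Finset.Iic (2 * d, 0)).sup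
    fun m : ℕ × ℕ => SchwartzMap.seminorm ℝ (E := EuclideanSpace ℝ (Fin d)) (F := ℂ) m.1 m.2) φ
  have hC : ∀ w, (1 + ‖w‖) ^ (2 * d) * ‖φ w‖ ≤ C := by
    intro w
    have := SchwartzMap.one_add_le_sup_seminorm_apply (𝕜 := ℝ) (m := (2 * d, 0)) (k := 2 * d)
      (n := 0) le_rfl le_rfl φ w
    simpa using this
  have hval : ∀ ζ : Fin d → ℝ, ∫ t : Fin d → ℝ, (Ψ t : ℂ) * eC (∑ i, t i * ζ i)
      = φ (WithLp.toLp 2 ζ) := by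
    intro ζ
    rw [hφ, SchwartzMap.fourierInv_coe, Real.fourierInv_eq',
      ← (EuclideanSpace.volume_preserving_symm_measurableEquiv_toLp (Fin d)).integral_comp'
        (g := fun t : Fin d → ℝ => (Ψ t : ℂ) * eC (∑ i, t i * ζ i))]
    refine integral_congr_ae (Filter.Eventually.of_forall fun v => ?_)
    simp only [smul_eq_mul, hg, HasCompactSupport.toSchwartzMap_toFun]
    rw [mul_comm]
    congr 1
    rw [eC]
    congr 1
    simp [PiLp.inner_apply, mul_comm]
    ring
  refine ⟨C, by positivity, fun ζ => ?_⟩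
  rw [hval, Finset.prod_inv_distrib, ← div_eq_mul_inv, le_div_iff₀ (by positivity), mul_comm]
  refine le_trans ?_ (hC (WithLp.toLp 2 ζ))
  gcongr
  calc ∏ i, (1 + ζ i ^ 2)
      ≤ ∏ _i : Fin d, (1 + ‖(WithLp.toLp 2 ζ : EuclideanSpace ℝ (Fin d))‖) ^ 2 := by
        refine Finset.prod_le_prod (fun _ _ => by positivity) fun i _ => ?_
        have h1 : |ζ i| ≤ ‖(WithLp.toLp 2 ζ : EuclideanSpace ℝ (Fin d))‖ := by
          simpa using PiLp.norm_apply_le (WithLp.toLp 2 ζ : EuclideanSpace ℝ (Fin d)) i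
        nlinarith [sq_abs (ζ i), abs_nonneg (ζ i)]
    _ = _ := by simp [← pow_mul]

end KernelDecay

section Unfolding

open Finset

lemma hasSum_integral_Icc_sub {d : ℕ} {E : Type*} [NormedAddCommGroup E] [NormedSpace ℝ E]
    {g : (Fin d → ℝ) → E} (hg : Integrable g) :
    HasSum (fun l : Fin d → ℤ => ∫ ξ in Set.Icc (0 : Fin d → ℝ) 1, g (ξ - fun i => (l i : ℝ)))
      (∫ ξ, g ξ) := by
  set s : (Fin d → ℤ) → Set (Fin d → ℝ) := fun l =>
    Set.univ.pi fun i => Set.Ico (-(l i : ℝ)) (-(l i : ℝ) + 1) with hs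
  have hmem : ∀ l ξ, ξ ∈ s l ↔ ∀ i, l i = -⌊ξ i⌋ := by
    intro l ξ
    simp only [hs, Set.mem_pi, Set.mem_univ, forall_true_left, Set.mem_Ico]
    refine forall_congr' fun i => ?_
    have := Int.floor_eq_iff (a := ξ i) (z := -l i)
    push_cast at this
    rw [← this]
    constructor <;> intro h <;> omega
  have hunion : ⋃ l, s l = Set.univ := by
    refine Set.eq_univ_of_forall fun ξ => Set.mem_iUnion.2 ⟨fun i => -⌊ξ i⌋, ?_⟩
    simp [hmem]
  have hdisj : Pairwise (Function.onFun Disjoint s) := by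
    intro l l' hne
    refine Set.disjoint_left.2 fun ξ h h' => hne (funext fun i => ?_)
    rw [(hmem l ξ).1 h i, (hmem l' ξ).1 h' i]
  have key := hasSum_integral_iUnion (μ := (volume : Measure (Fin d → ℝ))) (f := g) (s := s)
    (fun l => MeasurableSet.univ_pi fun i => measurableSet_Ico) hdisj hg.integrableOn
  rw [hunion, Measure.restrict_univ] at key
  have hset : ∀ l, ∫ ξ in s l, g ξ
      = ∫ ξ in Set.Icc (0 : Fin d → ℝ) 1, g (ξ - fun i => (l i : ℝ)) := by
    intro l
    have hpre : (fun ξ : Fin d → ℝ => ξ - fun i => (l i : ℝ)) ⁻¹' s l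
        = Set.univ.pi fun i => Set.Ico ((0 : Fin d → ℝ) i) ((1 : Fin d → ℝ) i) := by
      ext ξ
      simp only [hs, Set.mem_preimage, Set.mem_pi, Set.mem_univ, forall_true_left, Set.mem_Ico,
        Pi.sub_apply, Pi.zero_apply, Pi.one_apply]
      refine forall_congr' fun i => ?_
      constructor <;> rintro ⟨h1, h2⟩ <;> constructor <;> linarith
    rw [← (measurePreserving_sub_right volume (fun i => (l i : ℝ))).setIntegral_preimage_emb
      (Homeomorph.subRight _).measurableEmbedding, hpre]
    exact setIntegral_congr_set Measure.univ_pi_Ico_ae_eq_Icc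
  simpa only [hset] using key

/-- The bijection `n = a + q l` between `ℤ^d` and residues together with quotients. -/
def piDivMod (d q : ℕ) [NeZero q] : (Fin d → ℤ) ≃ (Fin d → ℤ) × (Fin d → Fin q) :=
  (Equiv.piCongrRight fun _ => Int.divModEquiv q).trans (Equiv.arrowProdEquivProdArrow _ _ _)

lemma piDivMod_symm_apply {d q : ℕ} [NeZero q] (l : Fin d → ℤ) (a : Fin d → Fin q) :
    (piDivMod d q).symm (l, a) = fun i => ((a i : ℕ) : ℤ) + q * l i := by
  funext i
  simp only [piDivMod, Equiv.symm_trans_apply]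
  change (Int.divModEquiv q).symm (l i, a i) = _
  rw [Int.divModEquiv_symm_apply]
  ring

variable {d q : ℕ} [NeZero q] {K : (Fin d → ℤ) → ℂ} {Φ : (Fin d → ℝ) → ℂ}

/-- The kernel of a multiplier periodized from `Φ` with `q`-periodic weights `K` factors. -/
lemma mulKernel_periodized (hK : ∀ n m : Fin d → ℤ, K (fun i => n i + q * m i) = K n)
    (hΦ : Integrable Φ) (z : Fin d → ℤ) :
    mulKernel d (fun ξ => ∑' n : Fin d → ℤ, K n * Φ (fun i => ξ i - (n i : ℝ) / q)) z
      = (∑ a : Fin d → Fin q, K (fun i => ((a i : ℕ) : ℤ)) *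
          eC (-∑ i, (z i : ℝ) * (((a i : ℕ) : ℝ) / q))) *
        ∫ η, Φ η * eC (-∑ i, (z i : ℝ) * η i) := by
  have hq : (q : ℝ) ≠ 0 := by exact_mod_cast NeZero.ne q
  have hcont : Continuous fun ξ : Fin d → ℝ => eC (-∑ i, (z i : ℝ) * ξ i) :=
    continuous_eC.comp (by fun_prop)
  set w : (Fin d → Fin q) → (Fin d → ℝ) := fun a i => ((a i : ℕ) : ℝ) / q with hw
  have hΦa : ∀ a, Integrable fun ξ : Fin d → ℝ => Φ (ξ - w a) := fun a => hΦ.comp_sub_right _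
  have hga : ∀ a, Integrable fun ξ : Fin d → ℝ => Φ (ξ - w a) * eC (-∑ i, (z i : ℝ) * ξ i) :=
    fun a => (hΦa a).mul_bdd (c := 1) hcont.aestronglyMeasurable
      (Filter.Eventually.of_forall fun ξ => (norm_eC _).le)
  set u : (Fin d → ℤ) → (Fin d → ℝ) → ℂ := fun n ξ =>
    K n * Φ (fun i => ξ i - (n i : ℝ) / q) * eC (-∑ i, (z i : ℝ) * ξ i) with hu
  have hu_eq : ∀ l a ξ, u ((piDivMod d q).symm (l, a)) ξ = K (fun i => ((a i : ℕ) : ℤ)) *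
      (Φ ((ξ - fun i => (l i : ℝ)) - w a) *
        eC (-∑ i, (z i : ℝ) * (ξ - fun i => (l i : ℝ)) i)) := by
    intro l a ξ
    simp only [hu, piDivMod_symm_apply, hK, mul_assoc]
    congr 2
    · congr 1
      funext i
      simp only [hw, Pi.sub_apply]
      push_cast
      field_simp
      ring
    · have : -∑ i, (z i : ℝ) * (ξ - fun i => (l i : ℝ)) i
          = -∑ i, (z i : ℝ) * ξ i + ((∑ i, z i * l i : ℤ) : ℝ) := by
        push_cast
        rw [← Finset.sum_neg_distrib, ← Finset.sum_neg_distrib, ← Finset.sum_add_distrib]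
        refine Finset.sum_congr rfl fun i _ => ?_
        simp only [Pi.sub_apply]
        ring
      rw [this, eC_add, eC_int, mul_one]
  have hnorm_eq : ∀ l a, ∫ ξ in Set.Icc (0 : Fin d → ℝ) 1, ‖u ((piDivMod d q).symm (l, a)) ξ‖
      = ‖K (fun i => ((a i : ℕ) : ℤ))‖ *
        ∫ ξ in Set.Icc (0 : Fin d → ℝ) 1, ‖Φ ((ξ - fun i => (l i : ℝ)) - w a)‖ := by
    intro l a
    rw [← integral_const_mul]
    simp only [hu_eq, norm_mul, norm_eC, mul_one]
  have hsum : Summable fun n => ∫ ξ in Set.Icc (0 : Fin d → ℝ) 1, ‖u n ξ‖ := by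
    rw [← (piDivMod d q).symm.summable_iff, ← (Equiv.prodComm _ _).summable_iff]
    refine (summable_prod_of_nonneg fun _ => integral_nonneg fun _ => norm_nonneg _).2
      ⟨fun a => ?_, (hasSum_fintype _).summable⟩
    simp only [Equiv.prodComm_apply, Prod.swap_prod_mk, hnorm_eq]
    exact (hasSum_integral_Icc_sub (hΦa a).norm).summable.mul_left _
  have huint : ∀ n, IntegrableOn (u n) (Set.Icc 0 1) := by
    intro n
    obtain ⟨⟨l, a⟩, rfl⟩ := (piDivMod d q).symm.surjective n
    rw [show u ((piDivMod d q).symm (l, a)) = _ from funext (hu_eq l a)]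
    exact (((hga a).comp_sub_right fun i => (l i : ℝ)).const_mul _).integrableOn
  have key := hasSum_integral_of_summable_integral_norm huint hsum
  have h1 : mulKernel d (fun ξ => ∑' n : Fin d → ℤ, K n * Φ (fun i => ξ i - (n i : ℝ) / q)) z
      = ∫ ξ in Set.Icc (0 : Fin d → ℝ) 1, ∑' n, u n ξ := by
    simp only [mulKernel, hu, tsum_mul_right]
  rw [h1]
  have key2 : HasSum (fun x : (Fin d → Fin q) × (Fin d → ℤ) =>
      ∫ ξ in Set.Icc (0 : Fin d → ℝ) 1, u ((piDivMod d q).symm (x.2, x.1)) ξ)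
      (∫ ξ in Set.Icc (0 : Fin d → ℝ) 1, ∑' n, u n ξ) := by
    rw [← (piDivMod d q).symm.hasSum_iff, ← (Equiv.prodComm _ _).hasSum_iff] at key
    exact key
  have key3 := key2.prod_fiberwise (g := fun a => K (fun i => ((a i : ℕ) : ℤ)) *
    ∫ ξ, Φ (ξ - w a) * eC (-∑ i, (z i : ℝ) * ξ i)) fun a => by
      simp only [hu_eq, integral_const_mul]
      exact (hasSum_integral_Icc_sub (hga a)).mul_left _
  rw [key3.unique (hasSum_fintype _), Finset.sum_mul]
  refine Finset.sum_congr rfl fun a _ => ?_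
  rw [mul_assoc]
  congr 1
  rw [← integral_const_mul,
    ← integral_sub_right_eq_self (fun η => eC (-∑ i, (z i : ℝ) * (((a i : ℕ) : ℝ) / q)) *
    (Φ η * eC (-∑ i, (z i : ℝ) * η i))) (w a)]
  congr 1
  funext ξ
  have : -∑ i, (z i : ℝ) * ξ i
      = -∑ i, (z i : ℝ) * (((a i : ℕ) : ℝ) / q) + -∑ i, (z i : ℝ) * (ξ - w a) i := by
    rw [← Finset.sum_neg_distrib, ← Finset.sum_neg_distrib, ← Finset.sum_neg_distrib,
      ← Finset.sum_add_distrib]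
    refine Finset.sum_congr rfl fun i _ => ?_
    simp only [Pi.sub_apply, hw]
    ring
  rw [this, eC_add]
  ring

/-- The `n`-th term of the periodized multiplier is non-zero only when `n` is the nearest lattice
point. -/
lemma tsum_periodized_eq (hΦ : ∀ η, (∃ i, 1 / 4 < |(q : ℝ) * η i|) → Φ η = 0) (ξ : Fin d → ℝ) :
    ∑' n : Fin d → ℤ, K n * Φ (fun i => ξ i - (n i : ℝ) / q)
      = K (fun i => round (q * ξ i)) * Φ (fun i => ξ i - (round (q * ξ i) : ℝ) / q) := by
  have hq : (q : ℝ) ≠ 0 := by exact_mod_cast NeZero.ne q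
  refine tsum_eq_single (fun i => round (q * ξ i)) fun n hn => ?_
  rw [hΦ, mul_zero]
  obtain ⟨i, hi⟩ := Function.ne_iff.1 hn
  refine ⟨i, ?_⟩
  by_contra! hcon
  apply hi
  have h1 : (q : ℝ) * (ξ i - n i / q) = q * ξ i - n i := by field_simp
  rw [h1] at hcon
  have h2 := abs_sub_round ((q : ℝ) * ξ i)
  have h3 : |((n i - round ((q : ℝ) * ξ i) : ℤ) : ℝ)| < 1 := by
    push_cast
    calc |(n i : ℝ) - round ((q : ℝ) * ξ i)|
        ≤ |(n i : ℝ) - q * ξ i| + |(q : ℝ) * ξ i - round ((q : ℝ) * ξ i)| := abs_sub_le _ _ _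
      _ < 1 := by rw [abs_sub_comm]; linarith
  have h4 : n i - round ((q : ℝ) * ξ i) = 0 := by
    rw [← Int.abs_lt_one_iff]; exact_mod_cast h3
  linarith

lemma norm_periodized_le (hΦ : ∀ η, (∃ i, 1 / 4 < |(q : ℝ) * η i|) → Φ η = 0) {A B : ℝ}
    (hA : ∀ n, ‖K n‖ ≤ A) (hB : ∀ η, ‖Φ η‖ ≤ B) (ξ : Fin d → ℝ) :
    ‖∑' n : Fin d → ℤ, K n * Φ (fun i => ξ i - (n i : ℝ) / q)‖ ≤ A * B := by
  rw [tsum_periodized_eq hΦ, norm_mul]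
  exact mul_le_mul (hA _) (hB _) (norm_nonneg _) ((norm_nonneg _).trans (hA 0))

lemma measurable_periodized (hΦ : ∀ η, (∃ i, 1 / 4 < |(q : ℝ) * η i|) → Φ η = 0)
    (hm : Measurable Φ) :
    Measurable fun ξ : Fin d → ℝ =>
      ∑' n : Fin d → ℤ, K n * Φ (fun i => ξ i - (n i : ℝ) / q) := by
  simp only [tsum_periodized_eq hΦ]
  have h1 : Measurable fun x : (Fin d → ℝ) × (Fin d → ℤ) =>
      K x.2 * Φ (fun i => x.1 i - (x.2 i : ℝ) / q) := by
    refine measurable_from_prod_countable_left fun n => ?_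
    have h2 : Measurable fun x : Fin d → ℝ => fun i => x i - (n i : ℝ) / q :=
      measurable_pi_lambda _ fun i => by fun_prop
    exact (measurable_const : Measurable fun _ => K n).mul (hm.comp h2)
  have h3 : Measurable fun ξ : Fin d → ℝ => fun i => round ((q : ℝ) * ξ i) := by
    refine measurable_pi_lambda _ fun i => ?_
    simp only [round_eq]
    exact Int.measurable_floor.comp (by fun_prop)
  exact h1.comp (measurable_id.prodMk h3)

end Unfolding

section SphericalMultiplier

open scoped Pointwise in
lemma sphMeasure_univ {d : ℕ} (hd : 1 ≤ d) {r : ℝ} (hr : 0 < r) :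
    sphMeasure d r Set.univ = sphMeasure d 1 Set.univ := by
  have hd' : (0 : ℝ) ≤ (d : ℝ) - 1 := by
    have : (1 : ℝ) ≤ d := by exact_mod_cast hd
    linarith
  have hsph : Metric.sphere (0 : EuclideanSpace ℝ (Fin d)) r =
      r • Metric.sphere (0 : EuclideanSpace ℝ (Fin d)) 1 := by
    rw [smul_sphere' hr.ne', smul_zero, Real.norm_of_nonneg hr.le, mul_one]
  have hpow : ((‖r‖₊ ^ ((d : ℝ) - 1) : ℝ≥0) : ℝ≥0∞) = ENNReal.ofReal (r ^ (d - 1)) := by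
    rw [ENNReal.ofReal, ENNReal.coe_inj]
    ext
    rw [NNReal.coe_rpow, coe_nnnorm, Real.norm_of_nonneg hr.le,
      Real.coe_toNNReal _ (by positivity), ← Real.rpow_natCast, Nat.cast_sub hd, Nat.cast_one]
  simp only [sphMeasure, Measure.smul_apply, Measure.restrict_apply_univ, smul_eq_mul]
  rw [hsph, Measure.hausdorffMeasure_smul₀ hd' hr.ne', ENNReal.smul_def, smul_eq_mul, hpow,
    ← mul_assoc]
  congr 1
  rw [ENNReal.ofReal_mul two_pos.le, one_pow, mul_one, ENNReal.mul_inv (by simp) (by simp), mul_assoc,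
    ENNReal.inv_mul_cancel (by simpa using pow_pos hr _) ENNReal.ofReal_ne_top, mul_one]

/-- The Fourier transforms of the normalized spherical measures are Fourier transforms of finite
measures of uniformly bounded mass. -/
lemma exists_fourierSphMeasure_eq {d : ℕ} (hd : 1 ≤ d) :
    ∃ M : ℝ, 0 < M ∧ ∀ r : ℝ, 0 < r → ∃ μ : Measure (EuclideanSpace ℝ (Fin d)),
      IsFiniteMeasure μ ∧ μ.real Set.univ ≤ M ∧
        ∀ ξ, fourierSphMeasure d r ξ = ∫ x, eC (∑ i, x i * ξ i) ∂μ := by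
  refine ⟨(sphMeasure d 1).real Set.univ + 1, by positivity, fun r hr => ?_⟩
  by_cases hfin : IsFiniteMeasure (sphMeasure d r)
  · refine ⟨sphMeasure d r, hfin, ?_, fun ξ => rfl⟩
    rw [Measure.real, sphMeasure_univ hd hr, ← Measure.real]
    linarith
  · refine ⟨0, inferInstance, by simp; positivity, fun ξ => ?_⟩
    rw [integral_zero_measure]
    refine integral_undef fun hInt => hfin ?_
    have h := hInt.norm
    simp only [norm_eC] at h
    simpa [integrable_const_iff] using h

variable {d : ℕ} {μ : Measure (EuclideanSpace ℝ (Fin d))} [IsFiniteMeasure μ]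

lemma continuous_eC_inner (ξ : Fin d → ℝ) :
    Continuous fun x : EuclideanSpace ℝ (Fin d) => eC (∑ i, x i * ξ i) :=
  continuous_eC.comp (by fun_prop)

lemma norm_integral_eC_le (ξ : Fin d → ℝ) :
    ‖∫ x : EuclideanSpace ℝ (Fin d), eC (∑ i, x i * ξ i) ∂μ‖ ≤ μ.real Set.univ := by
  simpa using norm_integral_le_of_norm_le_const (μ := μ) (C := 1)
    (Filter.Eventually.of_forall fun x => (norm_eC (∑ i, x i * ξ i)).le)

lemma continuous_integral_eC :
    Continuous fun ξ : Fin d → ℝ => ∫ x : EuclideanSpace ℝ (Fin d), eC (∑ i, x i * ξ i) ∂μ :=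
  continuous_of_dominated (bound := fun _ => 1)
    (fun ξ => (continuous_eC_inner ξ).aestronglyMeasurable)
    (fun ξ => Filter.Eventually.of_forall fun x => (norm_eC _).le) (integrable_const _)
    (Filter.Eventually.of_forall fun x => continuous_eC.comp (by fun_prop))

lemma integral_bump_mul_eC {q : ℕ} (hq : 0 < q) (Ψ : (Fin d → ℝ) → ℝ) (ζ : Fin d → ℝ) :
    ∫ η : Fin d → ℝ, (Ψ (fun i => (q : ℝ) * η i) : ℂ) * eC (∑ i, η i * ζ i)
      = (((q : ℝ)⁻¹ ^ d : ℝ) : ℂ) *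
        ∫ t : Fin d → ℝ, (Ψ t : ℂ) * eC (∑ i, t i * (ζ i / q)) := by
  have hq' : (q : ℝ) ≠ 0 := by exact_mod_cast hq.ne'
  have h := Measure.integral_comp_smul (volume : Measure (Fin d → ℝ))
    (fun t : Fin d → ℝ => (Ψ t : ℂ) * eC (∑ i, t i * (ζ i / q))) (q : ℝ)
  rw [Module.finrank_fintype_fun_eq_card, Fintype.card_fin, abs_of_nonneg (by positivity),
    ← inv_pow] at h
  rw [← Complex.real_smul, ← h]
  congr 1
  funext η
  congr 2
  refine Finset.sum_congr rfl fun i _ => ?_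
  simp only [Pi.smul_apply, smul_eq_mul]
  field_simp

variable {q : ℕ} {Ψ : (Fin d → ℝ) → ℝ}

lemma IsBump.integrable_dilate (h : IsBump d Ψ) (hq : 0 < q) :
    Integrable fun η : Fin d → ℝ => (Ψ (fun i => (q : ℝ) * η i) : ℂ) := by
  have hq' : (q : ℝ) ≠ 0 := by exact_mod_cast hq.ne'
  exact ((h.continuous.integrable_of_hasCompactSupport h.hasCompactSupport).comp_smul hq').ofReal

lemma IsBump.integrable_dilate_mul (h : IsBump d Ψ) (hq : 0 < q) :
    Integrable fun η : Fin d → ℝ => (Ψ (fun i => (q : ℝ) * η i) : ℂ) *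
      ∫ x : EuclideanSpace ℝ (Fin d), eC (∑ i, x i * η i) ∂μ :=
  (h.integrable_dilate hq).mul_bdd (c := μ.real Set.univ)
    continuous_integral_eC.aestronglyMeasurable
    (Filter.Eventually.of_forall fun η => norm_integral_eC_le η)

lemma IsBump.integral_dilate_mul_eq (h : IsBump d Ψ) (hq : 0 < q) (z : Fin d → ℤ) :
    ∫ η : Fin d → ℝ, ((Ψ (fun i => (q : ℝ) * η i) : ℂ) *
      ∫ x : EuclideanSpace ℝ (Fin d), eC (∑ i, x i * η i) ∂μ) * eC (-∑ i, (z i : ℝ) * η i)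
    = ∫ x : EuclideanSpace ℝ (Fin d), ((((q : ℝ)⁻¹ ^ d : ℝ) : ℂ) *
        ∫ t : Fin d → ℝ, (Ψ t : ℂ) * eC (∑ i, t i * ((x i - z i) / q))) ∂μ := by
  simp only [← integral_bump_mul_eC hq Ψ]
  have hInt : Integrable (Function.uncurry fun (η : Fin d → ℝ) (x : EuclideanSpace ℝ (Fin d)) =>
      (Ψ (fun i => (q : ℝ) * η i) : ℂ) * eC (∑ i, η i * (x i - z i))) (volume.prod μ) := by
    have h1 := (h.integrable_dilate hq).mul_prod (integrable_const (μ := μ) (1 : ℂ))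
    simp only [mul_one] at h1
    refine h1.mul_bdd (c := 1) ?_ (Filter.Eventually.of_forall fun x => (norm_eC _).le)
    exact (continuous_eC.comp (by fun_prop)).aestronglyMeasurable
  rw [← integral_integral_swap hInt]
  congr 1
  funext η
  rw [integral_const_mul, mul_assoc, ← integral_mul_const]
  congr 2
  funext x
  rw [← eC_add]
  congr 1
  rw [← Finset.sum_neg_distrib, ← Finset.sum_add_distrib]
  refine Finset.sum_congr rfl fun i _ => ?_
  ring

lemma IsBump.sum_norm_integral_le (h : IsBump d Ψ) (hq : 0 < q) {C : ℝ} (hC0 : 0 ≤ C)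
    (hC : ∀ ζ : Fin d → ℝ,
      ‖∫ t : Fin d → ℝ, (Ψ t : ℂ) * eC (∑ i, t i * ζ i)‖ ≤ C * ∏ i, (1 + ζ i ^ 2)⁻¹)
    (Z : Finset (Fin d → ℤ)) :
    ∑ z ∈ Z, ‖∫ η : Fin d → ℝ, ((Ψ (fun i => (q : ℝ) * η i) : ℂ) *
      ∫ x : EuclideanSpace ℝ (Fin d), eC (∑ i, x i * η i) ∂μ) * eC (-∑ i, (z i : ℝ) * η i)‖
    ≤ C * (3 * ∑' n : ℤ, (1 + (n : ℝ) ^ 2)⁻¹) ^ d * μ.real Set.univ := by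
  set g : (Fin d → ℤ) → EuclideanSpace ℝ (Fin d) → ℝ := fun z x =>
    C * ((q : ℝ)⁻¹ ^ d * ∏ i, (1 + ((x i - z i) / q) ^ 2)⁻¹) with hg
  have hgc : ∀ z, Continuous (g z) := fun z =>
    continuous_const.mul (continuous_const.mul (continuous_finsetProd _ fun i _ =>
      Continuous.inv₀ (by fun_prop) fun x => by positivity))
  have hg0 : ∀ z x, 0 ≤ g z x := fun z x => by positivity
  have hgsum : ∀ (Z : Finset (Fin d → ℤ)) x, ∑ z ∈ Z, g z x ≤
      C * (3 * ∑' n : ℤ, (1 + (n : ℝ) ^ 2)⁻¹) ^ d := by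
    intro Z x
    rw [← Finset.mul_sum]
    exact mul_le_mul_of_nonneg_left (sum_prod_inv_one_add_sq_div_le hq _ Z) hC0
  have hgi : ∀ z, Integrable (g z) μ := fun z =>
    Integrable.of_bound (hgc z).aestronglyMeasurable
      (C * (3 * ∑' n : ℤ, (1 + (n : ℝ) ^ 2)⁻¹) ^ d) (Filter.Eventually.of_forall fun x => by
        rw [Real.norm_of_nonneg (hg0 z x)]
        simpa using hgsum {z} x)
  calc _ ≤ ∑ z ∈ Z, ∫ x, g z x ∂μ := by
        refine Finset.sum_le_sum fun z _ => ?_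
        rw [h.integral_dilate_mul_eq hq]
        refine norm_integral_le_of_norm_le (hgi z) (Filter.Eventually.of_forall fun x => ?_)
        rw [norm_mul, Complex.norm_real, Real.norm_of_nonneg (by positivity), hg]
        calc _ ≤ (q : ℝ)⁻¹ ^ d * (C * ∏ i, (1 + ((x i - z i) / q) ^ 2)⁻¹) :=
              mul_le_mul_of_nonneg_left (hC _) (by positivity)
          _ = _ := by ring
    _ = ∫ x, ∑ z ∈ Z, g z x ∂μ := (integral_finsetSum _ fun z _ => hgi z).symm
    _ ≤ ∫ x, C * (3 * ∑' n : ℤ, (1 + (n : ℝ) ^ 2)⁻¹) ^ d ∂μ :=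
        integral_mono (integrable_finsetSum _ fun z _ => hgi z) (integrable_const _) (hgsum Z)
    _ = _ := by simp [mul_comm]

end SphericalMultiplier

lemma IsBump.exists_abs_le {d : ℕ} {Ψ : (Fin d → ℝ) → ℝ} (h : IsBump d Ψ) :
    ∃ B : ℝ, 0 < B ∧ ∀ t, |Ψ t| ≤ B := by
  obtain ⟨B, hB⟩ := h.continuous.bounded_above_of_compact_support h.hasCompactSupport
  exact ⟨max B 1, by positivity, fun t => (hB t).trans (le_max_left _ _)⟩

lemma opNormLp_mulOp_mHqr_le {d q : ℕ} [NeZero q] {r : ℝ} {Ψ : (Fin d → ℝ) → ℝ} (hΨ : IsBump d Ψ)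
    {μ : Measure (EuclideanSpace ℝ (Fin d))} [IsFiniteMeasure μ]
    (hμ : ∀ ξ, fourierSphMeasure d r ξ = ∫ x, eC (∑ i, x i * ξ i) ∂μ)
    {M : ℝ} (hM : μ.real Set.univ ≤ M) {C : ℝ} (hC0 : 0 ≤ C)
    (hC : ∀ ζ : Fin d → ℝ,
      ‖∫ t : Fin d → ℝ, (Ψ t : ℂ) * eC (∑ i, t i * ζ i)‖ ≤ C * ∏ i, (1 + ζ i ^ 2)⁻¹)
    {B : ℝ} (hB : ∀ t, |Ψ t| ≤ B) {A : ℝ} (hA : ∀ n, ‖kloosterman d q (radSq r : ℤ) n‖ ≤ A)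
    {p : ℝ} (hp1 : 1 ≤ p) (hp2 : p ≤ 2) :
    opNormLp d p (mulOp d (mHqr d q r Ψ)) ≤ ENNReal.ofReal
      ((q.totient * (C * (3 * ∑' n : ℤ, (1 + (n : ℝ) ^ 2)⁻¹) ^ d * M)) ^ (2 / p - 1) *
        (A * (B * M)) ^ (2 * (1 - 1 / p))) := by
  have hq0 : 0 < q := Nat.pos_of_ne_zero (NeZero.ne q)
  have hq : (q : ℝ) ≠ 0 := by exact_mod_cast NeZero.ne q
  set Φ : (Fin d → ℝ) → ℂ := fun η => (Ψ (fun i => (q : ℝ) * η i) : ℂ) *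
    ∫ x : EuclideanSpace ℝ (Fin d), eC (∑ i, x i * η i) ∂μ with hΦ
  have hm : mHqr d q r Ψ = fun ξ => ∑' n : Fin d → ℤ,
      kloosterman d q (radSq r : ℤ) n * Φ (fun i => ξ i - (n i : ℝ) / q) := by
    funext ξ
    refine tsum_congr fun n => ?_
    rw [hΦ, hμ, mul_assoc]
    congr 5
    funext i
    field_simp
  have hsupp : ∀ η, (∃ i, 1 / 4 < |(q : ℝ) * η i|) → Φ η = 0 := by
    rintro η ⟨i, hi⟩
    have : Ψ (fun i => (q : ℝ) * η i) = 0 := by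
      refine hΨ.2.1 _ fun hmem => hi.not_ge (abs_le.2 ⟨hmem.1 i, hmem.2 i⟩)
    simp [hΦ, this]
  have hcont : Continuous Φ :=
    (Complex.continuous_ofReal.comp (hΨ.continuous.comp (by fun_prop))).mul continuous_integral_eC
  have hM0 : 0 ≤ M := measureReal_nonneg.trans hM
  have hΦB : ∀ η, ‖Φ η‖ ≤ B * M := fun η => by
    rw [hΦ, norm_mul, Complex.norm_real]
    exact mul_le_mul (hB _) ((norm_integral_eC_le η).trans hM) (norm_nonneg _)
      ((abs_nonneg _).trans (hB 0))
  have hbd : ∀ ξ, ‖mHqr d q r Ψ ξ‖ ≤ A * (B * M) := fun ξ => by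
    rw [hm]
    exact norm_periodized_le hsupp hA hΦB ξ
  refine opNormLp_mulOp_le ?_ (fun Z => ?_) hbd hp1 hp2
  · have hmeas : Measurable (mHqr d q r Ψ) := by
      rw [hm]
      exact measurable_periodized hsupp hcont.measurable
    exact Integrable.of_bound hmeas.aestronglyMeasurable _ (Filter.Eventually.of_forall hbd)
  · rw [hm]
    simp only [mulKernel_periodized (kloosterman_add_mul _) (hΨ.integrable_dilate_mul hq0), hΦ]
    calc _ ≤ ∑ z ∈ Z, (q.totient : ℝ) * ‖∫ η, Φ η * eC (-∑ i, (z i : ℝ) * η i)‖ := by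
          refine Finset.sum_le_sum fun z _ => ?_
          rw [norm_mul]
          exact mul_le_mul_of_nonneg_right (norm_sum_kloosterman_mul_le _ z) (norm_nonneg _)
      _ ≤ q.totient * (C * (3 * ∑' n : ℤ, (1 + (n : ℝ) ^ 2)⁻¹) ^ d * μ.real Set.univ) := by
          rw [← Finset.mul_sum]
          exact mul_le_mul_of_nonneg_left (hΨ.sum_norm_integral_le hq0 hC0 hC Z) (by positivity)
      _ ≤ _ := by
          have : (0 : ℝ) ≤ ∑' n : ℤ, (1 + (n : ℝ) ^ 2)⁻¹ := tsum_nonneg fun n => by positivity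
          gcongr

theorem statement9 (d : ℕ) (hd : 4 ≤ d) (Ψ : (Fin d → ℝ) → ℝ) (hΨ : IsBump d Ψ)
    (p : ℝ) (hp1 : 1 ≤ p) (hp2 : p ≤ 2) (ε : ℝ) (hε : 0 < ε) :
    ∃ C : ℝ, 0 < C ∧ ∀ q : ℕ, 1 ≤ q → Odd q → ∀ r : ℝ, IsAdmissible r →
      opNormLp d p (mulOp d (mHqr d q r Ψ))
        ≤ ENNReal.ofReal (C * (Nat.totient q : ℝ) ^ (2 / p - 1)
            * (q : ℝ) ^ (-(((d : ℝ) - 1) * (1 - 1 / p)) + ε)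
            * (Nat.gcd q (radSq r) : ℝ) ^ (1 - 1 / p)) := by
  obtain ⟨M, hM, hμ⟩ := exists_fourierSphMeasure_eq (d := d) (by omega)
  obtain ⟨C₀, hC₀, hC⟩ := hΨ.exists_norm_ft_le
  obtain ⟨B, hB0, hB⟩ := hΨ.exists_abs_le
  obtain ⟨A, hA1, hA⟩ := exists_norm_kloosterman_le d hε
  set L : ℝ := C₀ * (3 * ∑' n : ℤ, (1 + (n : ℝ) ^ 2)⁻¹) ^ d * M with hL
  have hL0 : 0 ≤ L := by
    have : (0 : ℝ) ≤ ∑' n : ℤ, (1 + (n : ℝ) ^ 2)⁻¹ := tsum_nonneg fun n => by positivity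
    positivity
  have hp0 : 0 < p := by linarith
  have hp' : 0 ≤ 1 - 1 / p := by rw [sub_nonneg, div_le_one hp0]; exact hp1
  have hp'' : 2 * (1 - 1 / p) ≤ 1 := by
    have : 1 / 2 ≤ 1 / p := one_div_le_one_div_of_le hp0 hp2
    linarith
  have hp3 : 0 ≤ 2 / p - 1 := by rw [sub_nonneg, le_div_iff₀ hp0]; linarith
  refine ⟨(L + 1) ^ (2 / p - 1) * (A * (B * M)) ^ (2 * (1 - 1 / p)), by positivity,
    fun q hq hodd r hr => ?_⟩
  have : NeZero q := ⟨by omega⟩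
  have hq1 : (1 : ℝ) ≤ q := by exact_mod_cast hq
  have hq0 : (0 : ℝ) ≤ q := by linarith
  obtain ⟨μ, hfin, hμM, hμF⟩ := hμ r hr.1
  refine (opNormLp_mulOp_mHqr_le hΨ hμF hμM hC₀ hC hB (hA q hodd (radSq r)) hp1 hp2).trans
    (ENNReal.ofReal_le_ofReal ?_)
  rw [← hL]
  set g : ℝ := (Nat.gcd q (radSq r) : ℝ)
  have hg : 0 ≤ g := Nat.cast_nonneg _
  have h1 : ((q.totient : ℝ) * L) ^ (2 / p - 1)
      ≤ (L + 1) ^ (2 / p - 1) * (q.totient : ℝ) ^ (2 / p - 1) := by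
    rw [mul_comm ((L + 1) ^ _), ← Real.mul_rpow (Nat.cast_nonneg _) (by linarith)]
    gcongr
    linarith
  have h2 : (A * (q : ℝ) ^ (-(((d : ℝ) - 1) / 2) + ε) * g ^ (1 / 2 : ℝ) * (B * M))
        ^ (2 * (1 - 1 / p))
      ≤ (A * (B * M)) ^ (2 * (1 - 1 / p)) * (q : ℝ) ^ (-(((d : ℝ) - 1) * (1 - 1 / p)) + ε)
        * g ^ (1 - 1 / p) := by
    have : A * (q : ℝ) ^ (-(((d : ℝ) - 1) / 2) + ε) * g ^ (1 / 2 : ℝ) * (B * M)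
        = A * (B * M) * (q : ℝ) ^ (-(((d : ℝ) - 1) / 2) + ε) * g ^ (1 / 2 : ℝ) := by ring
    rw [this, Real.mul_rpow (by positivity) (by positivity),
      Real.mul_rpow (by positivity) (by positivity), ← Real.rpow_mul hg, ← Real.rpow_mul hq0]
    rw [show 1 / 2 * (2 * (1 - 1 / p)) = 1 - 1 / p by ring]
    gcongr
    nlinarith
  calc _ ≤ _ := mul_le_mul h1 h2 (by positivity) (by positivity)
    _ = _ := by ring

end
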